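/- Under the standing assumptions (fixed 0<ε<1/4, n^{1/2−o(1)} < k < sqrt((1/4−ε)·n·log n), Λ(Δ) < o(1) a.s., and φ ≤ φ*), almost surely H = H_k(n,p) does not contain a clique of size γ which has at most one vertex of clique-degree greater than λ and whose maximum clique-degree is less than τ. -/

import Mathlib

open Filter

noncomputable section

/-- The collection of all `k`-element subsets of `Fin n`. -/
def kSets (n k : ℕ) : Finset (Finset (Fin n)) := Finset.powersetCard k Finset.univ

open Classical in
/-- The probability that the random hypergraph `H_k(n,p)` (each `k`-subset of `[n]`
present independently with probability `p`) satisfies the property `P`. -/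
def hprob (n k : ℕ) (p : ℝ) (P : Finset (Finset (Fin n)) → Prop) : ℝ :=
  ∑ H ∈ (kSets n k).powerset,
    if P H then p ^ H.card * (1 - p) ^ ((kSets n k).card - H.card) else 0

/-- A family of sets is intersecting (a clique) if no two of its members are disjoint. -/
def IsClique {n : ℕ} (C : Finset (Finset (Fin n))) : Prop :=
  ∀ A ∈ C, ∀ B ∈ C, (A ∩ B).Nonempty

/-- The star of `x` in `H`: the set of edges of `H` containing `x`. -/
def starOf {n : ℕ} (H : Finset (Finset (Fin n))) (x : Fin n) : Finset (Finset (Fin n)) :=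
  H.filter (fun A => x ∈ A)

/-- The degree of `x` in `H`. -/
def vdeg {n : ℕ} (H : Finset (Finset (Fin n))) (x : Fin n) : ℕ := (starOf H x).card

/-- The maximum degree of `H`. -/
def maxDegree {n : ℕ} (H : Finset (Finset (Fin n))) : ℕ :=
  Finset.univ.sup (vdeg H)

/-- A family is nontrivial if it is not contained in a star. -/
def IsNontrivial {n : ℕ} (C : Finset (Finset (Fin n))) : Prop :=
  ¬ ∃ x : Fin n, ∀ A ∈ C, x ∈ A

/-- `H` satisfies (strong) EKR if every maximum-size intersecting subfamily of `H`
is a star of `H`. -/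
def EKR {n : ℕ} (H : Finset (Finset (Fin n))) : Prop :=
  ∀ C ⊆ H, IsClique C → (∀ D ⊆ H, IsClique D → D.card ≤ C.card) →
    ∃ x : Fin n, C = starOf H x

open Classical in
/-- `q = q(n,k)`: the probability that two independent uniform `k`-subsets of `[n]` meet. -/
def interProb (n k : ℕ) : ℝ :=
  ((((kSets n k) ×ˢ (kSets n k)).filter fun AB => (AB.1 ∩ AB.2).Nonempty).card : ℝ) /
    ((kSets n k).card : ℝ) ^ 2

/-- `φ = p·C(n-1,k-1)`, the expected degree of a vertex. -/
def phi (n k : ℕ) (p : ℝ) : ℝ := p * ((n - 1).choose (k - 1) : ℝ)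

/-- `μ̄ = φ·n/k`, the expected number of edges. -/
def mubar (n k : ℕ) (p : ℝ) : ℝ := phi n k p * n / k

/-- The generalized binomial coefficient `C(x,t) = x(x-1)⋯(x-t+1)/t!`. -/
def gchoose (x : ℝ) (t : ℕ) : ℝ := (∏ i ∈ Finset.range t, (x - i)) / (t.factorial : ℝ)

/-- `Λ(t) = C(μ̄,t)·q^{C(t,2)}`. -/
def Lam (n k : ℕ) (p : ℝ) (t : ℕ) : ℝ :=
  gchoose (mubar n k p) t * interProb n k ^ t.choose 2

/-- `Λ'(t)`: equals `0` for `t ≤ 2` and `Λ(t)` otherwise. -/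
def Lam' (n k : ℕ) (p : ℝ) (t : ℕ) : ℝ := if t ≤ 2 then 0 else Lam n k p t

open Classical in
/-- The probability of `E` for a uniform sample from the finite set `s`. -/
def uprob {α : Type*} (s : Finset α) (E : α → Prop) : ℝ :=
  ((s.filter E).card : ℝ) / (s.card : ℝ)

open Classical in
/-- The probability of `E` under the probability mass function `w` on `Ω`. -/
def wprob {Ω : Type*} [Fintype Ω] (w : Ω → ℝ) (E : Ω → Prop) : ℝ :=
  ∑ ω ∈ Finset.univ.filter E, w ω

open Classical in
/-- The probability that the family `{A_1,…,A_m}` formed by `m` independent uniform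
`k`-subsets of `[n]` satisfies `P`. -/
def iidprob (n k m : ℕ) (P : Finset (Finset (Fin n)) → Prop) : ℝ :=
  uprob ((Finset.univ : Finset (Fin m → Finset (Fin n))).filter fun f => ∀ i, f i ∈ kSets n k)
    (fun f => P (Finset.image f Finset.univ))

open Classical in
/-- The probability that the tuple `(A_1,…,A_m)` of independent uniform `k`-subsets of `[n]`
satisfies `P`. -/
def tupleProb (n k m : ℕ) (P : (Fin m → Finset (Fin n)) → Prop) : ℝ :=
  uprob ((Finset.univ : Finset (Fin m → Finset (Fin n))).filter fun f => ∀ i, f i ∈ kSets n k) P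

/-- `Pr(Bin(M,p) ≥ θ)`. -/
def binomProbGe (M : ℕ) (p : ℝ) (θ : ℕ) : ℝ :=
  ∑ j ∈ Finset.Icc θ M, (M.choose j : ℝ) * p ^ j * (1 - p) ^ (M - j)

/-- `φ* = log³ n / log(1/q)`. -/
def phiStar (n k : ℕ) : ℝ := (Real.log n) ^ 3 / Real.log (1 / interProb n k)

/-- `α₁`: the largest integer `t` with `Pr(Bin(C(n-1,k-1),p) ≥ t) ≥ ψ/n`, where `ψ = log n`. -/
def alpha1 (n k : ℕ) (p : ℝ) : ℕ :=
  sSup {t : ℕ | Real.log n / n ≤ binomProbGe ((n - 1).choose (k - 1)) p t}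

/-- `α₂ = min{t : Λ(t) ≤ σ}`. -/
def alpha2 (n k : ℕ) (p σn : ℝ) : ℕ := sInf {t : ℕ | Lam n k p t ≤ σn}

/-- `α = max{α₁, α₂}`. -/
def alphaP (n k : ℕ) (p σn : ℝ) : ℕ := max (alpha1 n k p) (alpha2 n k p σn)

/-- `γ = min{α, φ*/3}`. -/
def gammaP (n k : ℕ) (p σn : ℝ) : ℕ := min (alphaP n k p σn) ⌊phiStar n k / 3⌋₊

/-- `τ = (1-ε)·γ`. -/
def tauP (ε : ℝ) (n k : ℕ) (p σn : ℝ) : ℝ := (1 - ε) * (gammaP n k p σn : ℝ)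

/-- `λ = max{√(log n)/log(1/q), 2·√(log n/log(1/q))}`. -/
def lamP (n k : ℕ) : ℝ :=
  max (Real.sqrt (Real.log n) / Real.log (1 / interProb n k))
    (2 * Real.sqrt (Real.log n / Real.log (1 / interProb n k)))

/-- `w̄ = max{φ²k²/n, 6 log n}`. -/
def wbar (n k : ℕ) (p : ℝ) : ℝ := max (phi n k p ^ 2 * (k : ℝ) ^ 2 / n) (6 * Real.log n)

/-- `q̄ = (1 + 2k²w̄/(q n²))·q`. -/
def qbar (n k : ℕ) (p : ℝ) : ℝ :=
  (1 + 2 * (k : ℝ) ^ 2 * wbar n k p / (interProb n k * (n : ℝ) ^ 2)) * interProb n k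

open Classical in
/-- The probability that the random subset of `H`, keeping each element independently
with probability `ρ`, satisfies `P`. -/
def sprob {β : Type*} [DecidableEq β] (H : Finset β) (ρ : ℝ) (P : Finset β → Prop) : ℝ :=
  ∑ G ∈ H.powerset, if P G then ρ ^ G.card * (1 - ρ) ^ (H.card - G.card) else 0

/-- The degree of `v` in the multiset `{f 0, …, f (m-1)}` (with multiplicity). -/
def tdeg {n m : ℕ} (f : Fin m → Finset (Fin n)) (v : Fin n) : ℕ :=
  (Finset.univ.filter fun i => v ∈ f i).card

/-- An increasing (up-)event in `{0,1}^ι`. -/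
def IncrEvent {ι : Type*} (A : Set (ι → Bool)) : Prop :=
  ∀ x y : ι → Bool, y ≤ x → y ∈ A → x ∈ A

/-- The coordinate `i` affects the event `A`. -/
def Affects {ι : Type*} (i : ι) (A : Set (ι → Bool)) : Prop :=
  ∃ η ∈ A, ∃ ν, ν ∉ A ∧ ∀ j, j ≠ i → η j = ν j

/-- Negative association of a family of `{0,1}`-valued random variables, defined on the
finite probability space `Ω` with probability mass function `w`. -/
def NegAssoc {Ω ι : Type*} [Fintype Ω] (w : Ω → ℝ) (X : ι → Ω → Bool) : Prop :=
  ∀ A B : Set (ι → Bool), IncrEvent A → IncrEvent B →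
    (∀ i, ¬ (Affects i A ∧ Affects i B)) →
    wprob w (fun ω => (fun i => X i ω) ∈ A ∧ (fun i => X i ω) ∈ B) ≤
      wprob w (fun ω => (fun i => X i ω) ∈ A) * wprob w (fun ω => (fun i => X i ω) ∈ B)

/-- `X = X_1 + ⋯ + X_m` for `{0,1}`-valued random variables. -/
def bcount {Ω : Type*} {m : ℕ} (X : Fin m → Ω → Bool) (ω : Ω) : ℕ :=
  (Finset.univ.filter fun i => X i ω = true).card

end

open Filter

/-! ### Part 1: counting lemmas for uniform subsets -/

section Part1
variable {α : Type*} [DecidableEq α]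

theorem lym_up (V : Finset α) (P : Finset α → Prop) [DecidablePred P]
    (hP : ∀ A B, A ⊆ B → P A → P B) (l : ℕ) :
    ((V.powersetCard l).filter P).card * (V.card - l) ≤
      ((V.powersetCard (l + 1)).filter P).card * (l + 1) := by
  classical
  refine Finset.card_mul_le_card_mul (fun A B => A ⊆ B) ?_ ?_
  · intro A hA
    simp only [Finset.mem_filter, Finset.mem_powersetCard] at hA
    obtain ⟨⟨hAV, hAc⟩, hPA⟩ := hA
    have h1 : (V \ A).card = V.card - l := by
      rw [Finset.card_sdiff_of_subset hAV, hAc]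
    rw [← h1]
    refine Finset.card_le_card_of_injOn (fun v => insert v A) ?_ ?_
    · intro v hv
      simp only [Finset.coe_sdiff, Set.mem_sdiff, Finset.mem_coe] at hv
      simp only [Finset.bipartiteAbove, Finset.coe_filter, Finset.mem_filter,
        Finset.mem_powersetCard, Set.mem_ofPred_eq]
      refine ⟨⟨⟨Finset.insert_subset hv.1 hAV, ?_⟩, hP _ _ (Finset.subset_insert v A) hPA⟩,
        Finset.subset_insert v A⟩
      rw [Finset.card_insert_of_notMem hv.2, hAc]
    · intro v hv u hu huv
      simp only [Finset.coe_sdiff, Set.mem_sdiff, Finset.mem_coe] at hv hu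
      have : v ∈ insert u A := by
        have := Finset.mem_insert_self v A
        simp only at huv
        rwa [huv] at this
      rcases Finset.mem_insert.1 this with h | h
      · exact h
      · exact absurd h hv.2
  · intro B hB
    simp only [Finset.mem_filter, Finset.mem_powersetCard] at hB
    have : (Finset.powersetCard l B).card = l + 1 := by
      rw [Finset.card_powersetCard, hB.1.2, Nat.choose_succ_self_right]
    rw [← this]
    refine Finset.card_le_card ?_
    intro A hA
    simp only [Finset.bipartiteBelow, Finset.mem_filter, Finset.mem_powersetCard] at hA ⊢
    exact ⟨hA.2, hA.1.1.2⟩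

theorem lym_dens (V : Finset α) (P : Finset α → Prop) [DecidablePred P]
    (hP : ∀ A B, A ⊆ B → P A → P B) (l : ℕ) :
    ((V.powersetCard l).filter P).card * V.card.choose (l + 1) ≤
      ((V.powersetCard (l + 1)).filter P).card * V.card.choose l := by
  have h := lym_up V P hP l
  have h2 := Nat.choose_succ_right_eq V.card l
  have h3 : (((V.powersetCard l).filter P).card * V.card.choose (l + 1)) * (l + 1) ≤
      (((V.powersetCard (l + 1)).filter P).card * V.card.choose l) * (l + 1) := by
    calc _ = (((V.powersetCard l).filter P).card * (V.card - l)) * V.card.choose l := by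
            rw [mul_assoc, h2]; ring
      _ ≤ _ := Nat.mul_le_mul_right _ h
      _ = _ := by ring
  exact Nat.le_of_mul_le_mul_right h3 (Nat.succ_pos l)

theorem rem_one (V : Finset α) (P : Finset α → Prop) [DecidablePred P]
    (hP : ∀ A B, A ⊆ B → P A → P B) (v : α) (hv : v ∉ V)
    (hPv : ∀ B, P (insert v B) → P B) (l : ℕ) :
    (((insert v V).powersetCard l).filter P).card * V.card.choose l ≤
      ((V.powersetCard l).filter P).card * (V.card + 1).choose l := by
  cases l with
  | zero => simp
  | succ l =>
    rw [Finset.powersetCard_succ_insert hv, Finset.filter_union, Nat.choose_succ_succ']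
    have h1 : (Finset.filter P (Finset.image (insert v) (Finset.powersetCard l V))).card ≤
        ((V.powersetCard l).filter P).card := by
      have : Finset.filter P (Finset.image (insert v) (Finset.powersetCard l V)) ⊆
          Finset.image (insert v) ((V.powersetCard l).filter P) := by
        intro B hB
        simp only [Finset.mem_filter, Finset.mem_image] at hB ⊢
        obtain ⟨⟨A, hA, rfl⟩, hB⟩ := hB
        exact ⟨A, ⟨hA, hPv _ hB⟩, rfl⟩
      exact (Finset.card_le_card this).trans Finset.card_image_le
    have h2 := lym_dens V P hP l
    have h3 := Finset.card_union_le (Finset.filter P (Finset.powersetCard (l+1) V))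
      (Finset.filter P (Finset.image (insert v) (Finset.powersetCard l V)))
    calc _ ≤ (((V.powersetCard (l+1)).filter P).card + ((V.powersetCard l).filter P).card) *
          V.card.choose (l + 1) := Nat.mul_le_mul_right _ (h3.trans (by omega))
      _ ≤ _ := by rw [add_mul, mul_add]; omega

theorem rem_set (V : Finset α) (P : Finset α → Prop) [DecidablePred P]
    (hP : ∀ A B, A ⊆ B → P A → P B) (T : Finset α) (hd : Disjoint V T)
    (hPv : ∀ v ∈ T, ∀ B, P (insert v B) → P B) (l : ℕ) :
    (((V ∪ T).powersetCard l).filter P).card * V.card.choose l ≤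
      ((V.powersetCard l).filter P).card * (V.card + T.card).choose l := by
  induction T using Finset.induction_on with
  | empty => simp
  | insert v T hvT ih =>
    have hd' : Disjoint V T := hd.mono_right (Finset.subset_insert _ _)
    have hvV : v ∉ V := fun h => (Finset.disjoint_left.1 hd h) (Finset.mem_insert_self _ _)
    have ih := ih hd' (fun u hu => hPv u (Finset.mem_insert_of_mem hu))
    have hvu : v ∉ V ∪ T := by simp [hvT, hvV]
    have h1 := rem_one (V ∪ T) P hP v hvu (hPv v (Finset.mem_insert_self _ _)) l
    rw [Finset.card_union_of_disjoint hd'] at h1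
    rw [Finset.union_insert, Finset.card_insert_of_notMem hvT]
    rcases Nat.eq_zero_or_pos ((V.card + T.card).choose l) with h0 | h0
    · have : V.card.choose l = 0 := by
        have := Nat.choose_le_choose l (show V.card ≤ V.card + T.card by omega)
        omega
      rw [this]; simp
    · refine Nat.le_of_mul_le_mul_right ?_ h0
      calc _ = ((((insert v (V ∪ T)).powersetCard l).filter P).card *
              (V.card + T.card).choose l) * V.card.choose l := by ring
        _ ≤ _ := Nat.mul_le_mul_right _ h1
        _ = ((((V ∪ T).powersetCard l).filter P).card * V.card.choose l) *
              (V.card + T.card + 1).choose l := by ring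
        _ ≤ _ := Nat.mul_le_mul_right _ ih
        _ = _ := by rw [← add_assoc]; ring

/-- Hitting pairwise disjoint sets. -/
theorem hit_disj {ι : Type*} [DecidableEq ι] (V : Finset α) (l k : ℕ) (q : ℝ)
    (hq0 : 0 ≤ q)
    (hq : ∀ t ≤ k, (V.card.choose l : ℝ) * (1 - q) ≤ ((V.card - t).choose l : ℝ))
    (hl : l ≤ V.card)
    (J : Finset ι) (T : ι → Finset α) (hT : ∀ i ∈ J, T i ⊆ V) (hTc : ∀ i ∈ J, (T i).card ≤ k)
    (hdis : ∀ i ∈ J, ∀ j ∈ J, i ≠ j → Disjoint (T i) (T j)) :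
    (((V.powersetCard l).filter (fun B => ∀ i ∈ J, (B ∩ T i).Nonempty)).card : ℝ) ≤
      V.card.choose l * q ^ J.card := by
  induction J using Finset.induction_on with
  | empty => simp
  | insert i J hi ih =>
    have ih := ih (fun j hj => hT j (Finset.mem_insert_of_mem hj))
      (fun j hj => hTc j (Finset.mem_insert_of_mem hj))
      (fun a ha b hb => hdis a (Finset.mem_insert_of_mem ha) b (Finset.mem_insert_of_mem hb))
    set P : Finset α → Prop := fun B => ∀ j ∈ J, (B ∩ T j).Nonempty with hPdef
    have hPm : ∀ A B, A ⊆ B → P A → P B := fun A B hAB hA j hj =>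
      (hA j hj).mono (Finset.inter_subset_inter_right hAB)
    have hTi := hT i (Finset.mem_insert_self _ _)
    have hPv : ∀ v ∈ T i, ∀ B, P (insert v B) → P B := by
      intro v hv B hB j hj
      obtain ⟨u, hu⟩ := hB j hj
      have hij : i ≠ j := fun h => hi (h ▸ hj)
      have := hdis i (Finset.mem_insert_self _ _) j (Finset.mem_insert_of_mem hj) hij
      rw [Finset.mem_inter, Finset.mem_insert] at hu
      rcases hu.1 with h | h
      · subst h
        exact absurd hu.2 (Finset.disjoint_left.1 this hv)
      · exact ⟨u, Finset.mem_inter.2 ⟨h, hu.2⟩⟩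
    have hR := rem_set (V \ T i) P hPm (T i) Finset.sdiff_disjoint hPv l
    rw [Finset.sdiff_union_of_subset hTi, Finset.card_sdiff_add_card_eq_card hTi,
      Finset.card_sdiff_of_subset hTi] at hR
    have hsplit : ((V.powersetCard l).filter (fun B => ∀ j ∈ insert i J, (B ∩ T j).Nonempty)).card
        + (((V \ T i).powersetCard l).filter P).card ≤ ((V.powersetCard l).filter P).card := by
      rw [← Finset.card_union_of_disjoint]
      · refine Finset.card_le_card ?_
        intro B hB
        simp only [Finset.mem_union, Finset.mem_filter, Finset.mem_powersetCard] at hB ⊢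
        rcases hB with h | h
        · exact ⟨h.1, fun j hj => h.2 j (Finset.mem_insert_of_mem hj)⟩
        · exact ⟨⟨h.1.1.trans Finset.sdiff_subset, h.1.2⟩, h.2⟩
      · rw [Finset.disjoint_left]
        intro B hB hB2
        simp only [Finset.mem_filter, Finset.mem_powersetCard] at hB hB2
        obtain ⟨u, hu⟩ := hB.2 i (Finset.mem_insert_self _ _)
        rw [Finset.mem_inter] at hu
        have := hB2.1.1 hu.1
        rw [Finset.mem_sdiff] at this
        exact this.2 hu.2
    have hC : (0 : ℝ) < V.card.choose l := by exact_mod_cast Nat.choose_pos hl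
    have hq1 := hq (T i).card (hTc i (Finset.mem_insert_self _ _))
    rw [Finset.card_insert_of_notMem hi, pow_succ]
    have hR' : (((V.powersetCard l).filter P).card : ℝ) * ((V.card - (T i).card).choose l : ℝ) ≤
      (((V \ T i).powersetCard l).filter P).card * (V.card.choose l : ℝ) := by exact_mod_cast hR
    have hs' : (((V.powersetCard l).filter
        (fun B => ∀ j ∈ insert i J, (B ∩ T j).Nonempty)).card : ℝ)
        + (((V \ T i).powersetCard l).filter P).card ≤ ((V.powersetCard l).filter P).card := by
      exact_mod_cast hsplit
    have h5 : (((V.powersetCard l).filter P).card : ℝ) * (1 - q) ≤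
        (((V \ T i).powersetCard l).filter P).card := by
      have h6 : (((V.powersetCard l).filter P).card : ℝ) * (V.card.choose l * (1 - q)) ≤
        (((V \ T i).powersetCard l).filter P).card * (V.card.choose l : ℝ) :=
        (mul_le_mul_of_nonneg_left hq1 (by positivity)).trans hR'
      refine le_of_mul_le_mul_right ?_ hC
      linarith
    calc _ ≤ (((V.powersetCard l).filter P).card : ℝ) * q := by linarith
      _ ≤ (V.card.choose l * q ^ J.card) * q := mul_le_mul_of_nonneg_right ih hq0
      _ = _ := by ring

end Part1

open Filter

/-! ### Part 2: generating functions and the hitting lemma -/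

theorem choose_sup_le (n k : ℕ) (hkn : k ≤ n) (r : ℕ) (hr : r ≤ k) :
    (n - r).choose (k - r) * n ^ r ≤ n.choose k * k ^ r := by
  induction r with
  | zero => simp
  | succ r ih =>
    have ih := ih (by omega)
    obtain ⟨a, ha⟩ : ∃ a, n - r = a + 1 := ⟨n - r - 1, by omega⟩
    obtain ⟨b, hb⟩ : ∃ b, k - r = b + 1 := ⟨k - r - 1, by omega⟩
    have ha' : n - (r + 1) = a := by omega
    have hb' : k - (r + 1) = b := by omega
    rw [ha', hb']
    rw [ha, hb] at ih
    have h1 := Nat.add_one_mul_choose_eq a b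
    have h2 : n * (b + 1) ≤ k * (a + 1) := by
      rw [← ha, ← hb]
      zify [show r ≤ k by omega, show r ≤ n by omega]
      nlinarith [mul_le_mul_of_nonneg_left (show (k : ℤ) ≤ n by exact_mod_cast hkn)
        (show (0 : ℤ) ≤ r by positivity)]
    refine Nat.le_of_mul_le_mul_right (c := a + 1) ?_ (Nat.succ_pos a)
    calc a.choose b * n ^ (r + 1) * (a + 1) = ((a + 1) * a.choose b) * n ^ r * n := by ring
      _ = (a + 1).choose (b + 1) * n ^ r * (n * (b + 1)) := by rw [h1]; ring
      _ ≤ (n.choose k * k ^ r) * (k * (a + 1)) := Nat.mul_le_mul ih h2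
      _ = _ := by ring

theorem card_sup_le (n k : ℕ) (hkn : k ≤ n) (hn : 0 < n) (R : Finset (Fin n)) :
    (((kSets n k).filter (fun B => R ⊆ B)).card : ℝ) ≤
      n.choose k * ((k : ℝ) / n) ^ R.card := by
  classical
  by_cases hr : R.card ≤ k
  · have h1 : ((kSets n k).filter (fun B => R ⊆ B)).card ≤ (n - R.card).choose (k - R.card) := by
      have : (Finset.powersetCard (k - R.card) (Finset.univ \ R)).card =
          (n - R.card).choose (k - R.card) := by
        rw [Finset.card_powersetCard, Finset.card_sdiff_of_subset (Finset.subset_univ _),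
          Finset.card_univ, Fintype.card_fin]
      rw [← this]
      refine Finset.card_le_card_of_injOn (fun B => B \ R) ?_ ?_
      · intro B hB
        simp only [kSets, Finset.coe_filter, Finset.mem_powersetCard, Set.mem_ofPred_eq] at hB
        simp only [Finset.mem_coe, Finset.mem_powersetCard]
        refine ⟨Finset.sdiff_subset_sdiff (Finset.subset_univ _) le_rfl, ?_⟩
        rw [Finset.card_sdiff_of_subset hB.2, hB.1.2]
      · intro B hB B' hB' h
        simp only [kSets, Finset.coe_filter, Finset.mem_powersetCard, Set.mem_ofPred_eq] at hB hB'
        simp only at h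
        rw [← Finset.sdiff_union_of_subset hB.2, h, Finset.sdiff_union_of_subset hB'.2]
    have h2 := choose_sup_le n k hkn R.card hr
    have h3 : (((n - R.card).choose (k - R.card) : ℕ) : ℝ) * (n : ℝ) ^ R.card ≤
        (n.choose k : ℝ) * (k : ℝ) ^ R.card := by exact_mod_cast h2
    have hn' : (0 : ℝ) < (n : ℝ) ^ R.card := by positivity
    calc _ ≤ (((n - R.card).choose (k - R.card) : ℕ) : ℝ) := by exact_mod_cast h1
      _ ≤ (n.choose k : ℝ) * (k : ℝ) ^ R.card / (n : ℝ) ^ R.card := by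
          rw [le_div_iff₀ hn']; exact h3
      _ = _ := by rw [div_pow]; ring
  · have : (kSets n k).filter (fun B => R ⊆ B) = ∅ := by
      rw [Finset.filter_eq_empty_iff]
      intro B hB h
      simp only [kSets, Finset.mem_powersetCard] at hB
      have := Finset.card_le_card h
      omega
    rw [this]
    simp only [Finset.card_empty, Nat.cast_zero]
    positivity

theorem genfun_le (n k : ℕ) (hkn : k ≤ n) (hn : 0 < n) (y : Fin n → ℝ) (hy : ∀ v, 0 ≤ y v) :
    ∑ B ∈ kSets n k, ∏ v ∈ B, (1 + y v) ≤
      n.choose k * Real.exp ((k : ℝ) / n * ∑ v, y v) := by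
  classical
  have h1 : ∀ B ∈ kSets n k, ∏ v ∈ B, (1 + y v) =
      ∑ R ∈ (Finset.univ : Finset (Fin n)).powerset, if R ⊆ B then ∏ v ∈ R, y v else 0 := by
    intro B _
    rw [Finset.prod_one_add, ← Finset.sum_filter]
    refine Finset.sum_congr ?_ (fun _ _ => rfl)
    ext R; simp
  rw [Finset.sum_congr rfl h1, Finset.sum_comm]
  have h2 : ∀ R ∈ (Finset.univ : Finset (Fin n)).powerset,
      (∑ B ∈ kSets n k, if R ⊆ B then ∏ v ∈ R, y v else 0) ≤
        n.choose k * ∏ v ∈ R, ((k : ℝ) / n * y v) := by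
    intro R _
    rw [← Finset.sum_filter, Finset.sum_const, nsmul_eq_mul, Finset.prod_mul_distrib,
      Finset.prod_const, ← mul_assoc]
    exact mul_le_mul_of_nonneg_right (card_sup_le n k hkn hn R)
      (Finset.prod_nonneg (fun v _ => hy v))
  refine (Finset.sum_le_sum h2).trans ?_
  rw [← Finset.mul_sum, ← Finset.prod_one_add]
  refine mul_le_mul_of_nonneg_left ?_ (by positivity)
  rw [Finset.mul_sum, Real.exp_sum]
  refine Finset.prod_le_prod (fun v _ => ?_) (fun v _ => ?_)
  · have := hy v; positivity
  · have := Real.add_one_le_exp ((k : ℝ) / n * y v); linarith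

/-- degree of `v` in an indexed family -/
def ideg {ι : Type*} {n : ℕ} (C : Finset ι) (S : ι → Finset (Fin n)) (v : Fin n) : ℕ :=
  (C.filter (fun i => v ∈ S i)).card

theorem hit_lemma {ι : Type*} [DecidableEq ι] (n k : ℕ) (hkn : k ≤ n) (hn : 0 < n)
    (C : Finset ι) (S : ι → Finset (Fin n)) (hS : ∀ i ∈ C, (S i).card ≤ k)
    (W : Finset (Fin n)) (hW : ∀ v, 2 ≤ ideg C S v → v ∈ W) (hWk : W.card + k ≤ n)
    (q : ℝ) (hq0 : 0 < q) (hq1 : q ≤ 1)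
    (hq : ∀ l ≤ k, ∀ t ≤ k, ((n - W.card).choose l : ℝ) * (1 - q) ≤
      ((n - W.card - t).choose l : ℝ)) :
    (((kSets n k).filter (fun B => ∀ i ∈ C, (B ∩ S i).Nonempty)).card : ℝ) ≤
      n.choose k * q ^ C.card *
        Real.exp ((k : ℝ) / n * ∑ v ∈ W, ((1 / q) ^ ideg C S v - 1)) := by
  classical
  set J : Finset (Fin n) → Finset ι := fun R => C.filter (fun i => S i ∩ R = ∅) with hJ
  set Wc : Finset (Fin n) := Finset.univ \ W with hWc
  have hWcc : Wc.card = n - W.card := by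
    rw [hWc, Finset.card_sdiff_of_subset (Finset.subset_univ _), Finset.card_univ, Fintype.card_fin]
  -- fibre estimate
  have hfib : ∀ R ∈ W.powerset,
      (((kSets n k).filter (fun B => ∀ i ∈ C, (B ∩ S i).Nonempty)).filter
        (fun B => B ∩ W = R)).card ≤
      ∑ B ∈ (kSets n k).filter (fun B => B ∩ W = R), q ^ (J (B ∩ W)).card := by
    intro R hR
    rw [Finset.mem_powerset] at hR
    have e1 : ∑ B ∈ (kSets n k).filter (fun B => B ∩ W = R), q ^ (J (B ∩ W)).card =
        (((kSets n k).filter (fun B => B ∩ W = R)).card : ℝ) * q ^ (J R).card := by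
      rw [Finset.sum_congr rfl (g := fun _ => q ^ (J R).card), Finset.sum_const, nsmul_eq_mul]
      intro B hB
      rw [(Finset.mem_filter.1 hB).2]
    rw [e1]
    by_cases hRk : R.card ≤ k
    swap
    · have : (((kSets n k).filter (fun B => ∀ i ∈ C, (B ∩ S i).Nonempty)).filter
        (fun B => B ∩ W = R)) = ∅ := by
        rw [Finset.filter_eq_empty_iff]
        intro B hB h
        simp only [kSets, Finset.mem_filter, Finset.mem_powersetCard] at hB
        have := Finset.card_le_card (Finset.inter_subset_left (s₁ := B) (s₂ := W))
        rw [h] at this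
        omega
      rw [this]; simp only [Finset.card_empty, Nat.cast_zero]
      positivity
    have e2 : (Wc.powersetCard (k - R.card)).card ≤
        ((kSets n k).filter (fun B => B ∩ W = R)).card := by
      refine Finset.card_le_card_of_injOn (fun B => B ∪ R) ?_ ?_
      · intro B hB
        simp only [Finset.mem_coe, Finset.mem_powersetCard] at hB
        simp only [kSets, Finset.coe_filter, Finset.mem_powersetCard, Set.mem_ofPred_eq]
        have hdW : Disjoint B W := Finset.disjoint_of_subset_left hB.1 Finset.sdiff_disjoint
        have hd : Disjoint B R := hdW.mono_right hR
        refine ⟨⟨Finset.subset_univ _, ?_⟩, ?_⟩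
        · rw [Finset.card_union_of_disjoint hd, hB.2]; omega
        · rw [Finset.union_inter_distrib_right, Finset.disjoint_iff_inter_eq_empty.1 hdW,
            Finset.empty_union, Finset.inter_eq_left.2 hR]
      · intro B hB B' hB' h
        simp only [Finset.mem_coe, Finset.mem_powersetCard] at hB hB'
        have hd : Disjoint B R :=
          (Finset.disjoint_of_subset_left hB.1 Finset.sdiff_disjoint).mono_right hR
        have hd' : Disjoint B' R :=
          (Finset.disjoint_of_subset_left hB'.1 Finset.sdiff_disjoint).mono_right hR
        simp only at h
        rw [← Finset.union_sdiff_cancel_right hd, h, Finset.union_sdiff_cancel_right hd']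
    have e3 : (((kSets n k).filter (fun B => ∀ i ∈ C, (B ∩ S i).Nonempty)).filter
        (fun B => B ∩ W = R)).card ≤
        ((Wc.powersetCard (k - R.card)).filter
          (fun B => ∀ i ∈ J R, (B ∩ (S i \ W)).Nonempty)).card := by
      refine Finset.card_le_card_of_injOn (fun B => B \ W) ?_ ?_
      · intro B hB
        simp only [kSets, Finset.coe_filter, Finset.mem_filter, Finset.mem_powersetCard,
          Set.mem_ofPred_eq] at hB ⊢
        obtain ⟨⟨⟨_, hBk⟩, hBC⟩, hBR⟩ := hB
        refine ⟨⟨Finset.sdiff_subset_sdiff (Finset.subset_univ _) le_rfl, ?_⟩, ?_⟩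
        · have := Finset.card_sdiff_add_card_inter B W
          rw [hBR] at this; omega
        · intro i hi
          simp only [hJ, Finset.mem_filter] at hi
          obtain ⟨u, hu⟩ := hBC i hi.1
          rw [Finset.mem_inter] at hu
          have huW : u ∉ W := by
            intro huW
            have h1 : u ∈ R := by rw [← hBR]; exact Finset.mem_inter.2 ⟨hu.1, huW⟩
            have h2 : u ∈ S i ∩ R := Finset.mem_inter.2 ⟨hu.2, h1⟩
            rw [hi.2] at h2
            exact absurd h2 (Finset.notMem_empty _)
          exact ⟨u, by simp [hu.1, hu.2, huW]⟩
      · intro B hB B' hB' h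
        simp only [Finset.coe_filter, Set.mem_ofPred_eq] at hB hB'
        simp only at h
        rw [← Finset.sdiff_union_inter B W, h, hB.2, ← hB'.2, Finset.sdiff_union_inter]
    have e4 := hit_disj Wc (k - R.card) k q hq0.le
      (by intro t ht; rw [hWcc]; exact hq _ (by omega) t ht) (by rw [hWcc]; omega)
      (J R) (fun i => S i \ W)
      (fun i _ => Finset.sdiff_subset_sdiff (Finset.subset_univ _) le_rfl)
      (fun i hi => (Finset.card_le_card Finset.sdiff_subset).trans
        (hS i (Finset.mem_filter.1 hi).1))
      (by
        intro i hi j hj hij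
        rw [Finset.disjoint_left]
        intro v hv hv'
        rw [Finset.mem_sdiff] at hv hv'
        apply hv.2
        apply hW
        unfold ideg
        have : ({i, j} : Finset ι) ⊆ C.filter (fun i => v ∈ S i) := by
          intro a ha
          simp only [Finset.mem_insert, Finset.mem_singleton] at ha
          rw [Finset.mem_filter]
          rcases ha with rfl | rfl
          · exact ⟨(Finset.mem_filter.1 hi).1, hv.1⟩
          · exact ⟨(Finset.mem_filter.1 hj).1, hv'.1⟩
        have h2 := Finset.card_le_card this
        rwa [Finset.card_pair hij] at h2)
    rw [Finset.card_powersetCard] at e2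
    calc _ ≤ (((Wc.powersetCard (k - R.card)).filter
          (fun B => ∀ i ∈ J R, (B ∩ (S i \ W)).Nonempty)).card : ℝ) := by exact_mod_cast e3
      _ ≤ Wc.card.choose (k - R.card) * q ^ (J R).card := e4
      _ ≤ _ := mul_le_mul_of_nonneg_right (by exact_mod_cast e2) (by positivity)
  have hsum : (((kSets n k).filter (fun B => ∀ i ∈ C, (B ∩ S i).Nonempty)).card : ℝ) ≤
      ∑ B ∈ kSets n k, q ^ (J (B ∩ W)).card := by
    rw [Finset.card_eq_sum_card_fiberwise (f := fun B => B ∩ W) (t := W.powerset)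
      (fun B _ => by simp), ← Finset.sum_fiberwise_of_maps_to (s := kSets n k)
      (g := fun B => B ∩ W) (t := W.powerset) (fun B _ => by simp)]
    push_cast
    exact Finset.sum_le_sum hfib
  refine hsum.trans ?_
  have hterm : ∀ B ∈ kSets n k, q ^ (J (B ∩ W)).card ≤
      q ^ C.card * ∏ v ∈ B, (1 + if v ∈ W then ((1 / q) ^ ideg C S v - 1) else 0) := by
    intro B _
    have h1 : C.card ≤ (J (B ∩ W)).card + ∑ v ∈ B ∩ W, ideg C S v := by
      have hsub : C ⊆ J (B ∩ W) ∪ (B ∩ W).biUnion (fun v => C.filter (fun i => v ∈ S i)) := by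
        intro i hi
        rw [Finset.mem_union]
        by_cases h : S i ∩ (B ∩ W) = ∅
        · left; exact Finset.mem_filter.2 ⟨hi, h⟩
        · right
          obtain ⟨v, hv⟩ := Finset.nonempty_iff_ne_empty.2 h
          rw [Finset.mem_inter] at hv
          exact Finset.mem_biUnion.2 ⟨v, hv.2, Finset.mem_filter.2 ⟨hi, hv.1⟩⟩
      exact (Finset.card_le_card hsub).trans ((Finset.card_union_le _ _).trans
        (Nat.add_le_add_left Finset.card_biUnion_le _))
    have h2 : ∏ v ∈ B, (1 + if v ∈ W then ((1 / q) ^ ideg C S v - 1) else 0) =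
        (1 / q) ^ (∑ v ∈ B ∩ W, ideg C S v) := by
      rw [← Finset.prod_pow_eq_pow_sum, ← Finset.filter_mem_eq_inter, Finset.prod_filter]
      refine Finset.prod_congr rfl (fun v _ => ?_)
      split_ifs <;> ring
    rw [h2]
    have h3 : q ^ ((J (B ∩ W)).card + ∑ v ∈ B ∩ W, ideg C S v) ≤ q ^ C.card :=
      pow_le_pow_of_le_one hq0.le hq1 h1
    rw [one_div, inv_pow, ← div_eq_mul_inv, le_div_iff₀ (by positivity), ← pow_add]
    exact h3
  refine (Finset.sum_le_sum hterm).trans ?_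
  rw [← Finset.mul_sum]
  have h1q : 1 ≤ 1 / q := by rw [le_div_iff₀ hq0]; linarith
  have hg := genfun_le n k hkn hn (fun v => if v ∈ W then ((1 / q) ^ ideg C S v - 1) else 0)
    (by
      intro v
      have : (1 : ℝ) ≤ (1 / q) ^ ideg C S v := one_le_pow₀ h1q
      split_ifs <;> linarith)
  rw [← Finset.sum_filter] at hg
  have hWf : Finset.univ.filter (fun v => v ∈ W) = W := by ext; simp
  rw [hWf] at hg
  calc _ ≤ _ := mul_le_mul_of_nonneg_left hg (by positivity)
    _ = _ := by ring

open Filter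

/-! ### Part 3: the intersection probability -/

theorem choose_ratio_mono (N M l j : ℕ) (hMN : M ≤ N) :
    N.choose l * M.choose (l + j) ≤ M.choose l * N.choose (l + j) := by
  induction j with
  | zero => simp [mul_comm]
  | succ j ih =>
    have h1 := Nat.choose_succ_right_eq M (l + j)
    have h2 := Nat.choose_succ_right_eq N (l + j)
    refine Nat.le_of_mul_le_mul_right (c := l + j + 1) ?_ (Nat.succ_pos _)
    calc N.choose l * M.choose (l + j + 1) * (l + j + 1)
        = (N.choose l * M.choose (l + j)) * (M - (l + j)) := by rw [mul_assoc, h1]; ring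
      _ ≤ (M.choose l * N.choose (l + j)) * (N - (l + j)) := Nat.mul_le_mul ih (by omega)
      _ = M.choose l * N.choose (l + j + 1) * (l + j + 1) := by
          rw [mul_assoc, mul_assoc, h2]

theorem choose_succ_real (N l : ℕ) (h : l ≤ N) :
    (N.choose (l + 1) : ℝ) * (l + 1) = N.choose l * ((N : ℝ) - l) := by
  have := Nat.choose_succ_right_eq N l
  have h2 : ((N - l : ℕ) : ℝ) = (N : ℝ) - l := by push_cast [Nat.cast_sub h]; ring
  rw [← h2]
  exact_mod_cast this

/-- `C(n-k,k)/C(n,k)`, the probability of missing. -/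
noncomputable def rho (n k : ℕ) : ℝ := ((n - k).choose k : ℝ) / (n.choose k : ℝ)

theorem rho_mono_use (N k : ℕ) (hk : k ≤ N) (l : ℕ) (hl : l ≤ k) (t : ℕ) (ht : t ≤ k) :
    (N.choose l : ℝ) * rho N k ≤ ((N - t).choose l : ℝ) := by
  have hpos : (0 : ℝ) < N.choose k := by exact_mod_cast Nat.choose_pos hk
  have h1 := choose_ratio_mono N (N - k) l (k - l) (by omega)
  rw [show l + (k - l) = k by omega] at h1
  have h2 : (N - k).choose l ≤ (N - t).choose l := Nat.choose_le_choose l (by omega)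
  have h1' : (N.choose l : ℝ) * (N - k).choose k ≤ (N - k).choose l * N.choose k := by
    exact_mod_cast h1
  have h2' : ((N - k).choose l : ℝ) ≤ (N - t).choose l := by exact_mod_cast h2
  unfold rho
  rw [← mul_div_assoc, div_le_iff₀ hpos]
  exact h1'.trans (mul_le_mul_of_nonneg_right h2' hpos.le)

theorem rho_shift_aux (n k w : ℕ) (h : w + 2 * k < n) (ξ : ℝ) (hξ0 : 0 ≤ ξ) (hξ1 : ξ ≤ 1)
    (hξ : (w : ℝ) * k ≤ ξ * (((n : ℝ) - w - k) * ((n : ℝ) - 2 * k))) (l : ℕ) (hl : l ≤ k) :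
    (1 - l * ξ) * (((n - w).choose l : ℝ) * ((n - k).choose l : ℝ)) ≤
      ((n - w - k).choose l : ℝ) * (n.choose l : ℝ) := by
  induction l with
  | zero => simp
  | succ l ih =>
    have ih := ih (by omega)
    have e1 := choose_succ_real (n - w) l (by omega)
    have e2 := choose_succ_real (n - k) l (by omega)
    have e3 := choose_succ_real (n - w - k) l (by omega)
    have e4 := choose_succ_real n l (by omega)
    have c1 : ((n - w : ℕ) : ℝ) = (n : ℝ) - w := by push_cast [Nat.cast_sub (show w ≤ n by omega)]; ring
    have c2 : ((n - k : ℕ) : ℝ) = (n : ℝ) - k := by push_cast [Nat.cast_sub (show k ≤ n by omega)]; ring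
    have c3 : ((n - w - k : ℕ) : ℝ) = (n : ℝ) - w - k := by
      rw [Nat.cast_sub (show k ≤ n - w by omega), c1]
    rw [c1] at e1; rw [c2] at e2; rw [c3] at e3
    have hlk : (l : ℝ) ≤ k := by exact_mod_cast (by omega : l ≤ k)
    have hn : (w : ℝ) + 2 * k < n := by exact_mod_cast h
    have hk0 : (0 : ℝ) ≤ k := by positivity
    have hw0 : (0 : ℝ) ≤ w := by positivity
    have hl0 : (0 : ℝ) ≤ l := by positivity
    set a := ((n - w).choose l : ℝ)
    set b := ((n - k).choose l : ℝ)
    set c := ((n - w - k).choose l : ℝ)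
    set d := (n.choose l : ℝ)
    have ha : 0 ≤ a := by positivity
    have hb : 0 ≤ b := by positivity
    have hc : 0 ≤ c := by positivity
    have hd : 0 ≤ d := by positivity
    set G := ((n : ℝ) - w - l) * ((n : ℝ) - k - l) with hG
    set F := ((n : ℝ) - w - k - l) * ((n : ℝ) - l) with hF
    have hG0 : 0 ≤ G := mul_nonneg (by linarith) (by linarith)
    have hFG : (1 - ξ) * G ≤ F := by
      have h1 : F = G - w * k := by rw [hG, hF]; ring
      have h2 : ((n : ℝ) - w - k) * ((n : ℝ) - 2 * k) ≤ G :=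
        mul_le_mul (by linarith) (by linarith) (by linarith) (by linarith)
      have h3 := mul_le_mul_of_nonneg_left h2 hξ0
      rw [h1]; linarith
    have hpos : (0 : ℝ) < (l + 1) * (l + 1) := by positivity
    refine le_of_mul_le_mul_right ?_ hpos
    push_cast
    have key : (1 - (l + 1) * ξ) * (a * b) * G ≤ c * d * F := by
      have s1 : (1 - (l + 1) * ξ) * ((a * b) * G) ≤ ((1 - l * ξ) * (1 - ξ)) * ((a * b) * G) := by
        apply mul_le_mul_of_nonneg_right _ (by positivity)
        nlinarith [mul_nonneg hl0 (mul_nonneg hξ0 hξ0)]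
      have s2 : ((1 - l * ξ) * (a * b)) * ((1 - ξ) * G) ≤ (c * d) * ((1 - ξ) * G) :=
        mul_le_mul_of_nonneg_right ih (mul_nonneg (by linarith) hG0)
      have s3 : (c * d) * ((1 - ξ) * G) ≤ (c * d) * F :=
        mul_le_mul_of_nonneg_left hFG (by positivity)
      linarith
    calc (1 - ((l : ℝ) + 1) * ξ) * (((n - w).choose (l + 1) : ℝ) * ((n - k).choose (l + 1) : ℝ)) * ((l + 1) * (l + 1))
        = (1 - (l + 1) * ξ) * ((((n - w).choose (l + 1) : ℝ) * (l + 1)) * (((n - k).choose (l + 1) : ℝ) * (l + 1))) := by ring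
      _ = (1 - (l + 1) * ξ) * (a * b) * G := by rw [e1, e2]; ring
      _ ≤ c * d * F := key
      _ = (((n - w - k).choose (l + 1) : ℝ) * (l + 1)) * ((n.choose (l + 1) : ℝ) * (l + 1)) := by
          rw [e3, e4]; ring
      _ = _ := by ring

theorem rho_shift (n k w : ℕ) (h : w + 2 * k < n) (ζ : ℝ) (hζ0 : 0 ≤ ζ) (hζ1 : ζ ≤ 1) (hk : 1 ≤ k)
    (hζ : (w : ℝ) * k ^ 2 ≤ ζ * (((n : ℝ) - w - k) * ((n : ℝ) - 2 * k))) :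
    (1 - ζ) * rho n k ≤ rho (n - w) k := by
  have hk0 : (1 : ℝ) ≤ k := by exact_mod_cast hk
  have hkp : (0 : ℝ) < k := by linarith
  have h1 := rho_shift_aux n k w h (ζ / k) (by positivity)
    (by rw [div_le_one hkp]; linarith) (by
      rw [div_mul_eq_mul_div, le_div_iff₀ hkp]; linarith) k le_rfl
  rw [mul_div_cancel₀ _ hkp.ne'] at h1
  have p1 : (0 : ℝ) < n.choose k := by exact_mod_cast Nat.choose_pos (by omega)
  have p2 : (0 : ℝ) < (n - w).choose k := by exact_mod_cast Nat.choose_pos (by omega)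
  unfold rho
  rw [← mul_div_assoc, div_le_div_iff₀ p1 p2]
  linarith

theorem rho_le (n k : ℕ) (h : 2 * k < n) : rho n k ≤ (1 - (k : ℝ) / n) ^ k := by
  have aux : ∀ l ≤ k, ((n - k).choose l : ℝ) * (n : ℝ) ^ l ≤ n.choose l * ((n : ℝ) - k) ^ l := by
    intro l
    induction l with
    | zero => simp
    | succ l ih =>
      intro hl
      have ih := ih (by omega)
      have e2 := choose_succ_real (n - k) l (by omega)
      have e4 := choose_succ_real n l (by omega)
      rw [Nat.cast_sub (show k ≤ n by omega)] at e2
      have hlk : (l : ℝ) ≤ k := by exact_mod_cast (by omega : l ≤ k)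
      have hn : 2 * (k : ℝ) < n := by exact_mod_cast h
      have hk0 : (0 : ℝ) ≤ k := by positivity
      have hl0 : (0 : ℝ) ≤ l := by positivity
      refine le_of_mul_le_mul_right ?_ (show (0 : ℝ) < l + 1 by positivity)
      calc ((n - k).choose (l + 1) : ℝ) * (n : ℝ) ^ (l + 1) * (l + 1)
          = (((n - k).choose (l + 1) : ℝ) * (l + 1)) * (n : ℝ) ^ l * n := by ring
        _ = (((n - k).choose l : ℝ) * (n : ℝ) ^ l) * (((n : ℝ) - k - l) * n) := by rw [e2]; ring
        _ ≤ (n.choose l * ((n : ℝ) - k) ^ l) * (((n : ℝ) - l) * ((n : ℝ) - k)) := by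
            have : ((n : ℝ) - k) ≥ 0 := by linarith
            have : ((n : ℝ) - k - l) ≥ 0 := by linarith
            apply mul_le_mul ih _ (by positivity) (by positivity)
            nlinarith [mul_nonneg hk0 hl0]
        _ = ((n.choose (l + 1) : ℝ) * (l + 1)) * ((n : ℝ) - k) ^ l * ((n : ℝ) - k) := by
            rw [e4]; ring
        _ = _ := by ring
  have h1 := aux k le_rfl
  have p1 : (0 : ℝ) < n.choose k := by exact_mod_cast Nat.choose_pos (by omega)
  have hn0 : (0 : ℝ) < n := by exact_mod_cast (by omega : 0 < n)
  unfold rho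
  rw [one_sub_div hn0.ne', div_pow, div_le_div_iff₀ p1 (by positivity)]
  linarith

theorem rho_ge (n k : ℕ) (h : 2 * k < n) :
    (((n : ℝ) - 2 * k) / ((n : ℝ) - k)) ^ k ≤ rho n k := by
  have aux : ∀ l ≤ k, (n.choose l : ℝ) * ((n : ℝ) - 2 * k) ^ l ≤
      (n - k).choose l * ((n : ℝ) - k) ^ l := by
    intro l
    induction l with
    | zero => simp
    | succ l ih =>
      intro hl
      have ih := ih (by omega)
      have e2 := choose_succ_real (n - k) l (by omega)
      have e4 := choose_succ_real n l (by omega)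
      rw [Nat.cast_sub (show k ≤ n by omega)] at e2
      have hlk : (l : ℝ) ≤ k := by exact_mod_cast (by omega : l ≤ k)
      have hn : 2 * (k : ℝ) < n := by exact_mod_cast h
      have hk0 : (0 : ℝ) ≤ k := by positivity
      have hl0 : (0 : ℝ) ≤ l := by positivity
      have g1 : ((n : ℝ) - k) ≥ 0 := by linarith
      have g2 : ((n : ℝ) - l) ≥ 0 := by linarith
      have g3 : ((n : ℝ) - 2 * k) ≥ 0 := by linarith
      refine le_of_mul_le_mul_right ?_ (show (0 : ℝ) < l + 1 by positivity)
      calc (n.choose (l + 1) : ℝ) * ((n : ℝ) - 2 * k) ^ (l + 1) * (l + 1)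
          = ((n.choose (l + 1) : ℝ) * (l + 1)) * ((n : ℝ) - 2 * k) ^ l * ((n : ℝ) - 2 * k) := by ring
        _ = ((n.choose l : ℝ) * ((n : ℝ) - 2 * k) ^ l) * (((n : ℝ) - l) * ((n : ℝ) - 2 * k)) := by
            rw [e4]; ring
        _ ≤ ((n - k).choose l * ((n : ℝ) - k) ^ l) * (((n : ℝ) - k - l) * ((n : ℝ) - k)) := by
            apply mul_le_mul ih _ (by positivity) (by positivity)
            nlinarith [mul_nonneg hk0 (sub_nonneg.2 hlk)]
        _ = (((n - k).choose (l + 1) : ℝ) * (l + 1)) * ((n : ℝ) - k) ^ l * ((n : ℝ) - k) := by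
            rw [e2]; ring
        _ = _ := by ring
  have h1 := aux k le_rfl
  have p1 : (0 : ℝ) < n.choose k := by exact_mod_cast Nat.choose_pos (by omega)
  have hn : 2 * (k : ℝ) < n := by exact_mod_cast h
  have hk0 : (0 : ℝ) ≤ k := by positivity
  have g1 : ((n : ℝ) - k) > 0 := by linarith
  unfold rho
  rw [div_pow, div_le_div_iff₀ (by positivity) p1]
  linarith

theorem rho_ge_exp (n k : ℕ) (h : 2 * k < n) :
    Real.exp (-((k : ℝ) ^ 2 / ((n : ℝ) - 2 * k))) ≤ rho n k := by
  refine le_trans ?_ (rho_ge n k h)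
  have hn : 2 * (k : ℝ) < n := by exact_mod_cast h
  have hk0 : (0 : ℝ) ≤ k := by positivity
  have g1 : ((n : ℝ) - k) > 0 := by linarith
  have g3 : ((n : ℝ) - 2 * k) > 0 := by linarith
  have h1 : Real.exp (-((k : ℝ) / ((n : ℝ) - 2 * k))) ≤ ((n : ℝ) - 2 * k) / ((n : ℝ) - k) := by
    rw [Real.exp_neg]
    have h2 := Real.add_one_le_exp ((k : ℝ) / ((n : ℝ) - 2 * k))
    have h3 : ((n : ℝ) - 2 * k) / ((n : ℝ) - k) = ((k : ℝ) / ((n : ℝ) - 2 * k) + 1)⁻¹ := by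
      field_simp; ring
    rw [h3]
    exact inv_anti₀ (by positivity) h2
  have h4 : Real.exp (-((k : ℝ) ^ 2 / ((n : ℝ) - 2 * k))) =
      Real.exp (-((k : ℝ) / ((n : ℝ) - 2 * k))) ^ k := by
    rw [← Real.exp_nat_mul]; congr 1; ring
  rw [h4]
  exact pow_le_pow_left₀ (Real.exp_pos _).le h1 k

theorem rho_le_exp (n k : ℕ) (h : 2 * k < n) :
    rho n k ≤ Real.exp (-((k : ℝ) ^ 2 / n)) := by
  refine (rho_le n k h).trans ?_
  have hn : 2 * (k : ℝ) < n := by exact_mod_cast h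
  have hk0 : (0 : ℝ) ≤ k := by positivity
  have hn0 : (0 : ℝ) < n := by linarith
  have h4 : Real.exp (-((k : ℝ) ^ 2 / n)) = Real.exp (-((k : ℝ) / n)) ^ k := by
    rw [← Real.exp_nat_mul]; congr 1; ring
  rw [h4]
  refine pow_le_pow_left₀ ?_ (by have := Real.add_one_le_exp (-((k : ℝ) / n)); linarith) k
  have : (k : ℝ) / n ≤ 1 := by rw [div_le_one hn0]; linarith
  linarith

theorem card_kSets (n k : ℕ) : (kSets n k).card = n.choose k := by
  simp [kSets]

theorem interProb_eq (n k : ℕ) (hk : k ≤ n) : interProb n k = 1 - rho n k := by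
  classical
  have hpos : (0 : ℝ) < n.choose k := by exact_mod_cast Nat.choose_pos hk
  have h1 : (((kSets n k) ×ˢ (kSets n k)).filter fun AB => ¬ (AB.1 ∩ AB.2).Nonempty).card =
      n.choose k * (n - k).choose k := by
    rw [Finset.card_filter, Finset.sum_product]
    have : ∀ A ∈ kSets n k, (∑ B ∈ kSets n k, if ¬ (A ∩ B).Nonempty then 1 else 0) =
        (n - k).choose k := by
      intro A hA
      rw [← Finset.card_filter]
      have hA' : A.card = k := by simp [kSets] at hA; exact hA
      have e : (kSets n k).filter (fun B => ¬ (A ∩ B).Nonempty) =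
          Finset.powersetCard k (Finset.univ \ A) := by
        ext B
        simp only [kSets, Finset.mem_filter, Finset.mem_powersetCard, Finset.subset_univ,
          true_and, Finset.not_nonempty_iff_eq_empty, ← Finset.disjoint_iff_inter_eq_empty]
        constructor
        · rintro ⟨h1, h2⟩
          refine ⟨?_, h1⟩
          intro v hv
          simp only [Finset.mem_sdiff, Finset.mem_univ, true_and]
          exact fun hvA => Finset.disjoint_left.1 h2 hvA hv
        · rintro ⟨h1, h2⟩
          exact ⟨h2, Finset.disjoint_of_subset_right h1 Finset.disjoint_sdiff⟩
      rw [e, Finset.card_powersetCard, Finset.card_sdiff_of_subset (Finset.subset_univ _),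
        Finset.card_univ, Fintype.card_fin, hA']
    rw [Finset.sum_congr rfl this, Finset.sum_const, card_kSets, smul_eq_mul]
  have h2 := Finset.card_filter_add_card_filter_not
    (s := (kSets n k) ×ˢ (kSets n k)) (fun AB => (AB.1 ∩ AB.2).Nonempty)
  rw [Finset.card_product, card_kSets] at h2
  have h3 : ((((kSets n k) ×ˢ (kSets n k)).filter fun AB => (AB.1 ∩ AB.2).Nonempty).card : ℝ)
      = (n.choose k : ℝ) * n.choose k - (n.choose k : ℝ) * (n - k).choose k := by
    rw [eq_sub_iff_add_eq]
    rw [h1] at h2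
    exact_mod_cast h2
  unfold interProb rho
  rw [card_kSets]
  have h3' : (((((kSets n k) ×ˢ (kSets n k)).filter fun AB => (AB.1 ∩ AB.2).Nonempty).card : ℕ) : ℝ)
    = _ := h3
  convert_to (((((kSets n k) ×ˢ (kSets n k)).filter fun AB => (AB.1 ∩ AB.2).Nonempty).card : ℕ) : ℝ)
    / (n.choose k : ℝ) ^ 2 = _
  rw [h3']
  field_simp

open Filter

/-! ### Part 4: counting families -/

/-- number of (pair, vertex) incidences outside `X` -/
def SX {n : ℕ} (X : Finset (Fin n)) (C : Finset (Finset (Fin n))) : ℕ :=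
  ∑ v ∈ Finset.univ \ X, (vdeg C v).choose 2

theorem two_le_choose (d : ℕ) (hd : 2 ≤ d) : d ≤ 2 * d.choose 2 ∧ 1 ≤ d.choose 2 := by
  have h := Nat.choose_two_right d
  have h2 : d * (d - 1) = 2 * d.choose 2 := by
    rw [h]
    exact (Nat.mul_div_cancel' (Nat.even_mul_pred_self d).two_dvd).symm
  have h3 : d * 1 ≤ d * (d - 1) := Nat.mul_le_mul_left _ (by omega)
  constructor <;> omega

theorem exp_sub_one_le (x : ℝ) : Real.exp x - 1 ≤ x * Real.exp x := by
  have h := Real.add_one_le_exp (-x)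
  have h2 : Real.exp (-x) * Real.exp x = 1 := by rw [← Real.exp_add]; simp
  nlinarith [Real.exp_pos x]

theorem hit_cor (n k : ℕ) (hk : 1 ≤ k) (hq0 : 0 < interProb n k)
    (X : Finset (Fin n)) (C : Finset (Finset (Fin n))) (hC : C ⊆ kSets n k) (lam K : ℝ)
    (hdeg : ∀ v, v ∉ X → (vdeg C v : ℝ) ≤ lam) (hK : (SX X C : ℝ) ≤ K)
    (hKn : K + k ≤ n / 2) (hkn : 2 * (k : ℝ) ≤ n / 2) (hζ1 : 4 * K * k ^ 2 / (n : ℝ) ^ 2 ≤ 1) :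
    (((kSets n k).filter (fun B => ∀ A ∈ C, (B ∩ (A \ X)).Nonempty)).card : ℝ) ≤
      n.choose k * interProb n k ^ C.card *
        Real.exp (C.card * (4 * K * k ^ 2 / (n : ℝ) ^ 2 / interProb n k) +
          (k : ℝ) / n * (Real.log (1 / interProb n k) *
            Real.exp (Real.log (1 / interProb n k) * lam) * (2 * K))) := by
  classical
  set q := interProb n k with hq
  set L := Real.log (1 / q) with hL
  set ζ := 4 * K * k ^ 2 / (n : ℝ) ^ 2 with hζ
  have hk1 : (1 : ℝ) ≤ k := by exact_mod_cast hk
  have hK0 : 0 ≤ K := le_trans (by positivity) hK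
  have hn4 : 4 * (k : ℝ) ≤ n := by linarith
  have hn4' : 4 * k ≤ n := by exact_mod_cast hn4
  have hn0 : (0 : ℝ) < n := by linarith
  have hρ : interProb n k = 1 - rho n k := interProb_eq n k (by omega)
  have hρ0 : 0 ≤ rho n k := by unfold rho; positivity
  have hq1 : q ≤ 1 := by rw [hq, hρ]; linarith
  have hζ0 : 0 ≤ ζ := by positivity
  set W : Finset (Fin n) := (Finset.univ \ X).filter (fun v => 2 ≤ vdeg C v) with hW
  have hid : ∀ v, v ∉ X → ideg C (fun A => A \ X) v = vdeg C v := by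
    intro v hv
    unfold ideg vdeg starOf
    congr 1
    ext A
    simp [hv]
  have hid0 : ∀ v, v ∈ X → ideg C (fun A => A \ X) v = 0 := by
    intro v hv
    unfold ideg
    simp [hv]
  have hWmem : ∀ v ∈ W, v ∉ X ∧ 2 ≤ vdeg C v := by
    intro v hv
    simpa [hW] using hv
  have hsum2 : (∑ v ∈ W, (vdeg C v).choose 2) ≤ SX X C :=
    Finset.sum_le_sum_of_subset (Finset.filter_subset _ _)
  have hWc : W.card ≤ SX X C := by
    refine le_trans ?_ hsum2
    rw [Finset.card_eq_sum_ones]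
    exact Finset.sum_le_sum (fun v hv => (two_le_choose _ (hWmem v hv).2).2)
  have hWd : (∑ v ∈ W, vdeg C v) ≤ 2 * SX X C := by
    refine le_trans ?_ (Nat.mul_le_mul_left 2 hsum2)
    rw [Finset.mul_sum]
    exact Finset.sum_le_sum (fun v hv => (two_le_choose _ (hWmem v hv).2).1)
  have hWK : (W.card : ℝ) ≤ K := le_trans (by exact_mod_cast hWc) hK
  have hWn : (W.card : ℝ) + k ≤ n / 2 := by linarith
  have hWn2 : W.card + 2 * k < n := by
    have : (W.card : ℝ) + 2 * k < n := by linarith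
    exact_mod_cast this
  have hsh : (1 - ζ) * rho n k ≤ rho (n - W.card) k := by
    refine rho_shift n k W.card hWn2 ζ hζ0 hζ1 hk ?_
    have h1 : (n : ℝ) / 2 * (n / 2) ≤ ((n : ℝ) - W.card - k) * ((n : ℝ) - 2 * k) :=
      mul_le_mul (by linarith) (by linarith) (by positivity) (by linarith)
    have h2 := mul_le_mul_of_nonneg_left h1 hζ0
    have h3 : ζ * ((n : ℝ) / 2 * (n / 2)) = K * k ^ 2 := by rw [hζ]; field_simp; ring
    have h4 : (W.card : ℝ) * k ^ 2 ≤ K * k ^ 2 := mul_le_mul_of_nonneg_right hWK (by positivity)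
    linarith
  set q' := 1 - (1 - ζ) * rho n k with hq'
  have hqq' : q ≤ q' := by rw [hq', hq, hρ]; nlinarith [mul_nonneg hζ0 hρ0]
  have hq'1 : q' ≤ 1 := by
    rw [hq']; have := mul_nonneg (sub_nonneg.2 hζ1) hρ0; linarith
  have hq'0 : 0 < q' := lt_of_lt_of_le hq0 hqq'
  have hq'e : q' ≤ q * Real.exp (ζ / q) := by
    have h1 := Real.add_one_le_exp (ζ / q)
    have h2 : q' ≤ q + ζ := by
      rw [hq', hq, hρ]
      have : rho n k ≤ 1 := by rw [hρ] at hq; linarith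
      nlinarith
    have h3 : q + ζ = q * (ζ / q + 1) := by field_simp; ring
    rw [h3] at h2
    exact h2.trans (mul_le_mul_of_nonneg_left h1 hq0.le)
  have hL0 : 0 ≤ L := Real.log_nonneg (by rw [le_div_iff₀ hq0]; linarith)
  have hmain := hit_lemma n k (by omega) (by omega) C (fun A => A \ X)
    (by
      intro A hA
      have h1 := hC hA
      simp only [kSets, Finset.mem_powersetCard] at h1
      exact (Finset.card_le_card Finset.sdiff_subset).trans h1.2.le)
    W
    (by
      intro v hv
      by_cases hvX : v ∈ X
      · rw [hid0 v hvX] at hv; omega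
      · rw [hid v hvX] at hv
        simp [hW, hvX, hv])
    (by omega) q' hq'0 hq'1
    (by
      intro l hl t ht
      refine le_trans ?_ (rho_mono_use (n - W.card) k (by omega) l hl t ht)
      refine mul_le_mul_of_nonneg_left ?_ (by positivity)
      rw [hq']; linarith)
  refine le_trans (le_of_eq ?_) (hmain.trans ?_)
  · congr!
  rw [Real.exp_add]
  have hA : q' ^ C.card ≤ q ^ C.card * Real.exp (C.card * (ζ / q)) := by
    rw [Real.exp_nat_mul, ← mul_pow]
    exact pow_le_pow_left₀ hq'0.le hq'e _
  have hB : ∑ v ∈ W, ((1 / q') ^ ideg C (fun A => A \ X) v - 1) ≤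
      L * Real.exp (L * lam) * (2 * K) := by
    have hb : ∀ v ∈ W, ((1 / q') ^ ideg C (fun A => A \ X) v - 1) ≤
        L * Real.exp (L * lam) * (vdeg C v : ℝ) := by
      intro v hv
      have hvX := (hWmem v hv).1
      rw [hid v hvX]
      have h1 : (1 / q') ^ vdeg C v ≤ (1 / q) ^ vdeg C v :=
        pow_le_pow_left₀ (by positivity) (one_div_le_one_div_of_le hq0 hqq') _
      have h2 : (1 / q) ^ vdeg C v = Real.exp (L * vdeg C v) := by
        rw [mul_comm, Real.exp_nat_mul, hL, Real.exp_log (by positivity)]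
      have h3 := exp_sub_one_le (L * vdeg C v)
      have h4 : Real.exp (L * vdeg C v) ≤ Real.exp (L * lam) :=
        Real.exp_le_exp.2 (mul_le_mul_of_nonneg_left (hdeg v hvX) hL0)
      have h5 : L * vdeg C v * Real.exp (L * vdeg C v) ≤ L * vdeg C v * Real.exp (L * lam) :=
        mul_le_mul_of_nonneg_left h4 (by positivity)
      linarith
    refine (Finset.sum_le_sum hb).trans ?_
    rw [← Finset.mul_sum]
    refine mul_le_mul_of_nonneg_left ?_ (by positivity)
    have : ((∑ v ∈ W, vdeg C v : ℕ) : ℝ) ≤ 2 * SX X C := by exact_mod_cast hWd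
    push_cast at this
    linarith
  have hB' : Real.exp ((k : ℝ) / n * ∑ v ∈ W, ((1 / q') ^ ideg C (fun A => A \ X) v - 1)) ≤
      Real.exp ((k : ℝ) / n * (L * Real.exp (L * lam) * (2 * K))) :=
    Real.exp_le_exp.2 (mul_le_mul_of_nonneg_left hB (by positivity))
  calc _ ≤ (n.choose k : ℝ) * (q ^ C.card * Real.exp (C.card * (ζ / q))) *
        Real.exp ((k : ℝ) / n * (L * Real.exp (L * lam) * (2 * K))) := by gcongr
    _ = _ := by ring

open Classical in
/-- good families -/
noncomputable def goodFam {n : ℕ} (k : ℕ) (X : Finset (Fin n)) (lam K : ℝ) (a j : ℕ) :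
    Finset (Finset (Finset (Fin n))) :=
  (kSets n k).powerset.filter (fun C => C.card = a + j ∧
    (C.filter (fun A => ¬ Disjoint A X)).card = a ∧ IsClique C ∧
    (∀ v, v ∉ X → (vdeg C v : ℝ) ≤ lam) ∧ (SX X C : ℝ) ≤ K)

theorem vdeg_mono {n : ℕ} {C D : Finset (Finset (Fin n))} (h : C ⊆ D) (v : Fin n) :
    vdeg C v ≤ vdeg D v :=
  Finset.card_le_card (Finset.filter_subset_filter _ h)

theorem SX_mono {n : ℕ} (X : Finset (Fin n)) {C D : Finset (Finset (Fin n))} (h : C ⊆ D) :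
    SX X C ≤ SX X D :=
  Finset.sum_le_sum (fun v _ => Nat.choose_le_choose 2 (vdeg_mono h v))

theorem good_step {n : ℕ} (k : ℕ) (X : Finset (Fin n)) (lam K : ℝ) (a j : ℕ) (Bd : ℝ)
    (hBd : ∀ C ∈ goodFam k X lam K a j,
      (((kSets n k).filter (fun B => ∀ A ∈ C, (B ∩ (A \ X)).Nonempty)).card : ℝ) ≤ Bd) 
    (hBd0 : 0 ≤ Bd) :
    ((goodFam k X lam K a (j + 1)).card : ℝ) * (j + 1) ≤ (goodFam k X lam K a j).card * Bd := by
  classical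
  have h : (goodFam k X lam K a (j + 1)).card * (j + 1) ≤
      (goodFam k X lam K a j).card * ⌊Bd⌋₊ := by
    refine Finset.card_mul_le_card_mul (fun D C => C ⊆ D) ?_ ?_
    · intro D hD
      simp only [goodFam, Finset.mem_filter, Finset.mem_powerset] at hD
      obtain ⟨hDk, hDc, hDa, hDcl, hDd, hDS⟩ := hD
      have h1 : (D.filter (fun A => Disjoint A X)).card = j + 1 := by
        have := Finset.card_filter_add_card_filter_not (s := D) (fun A => Disjoint A X)
        omega
      rw [← h1]
      refine Finset.card_le_card_of_injOn (fun A => D.erase A) ?_ ?_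
      · intro A hA
        simp only [Finset.coe_filter, Set.mem_ofPred_eq] at hA
        simp only [Finset.bipartiteAbove, goodFam, Finset.coe_filter, Finset.mem_filter,
          Finset.mem_powerset, Set.mem_ofPred_eq]
        have hsub := Finset.erase_subset A D
        refine ⟨⟨hsub.trans hDk, ?_, ?_, ?_, ?_, ?_⟩, hsub⟩
        · rw [Finset.card_erase_of_mem hA.1]; omega
        · rw [← hDa]
          congr 1
          ext B
          simp only [Finset.mem_filter, Finset.mem_erase]
          constructor
          · rintro ⟨⟨_, h1⟩, h2⟩; exact ⟨h1, h2⟩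
          · rintro ⟨h1, h2⟩; exact ⟨⟨fun h => h2 (h ▸ hA.2), h1⟩, h2⟩
        · exact fun B hB B' hB' => hDcl B (hsub hB) B' (hsub hB')
        · exact fun v hv => le_trans (by exact_mod_cast vdeg_mono hsub v) (hDd v hv)
        · exact le_trans (by exact_mod_cast SX_mono X hsub) hDS
      · intro A hA A' hA' h
        simp only [Finset.coe_filter, Set.mem_ofPred_eq] at hA hA'
        simp only at h
        by_contra hne
        have : A ∈ D.erase A' := Finset.mem_erase.2 ⟨hne, hA.1⟩
        rw [← h] at this
        exact absurd this (Finset.notMem_erase A D)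
    · intro C hC
      have hb := hBd C hC
      refine le_trans ?_ (Nat.le_floor hb)
      simp only [goodFam, Finset.mem_filter, Finset.mem_powerset] at hC
      obtain ⟨hCk, hCc, hCa, hCcl, hCd, hCS⟩ := hC
      refine le_trans (Finset.card_le_card (t := ((kSets n k).filter
        (fun B => ∀ A ∈ C, (B ∩ (A \ X)).Nonempty)).image (fun B => insert B C)) ?_)
        Finset.card_image_le
      intro D hD
      simp only [Finset.bipartiteBelow, goodFam, Finset.mem_filter, Finset.mem_powerset] at hD
      obtain ⟨⟨hDk, hDc, hDa, hDcl, hDd, hDS⟩, hCD⟩ := hD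
      have hcard : (D \ C).card = 1 := by
        rw [Finset.card_sdiff_of_subset hCD]; omega
      obtain ⟨B, hB⟩ := Finset.card_eq_one.1 hcard
      have hBm : B ∈ D \ C := by rw [hB]; simp
      rw [Finset.mem_sdiff] at hBm
      have hDeq : insert B C = D := by
        rw [← Finset.sdiff_union_of_subset hCD, hB]; rfl
      have hBX : Disjoint B X := by
        by_contra hBX
        have h3 : insert B (C.filter (fun A => ¬ Disjoint A X)) ⊆
            D.filter (fun A => ¬ Disjoint A X) := by
          intro A hA
          rw [Finset.mem_insert, Finset.mem_filter] at hA
          rw [Finset.mem_filter]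
          rcases hA with rfl | hA
          · exact ⟨hBm.1, hBX⟩
          · exact ⟨hCD hA.1, hA.2⟩
        have h4 := Finset.card_le_card h3
        rw [Finset.card_insert_of_notMem (fun h => hBm.2 (Finset.mem_filter.1 h).1)] at h4
        omega
      rw [Finset.mem_image]
      refine ⟨B, ?_, hDeq⟩
      rw [Finset.mem_filter]
      refine ⟨hDk hBm.1, fun A hA => ?_⟩
      obtain ⟨u, hu⟩ := hDcl B hBm.1 A (hCD hA)
      rw [Finset.mem_inter] at hu
      exact ⟨u, Finset.mem_inter.2 ⟨hu.1, Finset.mem_sdiff.2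
        ⟨hu.2, Finset.disjoint_left.1 hBX hu.1⟩⟩⟩
  calc ((goodFam k X lam K a (j + 1)).card : ℝ) * (j + 1) ≤
        (goodFam k X lam K a j).card * (⌊Bd⌋₊ : ℝ) := by exact_mod_cast h
    _ ≤ _ := mul_le_mul_of_nonneg_left (Nat.floor_le hBd0) (by positivity)

theorem good_base {n : ℕ} (k : ℕ) (hkn : k ≤ n) (hn : 0 < n) (X : Finset (Fin n))
    (hX : X.card ≤ 1) (lam K : ℝ) (a : ℕ) :
    ((goodFam k X lam K a 0).card : ℝ) ≤ (n.choose k * ((k : ℝ) / n)) ^ a / a.factorial := by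
  classical
  set U := (kSets n k).filter (fun A => ¬ Disjoint A X) with hU
  have hUc : (U.card : ℝ) ≤ n.choose k * ((k : ℝ) / n) := by
    rcases X.eq_empty_or_nonempty with h0 | ⟨x, hx⟩
    · have : U = ∅ := by simp [hU, h0]
      rw [this]; simp only [Finset.card_empty, Nat.cast_zero]; positivity
    · have hXx : X = {x} := by
        apply Finset.eq_singleton_iff_unique_mem.2 ⟨hx, fun y hy => ?_⟩
        exact Finset.card_le_one.1 (by assumption) y hy x hx
      have h1 := card_sup_le n k hkn hn {x}
      rw [Finset.card_singleton, pow_one] at h1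
      refine le_trans ?_ h1
      rw [hU, hXx]
      simp
  have h1 : goodFam k X lam K a 0 ⊆ Finset.powersetCard a U := by
    intro C hC
    simp only [goodFam, Finset.mem_filter, Finset.mem_powerset, add_zero] at hC
    obtain ⟨hCk, hCc, hCa, -⟩ := hC
    rw [Finset.mem_powersetCard]
    refine ⟨?_, hCc⟩
    have : C.filter (fun A => ¬ Disjoint A X) = C :=
      Finset.eq_of_subset_of_card_le (Finset.filter_subset _ _) (by omega)
    rw [← this]
    exact Finset.filter_subset_filter _ hCk
  have h2 := Finset.card_le_card h1
  rw [Finset.card_powersetCard] at h2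
  calc ((goodFam k X lam K a 0).card : ℝ) ≤ (U.card.choose a : ℝ) := by exact_mod_cast h2
    _ ≤ (U.card : ℝ) ^ a / a.factorial := Nat.choose_le_pow_div a U.card
    _ ≤ _ := by gcongr

theorem good_count {n : ℕ} (k : ℕ) (hk : 1 ≤ k) (hq0 : 0 < interProb n k)
    (X : Finset (Fin n)) (hX : X.card ≤ 1) (lam K : ℝ) (hK0 : 0 ≤ K)
    (hKn : K + k ≤ n / 2) (hkn : 2 * (k : ℝ) ≤ n / 2) (hζ1 : 4 * K * k ^ 2 / (n : ℝ) ^ 2 ≤ 1)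
    (a m : ℕ) (η : ℝ)
    (hη : m * (4 * K * k ^ 2 / (n : ℝ) ^ 2 / interProb n k) +
          (k : ℝ) / n * (Real.log (1 / interProb n k) *
            Real.exp (Real.log (1 / interProb n k) * lam) * (2 * K)) ≤ η) :
    ∀ b, a + b ≤ m → ((goodFam k X lam K a b).card : ℝ) ≤
      (n.choose k * ((k : ℝ) / n)) ^ a / a.factorial * ((n.choose k : ℝ) ^ b / b.factorial) *
        interProb n k ^ (a * b + b.choose 2) * Real.exp (b * η) := by
  have hk1 : (1 : ℝ) ≤ k := by exact_mod_cast hk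
  have hn0 : (0 : ℝ) < n := by linarith
  have hn0' : 0 < n := by exact_mod_cast hn0
  have hkn' : k ≤ n := by
    have : (k : ℝ) ≤ n := by linarith
    exact_mod_cast this
  intro b
  induction b with
  | zero =>
    intro _
    have := good_base k hkn' hn0' X hX lam K a
    simpa using this
  | succ b ih =>
    intro hab
    have ih := ih (by omega)
    set q := interProb n k with hq
    have hst := good_step k X lam K a b (n.choose k * q ^ (a + b) * Real.exp η) (by
      intro C hC
      simp only [goodFam, Finset.mem_filter, Finset.mem_powerset] at hC
      obtain ⟨hCk, hCc, hCa, hCcl, hCd, hCS⟩ := hC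
      have h := hit_cor n k hk hq0 X C hCk lam K hCd hCS hKn hkn hζ1
      rw [hCc] at h
      refine h.trans ?_
      refine mul_le_mul_of_nonneg_left (Real.exp_le_exp.2 ?_) (by positivity)
      refine le_trans ?_ hη
      have hm : (((a + b : ℕ) : ℝ)) ≤ m := by exact_mod_cast (by omega : a + b ≤ m)
      have : ((a + b : ℕ) : ℝ) * (4 * K * k ^ 2 / (n : ℝ) ^ 2 / interProb n k) ≤
        m * (4 * K * k ^ 2 / (n : ℝ) ^ 2 / interProb n k) :=
        mul_le_mul_of_nonneg_right hm (by positivity)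
      linarith) (by positivity)
    have hb1 : (0 : ℝ) < (b : ℝ) + 1 := by positivity
    refine le_of_mul_le_mul_right (hst.trans ?_) hb1
    refine (mul_le_mul_of_nonneg_right ih (by positivity)).trans (le_of_eq ?_)
    have e1 : a * (b + 1) + (b + 1).choose 2 = (a * b + b.choose 2) + (a + b) := by
      rw [Nat.choose_succ_succ' b 1, Nat.choose_one_right]; ring
    have e2 : Real.exp (((b + 1 : ℕ) : ℝ) * η) = Real.exp (b * η) * Real.exp η := by
      rw [← Real.exp_add]; congr 1; push_cast; ring
    rw [e1, e2, pow_add, Nat.factorial_succ]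
    push_cast
    field_simp
    ring

open Filter

/-! ### Part 5: exponential moments for families with large overlap -/

open Classical in
/-- families with small degrees outside `X` -/
noncomputable def lowFam {n : ℕ} (k : ℕ) (X : Finset (Fin n)) (lam : ℝ) (j : ℕ) :
    Finset (Finset (Finset (Fin n))) :=
  (kSets n k).powerset.filter (fun C => C.card = j ∧ (∀ v, v ∉ X → (vdeg C v : ℝ) ≤ lam))

theorem vdeg_insert {n : ℕ} (C : Finset (Finset (Fin n))) (B : Finset (Fin n)) (hB : B ∉ C)
    (v : Fin n) : vdeg (insert B C) v = vdeg C v + if v ∈ B then 1 else 0 := by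
  unfold vdeg starOf
  rw [Finset.filter_insert]
  split_ifs with h
  · rw [Finset.card_insert_of_notMem (fun h' => hB (Finset.mem_filter.1 h').1)]
  · rfl

theorem SX_insert {n : ℕ} (X : Finset (Fin n)) (C : Finset (Finset (Fin n)))
    (B : Finset (Fin n)) (hB : B ∉ C) :
    SX X (insert B C) = SX X C + ∑ v ∈ B, if v ∈ X then 0 else vdeg C v := by
  classical
  unfold SX
  have h1 : ∑ v ∈ B, (if v ∈ X then 0 else vdeg C v) =
      ∑ v ∈ Finset.univ \ X, if v ∈ B then vdeg C v else 0 := by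
    rw [← Finset.sum_filter, Finset.sum_ite, Finset.sum_const_zero, zero_add]
    refine Finset.sum_congr ?_ (fun _ _ => rfl)
    ext v; simp [and_comm]
  rw [h1, ← Finset.sum_add_distrib]
  refine Finset.sum_congr rfl (fun v _ => ?_)
  rw [vdeg_insert C B hB]
  split_ifs
  · rw [Nat.choose_succ_succ' _ 1, Nat.choose_one_right]; ring
  · simp

theorem sum_vdeg {n : ℕ} (k : ℕ) (C : Finset (Finset (Fin n))) (hC : C ⊆ kSets n k) :
    ∑ v, vdeg C v = C.card * k := by
  classical
  unfold vdeg starOf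
  simp only [Finset.card_filter]
  rw [Finset.sum_comm, Finset.card_eq_sum_ones, Finset.sum_mul]
  refine Finset.sum_congr rfl (fun A hA => ?_)
  have := hC hA
  simp only [kSets, Finset.mem_powersetCard] at this
  simp [this.2]

theorem exp_le_two (x : ℝ) (h0 : 0 ≤ x) (h1 : x ≤ 1) : Real.exp x - 1 ≤ 2 * x := by
  have := Real.abs_exp_sub_one_le (x := x) (by rw [abs_of_nonneg h0]; exact h1)
  rw [abs_of_nonneg h0] at this
  exact (le_abs_self _).trans this

theorem low_step {n : ℕ} (k : ℕ) (hkn : k ≤ n) (hn : 0 < n) (X : Finset (Fin n)) (lam : ℝ)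
    (hlam : 0 < lam) (j : ℕ) :
    (∑ C ∈ lowFam k X lam (j + 1), Real.exp (SX X C / lam)) * (j + 1) ≤
      (∑ C ∈ lowFam k X lam j, Real.exp (SX X C / lam)) *
        (n.choose k * Real.exp ((k : ℝ) / n * (2 * (j * k) / lam))) := by
  classical
  -- the weight on pairs
  set f : Finset (Finset (Fin n)) × Finset (Fin n) → ℝ := fun CB =>
    Real.exp ((SX X CB.1 + ∑ v ∈ CB.2, (if v ∈ X then 0 else vdeg CB.1 v) : ℕ) / lam) with hf
  set P := (lowFam k X lam (j + 1)).sigma (fun D => D) with hP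
  have h1 : (∑ C ∈ lowFam k X lam (j + 1), Real.exp (SX X C / lam)) * (j + 1) =
      ∑ DA ∈ P, f (DA.1.erase DA.2, DA.2) := by
    rw [hP, Finset.sum_sigma, Finset.sum_mul]
    refine Finset.sum_congr rfl (fun D hD => ?_)
    simp only [lowFam, Finset.mem_filter, Finset.mem_powerset] at hD
    rw [Finset.sum_congr rfl (g := fun _ => Real.exp (SX X D / lam)), Finset.sum_const,
      nsmul_eq_mul, hD.2.1]
    · push_cast; ring
    · intro A hA
      simp only [hf]
      rw [← SX_insert X (D.erase A) A (Finset.notMem_erase A D), Finset.insert_erase hA]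
  have hinj : Set.InjOn (fun DA : (_ : Finset (Finset (Fin n))) × Finset (Fin n) =>
      (DA.1.erase DA.2, DA.2)) (P : Set _) := by
    rintro ⟨D, A⟩ h ⟨D', A'⟩ h' he
    simp only [hP, Finset.coe_sigma, Set.mem_sigma_iff, Finset.mem_coe] at h h'
    simp only [Prod.mk.injEq] at he
    obtain ⟨he1, rfl⟩ := he
    have : D = D' := by rw [← Finset.insert_erase h.2, he1, Finset.insert_erase h'.2]
    subst this
    rfl
  have h2 : ∑ DA ∈ P, f (DA.1.erase DA.2, DA.2) ≤
      ∑ CB ∈ (lowFam k X lam j) ×ˢ (kSets n k), f CB := by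
    rw [← Finset.sum_image (f := f) (g := fun DA : (_ : Finset (Finset (Fin n))) × Finset (Fin n) =>
      (DA.1.erase DA.2, DA.2)) hinj]
    refine Finset.sum_le_sum_of_subset_of_nonneg ?_ (fun _ _ _ => (Real.exp_pos _).le)
    intro CB hCB
    rw [Finset.mem_image] at hCB
    obtain ⟨⟨D, A⟩, h, rfl⟩ := hCB
    simp only [hP, Finset.mem_sigma, lowFam, Finset.mem_filter, Finset.mem_powerset] at h
    obtain ⟨⟨hDk, hDc, hDd⟩, hA⟩ := h
    simp only [Finset.mem_product, lowFam, Finset.mem_filter, Finset.mem_powerset]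
    refine ⟨⟨(Finset.erase_subset A D).trans hDk, ?_, ?_⟩, hDk hA⟩
    · rw [Finset.card_erase_of_mem hA]; omega
    · exact fun v hv => le_trans (by exact_mod_cast vdeg_mono (Finset.erase_subset A D) v) (hDd v hv)
  rw [h1]
  refine h2.trans ?_
  rw [Finset.sum_product, Finset.sum_mul]
  refine Finset.sum_le_sum (fun C hC => ?_)
  simp only [lowFam, Finset.mem_filter, Finset.mem_powerset] at hC
  obtain ⟨hCk, hCc, hCd⟩ := hC
  have hg := genfun_le n k hkn hn
    (fun v => if v ∈ X then 0 else Real.exp (vdeg C v / lam) - 1)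
    (by
      intro v
      have : 1 ≤ Real.exp ((vdeg C v : ℝ) / lam) := Real.one_le_exp (by positivity)
      split_ifs <;> linarith)
  have h3 : ∀ B ∈ kSets n k, f (C, B) = Real.exp (SX X C / lam) *
      ∏ v ∈ B, (1 + if v ∈ X then 0 else Real.exp ((vdeg C v : ℝ) / lam) - 1) := by
    intro B _
    simp only [hf]
    push_cast
    rw [add_div, Real.exp_add, Finset.sum_div, Real.exp_sum]
    congr 1
    refine Finset.prod_congr rfl (fun v _ => ?_)
    split_ifs <;> simp
  rw [Finset.sum_congr rfl h3, ← Finset.mul_sum]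
  refine mul_le_mul_of_nonneg_left (hg.trans ?_) (Real.exp_pos _).le
  refine mul_le_mul_of_nonneg_left (Real.exp_le_exp.2 ?_) (by positivity)
  refine mul_le_mul_of_nonneg_left ?_ (by positivity)
  have h4 : ∀ v ∈ (Finset.univ : Finset (Fin n)),
      (if v ∈ X then 0 else Real.exp ((vdeg C v : ℝ) / lam) - 1) ≤ 2 * ((vdeg C v : ℝ) / lam) := by
    intro v _
    split_ifs with hv
    · positivity
    · exact exp_le_two _ (by positivity) (by rw [div_le_one hlam]; exact hCd v hv)
  refine (Finset.sum_le_sum h4).trans (le_of_eq ?_)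
  rw [← Finset.mul_sum, ← Finset.sum_div]
  have h5 : (∑ v, (vdeg C v : ℝ)) = j * k := by
    have := sum_vdeg k C hCk
    rw [hCc] at this
    exact_mod_cast this
  rw [h5]; ring

theorem low_count {n : ℕ} (k : ℕ) (hkn : k ≤ n) (hn : 0 < n) (X : Finset (Fin n)) (lam : ℝ)
    (hlam : 0 < lam) (m : ℕ) : ∀ j, j ≤ m →
    (∑ C ∈ lowFam k X lam j, Real.exp (SX X C / lam)) ≤
      (n.choose k : ℝ) ^ j / j.factorial * Real.exp (j * ((k : ℝ) / n * (2 * (m * k) / lam))) := by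
  classical
  intro j
  induction j with
  | zero =>
    intro _
    have : lowFam k X lam 0 ⊆ {∅} := by
      intro C hC
      simp only [lowFam, Finset.mem_filter, Finset.card_eq_zero] at hC
      simp [hC.2.1]
    refine (Finset.sum_le_sum_of_subset_of_nonneg this
      (fun _ _ _ => (Real.exp_pos _).le)).trans ?_
    simp [SX, vdeg, starOf]
  | succ j ih =>
    intro hj
    have ih := ih (by omega)
    have hst := low_step k hkn hn X lam hlam j
    have hb1 : (0 : ℝ) < (j : ℝ) + 1 := by positivity
    have hjm : (j : ℝ) ≤ m := by exact_mod_cast (by omega : j ≤ m)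
    have h6 : Real.exp ((k : ℝ) / n * (2 * (j * k) / lam)) ≤
        Real.exp ((k : ℝ) / n * (2 * (m * k) / lam)) := by
      apply Real.exp_le_exp.2
      gcongr
    refine le_of_mul_le_mul_right (hst.trans ?_) hb1
    calc _ ≤ ((n.choose k : ℝ) ^ j / j.factorial *
            Real.exp (j * ((k : ℝ) / n * (2 * (m * k) / lam)))) *
            (n.choose k * Real.exp ((k : ℝ) / n * (2 * (m * k) / lam))) := by gcongr
      _ = _ := by
        have e2 : Real.exp (((j + 1 : ℕ) : ℝ) * ((k : ℝ) / n * (2 * (m * k) / lam))) =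
            Real.exp (j * ((k : ℝ) / n * (2 * (m * k) / lam))) *
              Real.exp ((k : ℝ) / n * (2 * (m * k) / lam)) := by
          rw [← Real.exp_add]; congr 1; push_cast; ring
        rw [e2, Nat.factorial_succ]
        push_cast
        field_simp
        ring

theorem bad_count {n : ℕ} (k : ℕ) (hkn : k ≤ n) (hn : 0 < n) (X : Finset (Fin n)) (lam K : ℝ)
    (hlam : 0 < lam) (m : ℕ) :
    (((lowFam k X lam m).filter (fun C => K < (SX X C : ℝ))).card : ℝ) ≤
      (n.choose k : ℝ) ^ m / m.factorial *
        Real.exp (2 * (m : ℝ) ^ 2 * k ^ 2 / (n * lam) - K / lam) := by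
  classical
  have h := low_count k hkn hn X lam hlam m m le_rfl
  have h1 : (((lowFam k X lam m).filter (fun C => K < (SX X C : ℝ))).card : ℝ) * Real.exp (K / lam)
      ≤ ∑ C ∈ lowFam k X lam m, Real.exp (SX X C / lam) := by
    rw [← nsmul_eq_mul, ← Finset.sum_const]
    refine (Finset.sum_le_sum (fun C hC => ?_)).trans
      (Finset.sum_le_sum_of_subset_of_nonneg (Finset.filter_subset _ _)
        (fun _ _ _ => (Real.exp_pos _).le))
    apply Real.exp_le_exp.2
    have := (Finset.mem_filter.1 hC).2
    gcongr
  rw [Real.exp_sub, ← mul_div_assoc, le_div_iff₀ (Real.exp_pos _)]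
  refine h1.trans (h.trans (le_of_eq ?_))
  congr 2
  field_simp

/-! ### Probability of containing a member of a family -/

theorem sum_superset {β : Type*} [DecidableEq β] (U C : Finset β) (hC : C ⊆ U) (p : ℝ) :
    ∑ H ∈ U.powerset.filter (fun H => C ⊆ H), p ^ H.card * (1 - p) ^ (U.card - H.card) =
      p ^ C.card := by
  have h1 : U.powerset.filter (fun H => C ⊆ H) = (U \ C).powerset.image (fun G => G ∪ C) := by
    ext H
    simp only [Finset.mem_filter, Finset.mem_powerset, Finset.mem_image]
    constructor
    · rintro ⟨h1, h2⟩
      exact ⟨H \ C, Finset.sdiff_subset_sdiff h1 le_rfl, Finset.sdiff_union_of_subset h2⟩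
    · rintro ⟨G, hG, rfl⟩
      exact ⟨Finset.union_subset (hG.trans Finset.sdiff_subset) hC, Finset.subset_union_right⟩
  rw [h1, Finset.sum_image]
  · have h2 : ∀ G ∈ (U \ C).powerset, p ^ (G ∪ C).card * (1 - p) ^ (U.card - (G ∪ C).card) =
        p ^ C.card * (p ^ G.card * (1 - p) ^ ((U \ C).card - G.card)) := by
      intro G hG
      rw [Finset.mem_powerset] at hG
      have hd : Disjoint G C := Finset.disjoint_of_subset_left hG Finset.sdiff_disjoint
      rw [Finset.card_union_of_disjoint hd, Finset.card_sdiff_of_subset hC,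
        show U.card - (G.card + C.card) = U.card - C.card - G.card by omega, pow_add]
      ring
    rw [Finset.sum_congr rfl h2, ← Finset.mul_sum, Finset.sum_pow_mul_eq_add_pow]
    simp
  · intro G hG G' hG' h
    simp only [Finset.coe_powerset, Set.mem_preimage, Set.mem_powerset_iff, Finset.coe_subset] at hG hG'
    have hd : Disjoint G C := Finset.disjoint_of_subset_left hG Finset.sdiff_disjoint
    have hd' : Disjoint G' C := Finset.disjoint_of_subset_left hG' Finset.sdiff_disjoint
    simp only at h
    rw [← Finset.union_sdiff_cancel_right hd, h, Finset.union_sdiff_cancel_right hd']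

section Prob
variable {n k : ℕ} {p : ℝ}

theorem hterm_nonneg (hp0 : 0 ≤ p) (hp1 : p ≤ 1) (a b : ℕ) : 0 ≤ p ^ a * (1 - p) ^ b :=
  mul_nonneg (pow_nonneg hp0 _) (pow_nonneg (by linarith) _)

theorem hprob_mono (hp0 : 0 ≤ p) (hp1 : p ≤ 1) {P Q : Finset (Finset (Fin n)) → Prop}
    (h : ∀ H, H ⊆ kSets n k → P H → Q H) : hprob n k p P ≤ hprob n k p Q := by
  classical
  unfold hprob
  refine Finset.sum_le_sum (fun H hH => ?_)
  have := hterm_nonneg hp0 hp1 H.card ((kSets n k).card - H.card)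
  have h1 := h H (Finset.mem_powerset.1 hH)
  by_cases hP : P H
  · simp [hP, h1 hP]
  · by_cases hQ : Q H <;> simp [hP, hQ, this]

theorem hprob_nonneg (hp0 : 0 ≤ p) (hp1 : p ≤ 1) (P : Finset (Finset (Fin n)) → Prop) :
    0 ≤ hprob n k p P := by
  classical
  unfold hprob
  refine Finset.sum_nonneg (fun H _ => ?_)
  have := hterm_nonneg hp0 hp1 H.card ((kSets n k).card - H.card)
  split_ifs <;> simp [this]

theorem hprob_or (hp0 : 0 ≤ p) (hp1 : p ≤ 1) (P Q : Finset (Finset (Fin n)) → Prop) :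
    hprob n k p (fun H => P H ∨ Q H) ≤ hprob n k p P + hprob n k p Q := by
  classical
  unfold hprob
  rw [← Finset.sum_add_distrib]
  refine Finset.sum_le_sum (fun H _ => ?_)
  have := hterm_nonneg hp0 hp1 H.card ((kSets n k).card - H.card)
  by_cases hP : P H <;> by_cases hQ : Q H <;> simp [hP, hQ, this]

theorem hprob_not (P : Finset (Finset (Fin n)) → Prop) :
    hprob n k p (fun H => ¬ P H) = 1 - hprob n k p P := by
  classical
  unfold hprob
  rw [eq_sub_iff_add_eq, ← Finset.sum_add_distrib]
  have h := Finset.sum_pow_mul_eq_add_pow p (1 - p) (kSets n k)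
  rw [show p + (1 - p) = 1 by ring, one_pow] at h
  refine Eq.trans ?_ h
  refine Finset.sum_congr rfl (fun H _ => ?_)
  by_cases hP : P H <;> simp [hP]

theorem hprob_first_moment (hp0 : 0 ≤ p) (hp1 : p ≤ 1)
    (F : Finset (Finset (Finset (Fin n)))) (hF : ∀ C ∈ F, C ⊆ kSets n k) :
    hprob n k p (fun H => ∃ C ∈ F, C ⊆ H) ≤ ∑ C ∈ F, p ^ C.card := by
  classical
  have h1 : ∑ C ∈ F, p ^ C.card = ∑ C ∈ F, ∑ H ∈ (kSets n k).powerset,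
      if C ⊆ H then p ^ H.card * (1 - p) ^ ((kSets n k).card - H.card) else 0 := by
    refine Finset.sum_congr rfl (fun C hC => ?_)
    rw [← Finset.sum_filter, sum_superset _ _ (hF C hC)]
  rw [h1, Finset.sum_comm]
  unfold hprob
  refine Finset.sum_le_sum (fun H _ => ?_)
  have h0 := hterm_nonneg hp0 hp1 H.card ((kSets n k).card - H.card)
  have hnn : ∀ C ∈ F, 0 ≤
      (if C ⊆ H then p ^ H.card * (1 - p) ^ ((kSets n k).card - H.card) else 0) := by
    intro C _; split_ifs <;> simp [h0]
  split_ifs with h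
  · obtain ⟨C, hC, hCH⟩ := h
    have := Finset.single_le_sum hnn hC
    simpa [hCH] using this
  · exact Finset.sum_nonneg hnn

end Prob

open Filter

/-- families with few pairs violated -/
noncomputable def badFam {n : ℕ} (k : ℕ) (X : Finset (Fin n)) (lam K : ℝ) (m : ℕ) :
    Finset (Finset (Finset (Fin n))) :=
  (lowFam k X lam m).filter (fun C => K < (SX X C : ℝ))

open Classical in
theorem union_bound {n : ℕ} (k : ℕ) (p : ℝ) (hp0 : 0 ≤ p) (hp1 : p ≤ 1) (hk : 1 ≤ k)
    (hq0 : 0 < interProb n k)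
    (lam K tau : ℝ) (hlam : 0 < lam) (hK0 : 0 ≤ K)
    (hKn : K + k ≤ n / 2) (hkn : 2 * (k : ℝ) ≤ n / 2) (hζ1 : 4 * K * k ^ 2 / (n : ℝ) ^ 2 ≤ 1)
    (m : ℕ) (η : ℝ)
    (hη : m * (4 * K * k ^ 2 / (n : ℝ) ^ 2 / interProb n k) +
          (k : ℝ) / n * (Real.log (1 / interProb n k) *
            Real.exp (Real.log (1 / interProb n k) * lam) * (2 * K)) ≤ η)
    (hη0 : 0 ≤ η) (hmη : m * η ≤ Real.log 2) :
    hprob n k p (fun H => ∃ C ⊆ H, IsClique C ∧ C.card = m ∧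
        (∀ x y : Fin n, lam < (vdeg C x : ℝ) → lam < (vdeg C y : ℝ) → x = y) ∧
        (∀ x : Fin n, (vdeg C x : ℝ) < tau)) ≤
      (n + 1) * ((p * n.choose k) ^ m / m.factorial *
        Real.exp (2 * (m : ℝ) ^ 2 * k ^ 2 / (n * lam) - K / lam)) +
      2 * ((p * n.choose k) ^ m / m.factorial * interProb n k ^ (m.choose 2)) +
      n * ∑ a ∈ (Finset.range (m + 1)).filter (fun a : ℕ => lam < (a : ℝ) ∧ (a : ℝ) < tau),
        2 * ((p * n.choose k) ^ m / (a.factorial * (m - a).factorial) * ((k : ℝ) / n) ^ a *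
          interProb n k ^ (a * (m - a) + (m - a).choose 2)) := by
  have hk1 : (1 : ℝ) ≤ k := by exact_mod_cast hk
  have hn0 : (0 : ℝ) < n := by linarith
  have hn0' : 0 < n := by exact_mod_cast hn0
  have hkn' : k ≤ n := by
    have : (k : ℝ) ≤ n := by linarith
    exact_mod_cast this
  set S := (Finset.range (m + 1)).filter (fun a : ℕ => lam < (a : ℝ) ∧ (a : ℝ) < tau) with hS
  set F : Finset (Finset (Finset (Fin n))) :=
    ((badFam k ∅ lam K m ∪ Finset.univ.biUnion (fun x : Fin n => badFam k {x} lam K m)) ∪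
      goodFam k ∅ lam K 0 m) ∪
      Finset.univ.biUnion (fun x : Fin n => S.biUnion (fun a => goodFam k {x} lam K a (m - a)))
    with hF
  have hsub : ∀ C ∈ F, C ⊆ kSets n k ∧ C.card = m := by
    intro C hC
    simp only [hF, Finset.mem_union, Finset.mem_biUnion, Finset.mem_univ, true_and, badFam, lowFam,
      goodFam, Finset.mem_filter, Finset.mem_powerset] at hC
    rcases hC with ((h | ⟨x, h⟩) | h) | ⟨x, a, ha, h⟩
    · exact ⟨h.1.1, h.1.2.1⟩
    · exact ⟨h.1.1, h.1.2.1⟩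
    · exact ⟨h.1, by simpa using h.2.1⟩
    · refine ⟨h.1, ?_⟩
      rw [hS, Finset.mem_filter, Finset.mem_range] at ha
      have := h.2.1
      omega
  have hstep : hprob n k p (fun H => ∃ C ⊆ H, IsClique C ∧ C.card = m ∧
        (∀ x y : Fin n, lam < (vdeg C x : ℝ) → lam < (vdeg C y : ℝ) → x = y) ∧
        (∀ x : Fin n, (vdeg C x : ℝ) < tau)) ≤ F.card * p ^ m := by
    refine (hprob_mono hp0 hp1 (Q := fun H => ∃ C ∈ F, C ⊆ H) ?_).trans
      ((hprob_first_moment hp0 hp1 F (fun C hC => (hsub C hC).1)).trans (le_of_eq ?_))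
    · rintro H hH ⟨C, hCH, hcl, hcard, huniq, htau⟩
      refine ⟨C, ?_, hCH⟩
      have hCk : C ⊆ kSets n k := hCH.trans hH
      simp only [hF, Finset.mem_union, Finset.mem_biUnion, Finset.mem_univ, true_and, badFam, lowFam,
        goodFam, Finset.mem_filter, Finset.mem_powerset]
      by_cases hx : ∃ x, lam < (vdeg C x : ℝ)
      · obtain ⟨x, hx⟩ := hx
        have hlow : ∀ v, v ∉ ({x} : Finset (Fin n)) → (vdeg C v : ℝ) ≤ lam := by
          intro v hv
          by_contra hcon
          exact hv (Finset.mem_singleton.2 (huniq v x (not_le.1 hcon) hx))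
        by_cases hSX : K < (SX {x} C : ℝ)
        · exact Or.inl (Or.inl (Or.inr ⟨x, ⟨hCk, hcard, hlow⟩, hSX⟩))
        · refine Or.inr ⟨x, vdeg C x, ?_, hCk, ?_, ?_, hcl, hlow, not_lt.1 hSX⟩
          · rw [hS, Finset.mem_filter, Finset.mem_range]
            refine ⟨?_, hx, htau x⟩
            have : vdeg C x ≤ C.card := Finset.card_le_card (Finset.filter_subset _ _)
            omega
          · have : vdeg C x ≤ C.card := Finset.card_le_card (Finset.filter_subset _ _)
            omega
          · unfold vdeg starOf
            simp [Finset.disjoint_singleton_right]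
      · push Not at hx
        by_cases hSX : K < (SX ∅ C : ℝ)
        · exact Or.inl (Or.inl (Or.inl ⟨⟨hCk, hcard, fun v _ => hx v⟩, hSX⟩))
        · refine Or.inl (Or.inr ⟨hCk, by simpa using hcard, by simp, hcl, fun v _ => hx v,
            not_lt.1 hSX⟩)
    · rw [Finset.sum_congr rfl (fun C hC => by rw [(hsub C hC).2]), Finset.sum_const, nsmul_eq_mul]
  set Nn : ℝ := (n.choose k : ℝ) with hNn
  have hN0 : 0 ≤ Nn := by positivity
  set q := interProb n k with hq
  set Bd := Nn ^ m / m.factorial * Real.exp (2 * (m : ℝ) ^ 2 * k ^ 2 / (n * lam) - K / lam) with hBd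
  set G0 := 2 * (Nn ^ m / m.factorial * q ^ (m.choose 2)) with hG0
  set G : ℕ → ℝ := fun a => 2 * (Nn ^ m / (a.factorial * (m - a).factorial) * ((k : ℝ) / n) ^ a *
          q ^ (a * (m - a) + (m - a).choose 2)) with hG
  have hbad : ∀ X : Finset (Fin n), ((badFam k X lam K m).card : ℝ) ≤ Bd := fun X =>
    bad_count k hkn' hn0' X lam K hlam m
  have hexp : ∀ b : ℕ, b ≤ m → Real.exp (b * η) ≤ 2 := by
    intro b hb
    rw [← Real.le_log_iff_exp_le (by norm_num)]
    refine le_trans ?_ hmη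
    gcongr
  have hgood0 : ((goodFam k (∅ : Finset (Fin n)) lam K 0 m).card : ℝ) ≤ G0 := by
    have := good_count k hk hq0 (∅ : Finset (Fin n)) (by simp) lam K hK0 hKn hkn hζ1 0 m η hη m (by simp)
    refine this.trans ?_
    have h2 := hexp m le_rfl
    simp only [pow_zero, Nat.factorial_zero, Nat.cast_one, div_one, one_mul, zero_mul, zero_add]
    rw [hG0, mul_comm (2 : ℝ)]
    gcongr
  have hgood : ∀ x : Fin n, ∀ a ∈ S, ((goodFam k {x} lam K a (m - a)).card : ℝ) ≤ G a := by
    intro x a ha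
    rw [hS, Finset.mem_filter, Finset.mem_range] at ha
    have ham : a ≤ m := by omega
    have := good_count k hk hq0 ({x} : Finset (Fin n)) (by simp) lam K hK0 hKn hkn hζ1 a m η hη (m - a)
      (by omega)
    refine this.trans ?_
    have h2 := hexp (m - a) (by omega)
    rw [hG]
    simp only
    rw [mul_comm (2 : ℝ)]
    refine mul_le_mul (le_of_eq ?_) h2 (Real.exp_pos _).le (by positivity)
    have : Nn ^ m = Nn ^ a * Nn ^ (m - a) := by rw [← pow_add]; congr 1; omega
    rw [this, ← hNn, mul_pow, ← hq]
    field_simp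
  have hcard : (F.card : ℝ) ≤ (n + 1) * Bd + G0 + n * ∑ a ∈ S, G a := by
    have h1 : (F.card : ℝ) ≤ (((badFam k (∅ : Finset (Fin n)) lam K m).card +
        ∑ x : Fin n, (badFam k {x} lam K m).card + (goodFam k (∅ : Finset (Fin n)) lam K 0 m).card +
        ∑ x : Fin n, ∑ a ∈ S, (goodFam k {x} lam K a (m - a)).card : ℕ) : ℝ) := by
      norm_cast
      refine (Finset.card_union_le _ _).trans (add_le_add ((Finset.card_union_le _ _).trans
        (add_le_add_left ((Finset.card_union_le _ _).trans
          (add_le_add_right Finset.card_biUnion_le _)) _)) ?_)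
      exact Finset.card_biUnion_le.trans (Finset.sum_le_sum fun x _ => Finset.card_biUnion_le)
    refine h1.trans ?_
    push_cast
    have h2 : ∑ x : Fin n, ((badFam k {x} lam K m).card : ℝ) ≤ n * Bd := by
      refine (Finset.sum_le_sum (fun x _ => hbad {x})).trans (le_of_eq ?_)
      simp
    have h3 : ∑ x : Fin n, ∑ a ∈ S, ((goodFam k {x} lam K a (m - a)).card : ℝ) ≤
        n * ∑ a ∈ S, G a := by
      refine (Finset.sum_le_sum (fun x _ => Finset.sum_le_sum (hgood x))).trans (le_of_eq ?_)
      simp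
    have := hbad ∅
    linarith
  refine hstep.trans ((mul_le_mul_of_nonneg_right hcard (by positivity)).trans (le_of_eq ?_))
  rw [add_mul, add_mul, mul_assoc (n : ℝ), Finset.sum_mul]
  congr 1
  · rw [hBd, hG0, mul_pow]; ring
  · congr 1
    refine Finset.sum_congr rfl (fun a _ => ?_)
    rw [hG, mul_pow]; ring

open Filter

theorem pow_div_fact_le (m : ℕ) : (m : ℝ) ^ m / m.factorial ≤ Real.exp m :=
  Real.pow_div_factorial_le_exp (m : ℝ) (by positivity) m

theorem choose2_real (m : ℕ) : ((m.choose 2 : ℕ) : ℝ) = (m : ℝ) * (m - 1) / 2 := by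
  rw [Nat.cast_choose_two]

theorem inv_fact_mul_le (a b : ℕ) :
    (1 : ℝ) / (a.factorial * b.factorial) ≤ 2 ^ (a + b) / (a + b).factorial := by
  have h := Nat.add_choose_mul_factorial_mul_factorial a b
  rw [← Nat.choose_symm_add] at h
  have h2 : (a + b).choose a ≤ 2 ^ (a + b) := Nat.choose_le_two_pow _ _
  have h' : (((a + b).choose a : ℕ) : ℝ) * a.factorial * b.factorial = (a + b).factorial := by
    exact_mod_cast h
  have h2' : (((a + b).choose a : ℕ) : ℝ) ≤ 2 ^ (a + b) := by exact_mod_cast h2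
  rw [div_le_div_iff₀ (by positivity) (by positivity), one_mul, ← h', mul_assoc]
  gcongr

theorem term_caseI (m a b : ℕ) (hab : a + b = m) (hm : 1 ≤ m) (φ r q L ℓ θ ε : ℝ)
    (hφ0 : 0 ≤ φ) (hr : 0 < r) (hq : q = Real.exp (-L))
    (hφ : φ ≤ m * Real.exp (θ * ℓ)) (hr2 : r ≤ Real.exp ((1 / 2 + θ) * ℓ))
    (hC : 2 * Real.exp 1 ≤ Real.exp (θ * ℓ)) (hL0 : 0 ≤ L) (hL : L ≤ θ * ℓ)
    (hLm : (1 + ε) * ℓ ≤ L * m) (hb : ε * m ≤ b) (hε : 0 < ε) (hε4 : ε < 1 / 4)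
    (hℓ : 0 ≤ ℓ) (hθ : θ = ε ^ 2 / 16) :
    (φ * r) ^ m / (a.factorial * b.factorial) * (1 / r) ^ a * q ^ (a * b + b.choose 2) ≤
      Real.exp (-(ε / 4) * b * ℓ) := by
  have hm0 : (0 : ℝ) < m := by exact_mod_cast hm
  have e1 : (φ * r) ^ m * (1 / r) ^ a = φ ^ m * r ^ b := by
    rw [← hab, mul_pow, pow_add r, one_div, inv_pow]
    field_simp
  have e2 : φ ^ m ≤ m ^ m * Real.exp (m * (θ * ℓ)) := by
    rw [Real.exp_nat_mul, ← mul_pow]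
    gcongr
  have e3 : r ^ b ≤ Real.exp (b * ((1 / 2 + θ) * ℓ)) := by
    rw [Real.exp_nat_mul]
    gcongr
  have e4 : (1 : ℝ) / (a.factorial * b.factorial) ≤ 2 ^ m / m.factorial := by
    have := inv_fact_mul_le a b
    rwa [hab] at this
  have hE : ((a * b + b.choose 2 : ℕ) : ℝ) * L ≥ b * (((1 + ε) * ℓ - θ * ℓ) / 2) := by
    have h1 : ((a * b + b.choose 2 : ℕ) : ℝ) ≥ b * ((m - 1) / 2 : ℝ) := by
      push_cast
      rw [choose2_real]
      have : (m : ℝ) = a + b := by rw [← hab]; push_cast; ring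
      rw [this]
      have : (0 : ℝ) ≤ a * b := by positivity
      nlinarith
    calc ((a * b + b.choose 2 : ℕ) : ℝ) * L ≥ b * ((m - 1) / 2 : ℝ) * L := by gcongr
      _ = b * ((L * m - L) / 2) := by ring
      _ ≥ _ := by gcongr
  have e5 : q ^ (a * b + b.choose 2) ≤ Real.exp (-(b * (((1 + ε) * ℓ - θ * ℓ) / 2))) := by
    rw [hq, ← Real.exp_nat_mul]
    apply Real.exp_le_exp.2
    linarith
  have e6 : (m : ℝ) ^ m * (2 ^ m / m.factorial) ≤ Real.exp (m * (θ * ℓ)) := by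
    calc (m : ℝ) ^ m * (2 ^ m / m.factorial) = 2 ^ m * ((m : ℝ) ^ m / m.factorial) := by ring
      _ ≤ 2 ^ m * Real.exp m := by gcongr; exact pow_div_fact_le m
      _ = (2 * Real.exp 1) ^ m := by rw [mul_pow, ← Real.exp_nat_mul, mul_one]
      _ ≤ Real.exp (θ * ℓ) ^ m := by gcongr
      _ = _ := by rw [Real.exp_nat_mul]
  have hq0 : 0 < q := by rw [hq]; exact Real.exp_pos _
  calc (φ * r) ^ m / (a.factorial * b.factorial) * (1 / r) ^ a * q ^ (a * b + b.choose 2)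
      = φ ^ m * r ^ b * (1 / (a.factorial * b.factorial)) * q ^ (a * b + b.choose 2) := by
        rw [← e1]; ring
    _ ≤ (m ^ m * Real.exp (m * (θ * ℓ))) * Real.exp (b * ((1 / 2 + θ) * ℓ)) *
        (2 ^ m / m.factorial) * Real.exp (-(b * (((1 + ε) * ℓ - θ * ℓ) / 2))) := by
        gcongr
    _ = (m ^ m * (2 ^ m / m.factorial)) * (Real.exp (m * (θ * ℓ)) * Real.exp (b * ((1 / 2 + θ) * ℓ)) *
         Real.exp (-(b * (((1 + ε) * ℓ - θ * ℓ) / 2)))) := by ring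
    _ ≤ Real.exp (m * (θ * ℓ)) * (Real.exp (m * (θ * ℓ)) * Real.exp (b * ((1 / 2 + θ) * ℓ)) *
         Real.exp (-(b * (((1 + ε) * ℓ - θ * ℓ) / 2)))) := by gcongr
    _ = Real.exp (m * (θ * ℓ) + (m * (θ * ℓ) + (b * ((1 / 2 + θ) * ℓ)) +
          (-(b * (((1 + ε) * ℓ - θ * ℓ) / 2))))) := by simp only [Real.exp_add]
    _ ≤ _ := by
        apply Real.exp_le_exp.2
        have h1 : (m : ℝ) * θ ≤ b * (ε / 16) := by
          rw [hθ]
          nlinarith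
        have hb0 : (0 : ℝ) ≤ b := by positivity
        have h3 : (b : ℝ) * θ ≤ b * (ε / 64) := by
          have : θ ≤ ε / 64 := by rw [hθ]; nlinarith
          gcongr
        have h4 : 2 * ((m : ℝ) * θ) + (3 / 2) * (b * θ) - b * ε / 2 ≤ -(ε / 4) * b := by
          have : 0 ≤ b * ε := by positivity
          linarith
        nlinarith [mul_le_mul_of_nonneg_right h4 hℓ]

theorem choose_split (a b : ℕ) : a * b + b.choose 2 + a.choose 2 = (a + b).choose 2 := by
  have : (((a * b + b.choose 2 + a.choose 2 : ℕ)) : ℝ) = ((a + b).choose 2 : ℕ) := by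
    push_cast
    rw [choose2_real, choose2_real, choose2_real]
    push_cast
    ring
  exact_mod_cast this

theorem term_caseII (m a b : ℕ) (hab : a + b = m) (μ w q L ℓ θ ε lam : ℝ)
    (hμ : 0 ≤ μ) (hw : 0 ≤ w) (hq : q = Real.exp (-L))
    (hlam : 0 < lam) (ha : lam < a) (hE : Real.exp 1 * m * w ≤ lam * Real.exp ((-1 / 2 + θ) * ℓ))
    (hL0 : 0 ≤ L) (hLm : L * m ≤ (1 + ε) * ℓ) (ham : a ≤ (1 - ε) * m) (hε : 0 < ε) (hε4 : ε < 1 / 4)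
    (hℓ : 0 ≤ ℓ) (hθ : θ ≤ ε ^ 2 / 4) :
    μ ^ m / (a.factorial * b.factorial) * w ^ a * q ^ (a * b + b.choose 2) ≤
      μ ^ m / m.factorial * q ^ m.choose 2 * Real.exp (-(ε ^ 2 / 4) * a * ℓ) := by
  have ha0 : (0 : ℝ) < a := hlam.trans ha
  have hq0 : 0 < q := by rw [hq]; exact Real.exp_pos _
  have hle : a ≤ m := by omega
  have e1 : (1 : ℝ) / (a.factorial * b.factorial) = (m.choose a : ℝ) / m.factorial := by
    have h := Nat.add_choose_mul_factorial_mul_factorial a b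
    rw [← Nat.choose_symm_add] at h
    have h' : (((a + b).choose a : ℕ) : ℝ) * a.factorial * b.factorial = (a + b).factorial := by
      exact_mod_cast h
    rw [← hab, ← h']
    have : (((a + b).choose a : ℕ) : ℝ) ≠ 0 := by
      have := Nat.choose_pos (show a ≤ a + b by omega)
      positivity
    field_simp
  have e2 : q ^ (a * b + b.choose 2) = q ^ m.choose 2 * Real.exp (L * (a.choose 2 : ℕ)) := by
    rw [← hab, ← choose_split a b, pow_add q _ (a.choose 2), hq, ← Real.exp_nat_mul,
      ← Real.exp_nat_mul, mul_assoc, ← Real.exp_add]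
    rw [show ((a.choose 2 : ℕ) : ℝ) * -L + L * (a.choose 2 : ℕ) = 0 by ring]
    simp
  have e3 : (m.choose a : ℝ) ≤ (Real.exp 1 * m / lam) ^ a := by
    calc (m.choose a : ℝ) ≤ (m : ℝ) ^ a / a.factorial := Nat.choose_le_pow_div a m
      _ = (m / a : ℝ) ^ a * ((a : ℝ) ^ a / a.factorial) := by
          rw [div_pow]; field_simp
      _ ≤ (m / lam : ℝ) ^ a * Real.exp a := by
          gcongr
          exact pow_div_fact_le a
      _ = _ := by
          rw [← mul_one (a : ℝ), Real.exp_nat_mul, ← mul_pow]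
          congr 1; ring
  have e4 : (Real.exp 1 * m / lam) ^ a * w ^ a ≤ Real.exp (a * ((-1 / 2 + θ) * ℓ)) := by
    rw [← mul_pow, Real.exp_nat_mul]
    apply pow_le_pow_left₀ (by positivity)
    rw [div_mul_eq_mul_div, div_le_iff₀ hlam]
    linarith
  have e5 : L * (a.choose 2 : ℕ) ≤ a * ((1 - ε ^ 2) * ℓ / 2) := by
    rw [choose2_real]
    have h1 : L * a ≤ (1 - ε ^ 2) * ℓ := by
      calc L * a ≤ L * ((1 - ε) * m) := by gcongr
        _ = (1 - ε) * (L * m) := by ring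
        _ ≤ (1 - ε) * ((1 + ε) * ℓ) := by
            apply mul_le_mul_of_nonneg_left hLm; linarith
        _ = _ := by ring
    have h2 : 0 ≤ L * a := by positivity
    nlinarith
  calc μ ^ m / (a.factorial * b.factorial) * w ^ a * q ^ (a * b + b.choose 2)
      = μ ^ m * (1 / (a.factorial * b.factorial)) * w ^ a * q ^ (a * b + b.choose 2) := by ring
    _ = μ ^ m / m.factorial * q ^ m.choose 2 * ((m.choose a : ℝ) * w ^ a *
          Real.exp (L * (a.choose 2 : ℕ))) := by rw [e1, e2]; ring
    _ ≤ μ ^ m / m.factorial * q ^ m.choose 2 * ((Real.exp 1 * m / lam) ^ a * w ^ a *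
          Real.exp (a * ((1 - ε ^ 2) * ℓ / 2))) := by gcongr
    _ ≤ μ ^ m / m.factorial * q ^ m.choose 2 * (Real.exp (a * ((-1 / 2 + θ) * ℓ)) *
          Real.exp (a * ((1 - ε ^ 2) * ℓ / 2))) := by gcongr
    _ ≤ _ := by
        rw [← Real.exp_add]
        gcongr
        have : (a : ℝ) * ℓ * θ ≤ a * ℓ * (ε ^ 2 / 4) := by gcongr
        nlinarith

theorem term_bad (m : ℕ) (hm : 1 ≤ m) (φ r ℓ θ : ℝ)
    (hφ0 : 0 ≤ φ) (hr : 0 < r)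
    (hφ : φ ≤ m * Real.exp (θ * ℓ)) (hr2 : r ≤ Real.exp ((1 / 2 + θ) * ℓ))
    (hC : 2 * Real.exp 1 ≤ Real.exp (θ * ℓ)) (hθ : θ ≤ 1 / 6) (hℓ : 0 ≤ ℓ) :
    (φ * r) ^ m / m.factorial * Real.exp (-(3 * m * ℓ)) ≤ Real.exp (-(2 * ℓ)) := by
  have hm1 : (1 : ℝ) ≤ m := by exact_mod_cast hm
  have e1 : (φ * r) ^ m / m.factorial ≤ Real.exp (m * ℓ) := by
    calc (φ * r) ^ m / m.factorial ≤
        (m * Real.exp (θ * ℓ) * Real.exp ((1 / 2 + θ) * ℓ)) ^ m / m.factorial := by gcongr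
      _ = ((m : ℝ) ^ m / m.factorial) * (Real.exp (θ * ℓ) * Real.exp ((1 / 2 + θ) * ℓ)) ^ m := by
          rw [mul_assoc, mul_pow]; ring
      _ ≤ Real.exp m * (Real.exp (θ * ℓ) * Real.exp ((1 / 2 + θ) * ℓ)) ^ m := by
          gcongr; exact pow_div_fact_le m
      _ = (Real.exp 1 * (Real.exp (θ * ℓ) * Real.exp ((1 / 2 + θ) * ℓ))) ^ m := by
          rw [mul_pow (Real.exp 1), ← Real.exp_nat_mul, mul_one]
      _ ≤ (Real.exp (θ * ℓ) * (Real.exp (θ * ℓ) * Real.exp ((1 / 2 + θ) * ℓ))) ^ m := by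
          have := Real.exp_pos 1
          have h2 : Real.exp 1 ≤ Real.exp (θ * ℓ) := by linarith
          exact pow_le_pow_left₀ (by positivity)
            (mul_le_mul_of_nonneg_right h2 (by positivity)) _
      _ ≤ (Real.exp ℓ) ^ m := by
          gcongr
          rw [← Real.exp_add, ← Real.exp_add]
          apply Real.exp_le_exp.2
          have : θ * ℓ ≤ 1 / 6 * ℓ := by gcongr
          linarith
      _ = _ := by rw [Real.exp_nat_mul]
  calc _ ≤ Real.exp (m * ℓ) * Real.exp (-(3 * m * ℓ)) := by gcongr
    _ ≤ _ := by
      rw [← Real.exp_add]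
      apply Real.exp_le_exp.2
      nlinarith

open Filter

/-- `L = log (1/q)` -/
noncomputable def LL (n k : ℕ) : ℝ := Real.log (1 / interProb n k)

/-- basic parameter facts at a fixed `n` -/
structure PF (ε : ℝ) (n k : ℕ) : Prop where
  e0 : 0 < ε
  e4 : ε < 1 / 4
  l1 : 1 ≤ Real.log n
  lθ : 1 ≤ (ε ^ 2 / 16) ^ 2 * Real.log n
  P : 100 * Real.log n ^ 4 ≤ Real.exp (ε ^ 2 / 16 * Real.log n)
  E : Real.exp (-(ε / 2 * Real.log n)) ≤ 1 / 4
  n0 : (n : ℝ) = Real.exp (Real.log n)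
  k1 : 1 ≤ k
  k2 : 2 * k < n
  hr : (n : ℝ) / k ≤ Real.exp ((1 / 2 + ε ^ 2 / 16) * Real.log n)
  ksq : (k : ℝ) ^ 2 ≤ n * Real.log n
  q0 : 0 < interProb n k
  q1 : interProb n k < 1
  qe : interProb n k = Real.exp (-(LL n k))
  L0 : 0 < LL n k
  L1 : LL n k ≤ (ε ^ 2 / 16) ^ 2 / 4 * Real.log n
  L2 : 1 / LL n k ≤ Real.exp ((1 / 4 - ε / 2) * Real.log n)

theorem two_l_le (ε ℓ θ : ℝ) (e0 : 0 < ε) (l1 : 1 ≤ ℓ) (hθ0 : 0 < θ) (hθ1 : θ ≤ ε / 64)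
    (hθ2 : θ ≤ 1 / 2) (lθ : 1 ≤ θ ^ 2 * ℓ)
    (P : 100 * ℓ ^ 4 ≤ Real.exp (θ * ℓ)) : 2 * ℓ ≤ ε * Real.exp (ℓ / 2) := by
  have h0 : θ ^ 2 ≤ ε := by
    have : θ * θ ≤ 1 * θ := mul_le_mul_of_nonneg_right (by linarith) hθ0.le
    rw [pow_two]; linarith
  have hx : 1 ≤ ε * ℓ := lθ.trans (mul_le_mul_of_nonneg_right h0 (by linarith))
  have h5 : Real.exp (θ * ℓ) ≤ Real.exp (ℓ / 2) := by
    apply Real.exp_le_exp.2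
    have := mul_le_mul_of_nonneg_right hθ2 (show 0 ≤ ℓ by linarith)
    linarith
  have h9 : ε * (100 * ℓ ^ 4) ≤ ε * Real.exp (ℓ / 2) :=
    mul_le_mul_of_nonneg_left (P.trans h5) e0.le
  have h10 : ℓ * 1 ≤ ℓ ^ 3 * (ε * ℓ) := by
    apply mul_le_mul _ hx (by norm_num) (by positivity)
    exact le_self_pow₀ l1 (by norm_num)
  have h11 : ε * (100 * ℓ ^ 4) = 100 * (ℓ ^ 3 * (ε * ℓ)) := by ring
  linarith

set_option maxHeartbeats 1000000 in
theorem PF_of (ε : ℝ) (n k : ℕ) (δ : ℝ)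
  (e0 : 0 < ε)
  (e4 : ε < 1 / 4)
  (l1 : 1 ≤ Real.log n)
  (lθ : 1 ≤ (ε ^ 2 / 16) ^ 2 * Real.log n)
  (P : 100 * Real.log n ^ 4 ≤ Real.exp (ε ^ 2 / 16 * Real.log n))
  (E : Real.exp (-(ε / 2 * Real.log n)) ≤ 1 / 4)
  (hl2 : Real.log 2 ≤ (ε ^ 2 / 16) ^ 2 / 12 * Real.log n)
  (k2 : 2 * k < n)
  (hδ : δ ≤ (ε ^ 2 / 16) ^ 2 / 12)
  (hlow : (n : ℝ) ^ ((1 : ℝ) / 2 - δ) < (k : ℝ))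
  (hkup : (k : ℝ) < Real.sqrt ((1 / 4 - ε) * n * Real.log n)) : PF ε n k := by
  set ℓ := Real.log n with hℓ
  set θ := ε ^ 2 / 16 with hθ
  have hθ0 : 0 < θ := by positivity
  have hθ1 : θ ≤ ε / 64 := by rw [hθ]; nlinarith
  have hn0 : (0 : ℝ) < n := by
    have : 0 < n := by omega
    exact_mod_cast this
  have hne : (n : ℝ) = Real.exp ℓ := (Real.exp_log hn0).symm
  have hlow' : Real.exp ((1 / 2 - δ) * ℓ) < k := by
    rwa [Real.rpow_def_of_pos hn0, mul_comm] at hlow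
  have hδ2 : θ ^ 2 / 12 ≤ θ := by nlinarith
  have hδθ : δ ≤ θ := hδ.trans hδ2
  have hk0 : (0 : ℝ) < k := (Real.exp_pos _).trans hlow'
  have hk1 : 1 ≤ k := by
    have : 0 < k := by exact_mod_cast hk0
    omega
  have hksq' : (k : ℝ) ^ 2 ≤ (1 / 4 - ε) * n * ℓ := by
    have := (Real.lt_sqrt hk0.le).1 hkup
    exact this.le
  have hksq : (k : ℝ) ^ 2 ≤ n * ℓ := by
    have : 0 ≤ (n : ℝ) * ℓ := by positivity
    nlinarith
  have hkn : (k : ℝ) ≤ n := by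
    have : k ≤ n := by omega
    exact_mod_cast this
  have hkn' : 2 * (k : ℝ) < n := by exact_mod_cast k2
  have hr : (n : ℝ) / k ≤ Real.exp ((1 / 2 + θ) * ℓ) := by
    rw [div_le_iff₀ hk0]
    calc (n : ℝ) = Real.exp ((1 / 2 + δ) * ℓ) * Real.exp ((1 / 2 - δ) * ℓ) := by
          rw [← Real.exp_add, hne]; congr 1; ring
      _ ≤ Real.exp ((1 / 2 + θ) * ℓ) * k := by gcongr
  have hiq := interProb_eq n k (by omega)
  have hrho1 := rho_le_exp n k k2
  have hrho2 := rho_ge_exp n k k2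
  have hq1 : interProb n k < 1 := by
    rw [hiq]; have := Real.exp_pos (-((k : ℝ) ^ 2 / (n - 2 * k))); linarith
  set y := Real.exp (-(2 * (θ ^ 2 / 12) * ℓ)) with hy
  have hy0 : 0 < y := Real.exp_pos _
  have hy1 : y ≤ 1 := by rw [hy, Real.exp_le_one_iff]; have : 0 ≤ 2 * (θ ^ 2 / 12) * ℓ := by positivity
                         linarith
  have hky : y ≤ (k : ℝ) ^ 2 / n := by
    rw [le_div_iff₀ hn0]
    calc y * n = Real.exp ((1 / 2 - θ ^ 2 / 12) * ℓ) ^ 2 := by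
          rw [hy, hne, ← Real.exp_add, ← Real.exp_nat_mul]; congr 1; push_cast; ring
      _ ≤ Real.exp ((1 / 2 - δ) * ℓ) ^ 2 := by gcongr
      _ ≤ _ := by gcongr
  have hq2 : y / 2 ≤ interProb n k := by
    rw [hiq]
    have h1 : Real.exp (-((k : ℝ) ^ 2 / n)) ≤ Real.exp (-y) := by
      apply Real.exp_le_exp.2; linarith
    have h2 : Real.exp (-y) ≤ 1 - y / 2 := by
      rw [Real.exp_neg]
      have h3 := Real.add_one_le_exp y
      rw [inv_le_comm₀ (Real.exp_pos _) (by linarith)]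
      refine le_trans ?_ h3
      rw [inv_le_iff_one_le_mul₀ (by linarith)]
      nlinarith
    linarith
  have hq0 : 0 < interProb n k := lt_of_lt_of_le (by positivity) hq2
  have hLq : LL n k = -Real.log (interProb n k) := by
    unfold LL; rw [one_div, Real.log_inv]
  have hL1 : LL n k ≤ θ ^ 2 / 4 * ℓ := by
    rw [hLq]
    have := Real.log_le_log (by positivity) hq2
    rw [Real.log_div hy0.ne' (by norm_num), hy, Real.log_exp] at this
    linarith
  have hL2 : Real.exp (-((1 / 4 - ε / 2) * ℓ)) ≤ LL n k := by
    have h1 : 1 - interProb n k ≤ LL n k := by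
      rw [hLq]
      have := Real.log_le_sub_one_of_pos hq0
      linarith
    refine le_trans ?_ (le_trans hrho2 (by rw [hiq] at h1; linarith))
    apply Real.exp_le_exp.2
    rw [neg_le_neg_iff, div_le_iff₀ (by linarith)]
    have h2 : 2 * (k : ℝ) ≤ ε * n := by
      have h3 : (k : ℝ) ≤ ℓ * Real.exp (ℓ / 2) := by
        refine (sq_le_sq₀ hk0.le (by positivity)).1 ?_
        rw [mul_pow, ← Real.exp_nat_mul]
        push_cast
        rw [show 2 * (ℓ / 2) = ℓ by ring, ← hne]
        have : ℓ ≤ ℓ ^ 2 := le_self_pow₀ l1 (by norm_num)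
        have := mul_le_mul_of_nonneg_left this hn0.le
        linarith
      have h4 : 2 * ℓ ≤ ε * Real.exp (ℓ / 2) := by
        exact two_l_le ε ℓ θ e0 l1 hθ0 hθ1 (by linarith) lθ P
      calc 2 * (k : ℝ) ≤ 2 * (ℓ * Real.exp (ℓ / 2)) := by gcongr
        _ = (2 * ℓ) * Real.exp (ℓ / 2) := by ring
        _ ≤ (ε * Real.exp (ℓ / 2)) * Real.exp (ℓ / 2) := by gcongr
        _ = ε * n := by rw [mul_assoc, ← Real.exp_add, hne]; congr 2; ring
    have h3 : (1 / 4 - ε) * ((n : ℝ) * ℓ) ≤ (1 / 4 - ε / 2) * ((1 - ε) * (n * ℓ)) := by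
      have : 0 ≤ (n : ℝ) * ℓ := by positivity
      rw [← mul_assoc (1 / 4 - ε / 2)]
      apply mul_le_mul_of_nonneg_right _ this
      have e : (1 / 4 - ε / 2) * (1 - ε) = 1 / 4 - 3 / 4 * ε + ε * ε / 2 := by ring
      rw [e]
      have := mul_pos e0 e0
      linarith
    calc (k : ℝ) ^ 2 ≤ (1 / 4 - ε) * ((n : ℝ) * ℓ) := by linarith
      _ ≤ _ := h3
      _ = (1 / 4 - ε / 2) * ℓ * ((1 - ε) * n) := by ring
      _ ≤ _ := by
        apply mul_le_mul_of_nonneg_left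
        · linarith
        · apply mul_nonneg <;> linarith
  have hL0 : 0 < LL n k := (Real.exp_pos _).trans_le hL2
  refine ⟨e0, e4, l1, lθ, P, E, hne, hk1, k2, hr, hksq, hq0, hq1, ?_, hL0, hL1, ?_⟩
  · rw [hLq, neg_neg, Real.exp_log hq0]
  · rw [Real.exp_neg] at hL2
    rw [one_div, inv_le_comm₀ hL0 (Real.exp_pos _)]
    exact hL2

theorem eventually_PF 
    (ε : ℝ) (hε0 : 0 < ε) (hε14 : ε < 1 / 4)
    (k : ℕ → ℕ) 
    (hnk : ∀ᶠ n in atTop, 2 * k n < n)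
    (δ : ℕ → ℝ) (hδ : Tendsto δ atTop (nhds 0))
    (hklow : ∀ᶠ n : ℕ in atTop, (n : ℝ) ^ ((1 : ℝ) / 2 - δ n) < (k n : ℝ))
    (hkup : ∀ᶠ n in atTop, (k n : ℝ) < Real.sqrt ((1 / 4 - ε) * n * Real.log n)) :
    ∀ᶠ n in atTop, PF ε n (k n) := by
  have hlog : Tendsto (fun n : ℕ => Real.log n) atTop atTop :=
    Real.tendsto_log_atTop.comp tendsto_natCast_atTop_atTop
  have hθ0 : 0 < ε ^ 2 / 16 := by positivity
  have c1 : ∀ᶠ n : ℕ in atTop, 1 ≤ Real.log n := hlog.eventually_ge_atTop 1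
  have c2 : ∀ᶠ n : ℕ in atTop, 1 ≤ (ε ^ 2 / 16) ^ 2 * Real.log n :=
    (hlog.const_mul_atTop (by positivity)).eventually_ge_atTop 1
  have c5 : ∀ᶠ n : ℕ in atTop, Real.log 2 ≤ (ε ^ 2 / 16) ^ 2 / 12 * Real.log n :=
    (hlog.const_mul_atTop (by positivity)).eventually_ge_atTop _
  have c4 : ∀ᶠ n : ℕ in atTop, Real.exp (-(ε / 2 * Real.log n)) ≤ 1 / 4 := by
    have h : Tendsto (fun n : ℕ => Real.exp (-(ε / 2 * Real.log n))) atTop (nhds 0) :=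
      Real.tendsto_exp_neg_atTop_nhds_zero.comp (hlog.const_mul_atTop (by positivity))
    exact (h.eventually_lt_const (by norm_num)).mono fun n hn => hn.le
  have c3 : ∀ᶠ n : ℕ in atTop, 100 * Real.log n ^ 4 ≤ Real.exp (ε ^ 2 / 16 * Real.log n) := by
    have h : Tendsto (fun x : ℝ => x ^ 4 * Real.exp (-x)) atTop (nhds 0) :=
      Real.tendsto_pow_mul_exp_neg_atTop_nhds_zero 4
    have h2 := h.comp (hlog.const_mul_atTop hθ0)
    have h3 := h2.eventually_lt_const (show (0 : ℝ) < (ε ^ 2 / 16) ^ 4 / 100 by positivity)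
    filter_upwards [h3] with n hn
    simp only [Function.comp] at hn
    rw [Real.exp_neg, ← div_eq_mul_inv, div_lt_iff₀ (Real.exp_pos _), mul_pow] at hn
    have h4 : 0 < (ε ^ 2 / 16) ^ 4 := by positivity
    have h5 : (ε ^ 2 / 16) ^ 4 * Real.log n ^ 4 <
      (ε ^ 2 / 16) ^ 4 * (Real.exp (ε ^ 2 / 16 * Real.log n) / 100) := by
      linarith
    have := lt_of_mul_lt_mul_left h5 h4.le
    linarith
  have c6 : ∀ᶠ n : ℕ in atTop, δ n ≤ (ε ^ 2 / 16) ^ 2 / 12 :=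
    (hδ.eventually_lt_const (show (0 : ℝ) < (ε ^ 2 / 16) ^ 2 / 12 by positivity)).mono
      fun n hn => hn.le
  filter_upwards [c1, c2, c3, c4, c5, c6, hnk, hklow, hkup] with n h1 h2 h3 h4 h5 h6 h7 h8 h9
  exact PF_of ε n (k n) (δ n) hε0 hε14 h1 h2 h3 h4 h5 h7 h6 h8 h9

open Filter

namespace PF
variable {ε : ℝ} {n k : ℕ}

theorem npos (h : PF ε n k) : (0 : ℝ) < n := by rw [h.n0]; exact Real.exp_pos _
theorem kpos (h : PF ε n k) : (0 : ℝ) < k := by exact_mod_cast h.k1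
theorem lpos (h : PF ε n k) : 0 < Real.log n := by have := h.l1; linarith
theorem θpos (h : PF ε n k) : 0 < ε ^ 2 / 16 := by have := h.e0; positivity
theorem θle (h : PF ε n k) : ε ^ 2 / 16 ≤ ε / 64 := by have := h.e0; have := h.e4; nlinarith

theorem Lθ (h : PF ε n k) : LL n k ≤ ε ^ 2 / 16 * Real.log n := by
  refine h.L1.trans (mul_le_mul_of_nonneg_right ?_ h.lpos.le)
  have := h.θpos; have := h.θle; have := h.e4
  nlinarith

theorem lam1 (_h : PF ε n k) : Real.sqrt (Real.log n) / LL n k ≤ lamP n k := le_max_left _ _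

theorem lampos (h : PF ε n k) : 0 < lamP n k :=
  lt_of_lt_of_le (div_pos (Real.sqrt_pos.2 h.lpos) h.L0) h.lam1

theorem lam_ge (h : PF ε n k) : 16 / ε ^ 2 ≤ lamP n k := by
  refine le_trans ?_ (le_max_right _ _)
  have h1 : (16 / ε ^ 2) ≤ Real.sqrt (Real.log n / Real.log (1 / interProb n k)) := by
    apply Real.le_sqrt_of_sq_le
    have := h.L0
    change _ ≤ Real.log n / LL n k
    rw [le_div_iff₀ this]
    have h2 := h.L1
    have h3 : (16 / ε ^ 2) ^ 2 * LL n k ≤ (16 / ε ^ 2) ^ 2 * ((ε ^ 2 / 16) ^ 2 / 4 * Real.log n) :=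
      mul_le_mul_of_nonneg_left h2 (by positivity)
    have h4 : (16 / ε ^ 2) ^ 2 * ((ε ^ 2 / 16) ^ 2 / 4 * Real.log n) = Real.log n / 4 := by
      have := h.e0.ne'
      field_simp
    have := h.lpos
    linarith
  have := Real.sqrt_nonneg (Real.log n / Real.log (1 / interProb n k))
  linarith

theorem Llam (h : PF ε n k) : LL n k * lamP n k ≤ ε ^ 2 / 16 * Real.log n := by
  have hL := h.L0
  have hl := h.lpos
  have hθ := h.θpos
  set θ := ε ^ 2 / 16 with hθd
  set ℓ := Real.log n with hℓ
  unfold lamP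
  change LL n k * max (Real.sqrt ℓ / LL n k) (2 * Real.sqrt (ℓ / LL n k)) ≤ _
  rw [mul_max_of_nonneg _ _ hL.le]
  apply max_le
  · rw [mul_div_cancel₀ _ hL.ne']
    apply Real.sqrt_le_iff.2 ⟨by positivity, ?_⟩
    have h1 : 1 ≤ θ ^ 2 * ℓ := h.lθ
    have h2 := mul_le_mul_of_nonneg_right h1 hl.le
    rw [mul_pow]
    linarith
  · have h1 : LL n k * Real.sqrt (ℓ / LL n k) ≤ θ / 2 * ℓ := by
      rw [← Real.sqrt_sq hL.le, ← Real.sqrt_mul (sq_nonneg _), Real.sqrt_sq hL.le]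
      apply Real.sqrt_le_iff.2 ⟨by positivity, ?_⟩
      have e : LL n k ^ 2 * (ℓ / LL n k) = LL n k * ℓ := by field_simp
      rw [e]
      have := mul_le_mul_of_nonneg_right h.L1 hl.le
      calc _ ≤ _ := this
        _ = _ := by ring
    linarith

/-- P ≥ everything polylog -/
theorem k_le (h : PF ε n k) : (k : ℝ) ≤ Real.log n * Real.exp (Real.log n / 2) := by
  have hl := h.l1
  refine (sq_le_sq₀ h.kpos.le (by positivity)).1 ?_
  rw [mul_pow, ← Real.exp_nat_mul]
  push_cast
  rw [show 2 * (Real.log n / 2) = Real.log n by ring, ← h.n0]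
  have : Real.log n ≤ Real.log n ^ 2 := le_self_pow₀ hl (by norm_num)
  have := mul_le_mul_of_nonneg_left this h.npos.le
  have := h.ksq
  linarith

theorem kn_le (h : PF ε n k) : (k : ℝ) / n ≤ Real.log n * Real.exp (-(Real.log n / 2)) := by
  rw [div_le_iff₀ h.npos]
  refine h.k_le.trans (le_of_eq ?_)
  conv_rhs => rw [h.n0]
  rw [Real.log_exp, mul_assoc, ← Real.exp_add]
  congr 2; ring

theorem m_lam (h : PF ε n k) (m : ℕ) (hm : (m : ℝ) ≤ Real.log n ^ 3 / (3 * LL n k)) :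
    Real.exp 1 * m * ((k : ℝ) / n) ≤
      lamP n k * Real.exp ((-1 / 2 + ε ^ 2 / 16) * Real.log n) := by
  have hL := h.L0
  have hl := h.l1
  have hl0 := h.lpos
  set ℓ := Real.log n with hℓ
  have h1 : (m : ℝ) ≤ lamP n k * ℓ ^ 3 := by
    have h2 : 1 / LL n k ≤ lamP n k := by
      refine le_trans ?_ h.lam1
      gcongr
      exact Real.one_le_sqrt.2 hl
    calc (m : ℝ) ≤ ℓ ^ 3 / (3 * LL n k) := hm
      _ = (1 / LL n k) * (ℓ ^ 3 / 3) := by field_simp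
      _ ≤ lamP n k * ℓ ^ 3 := by
        apply mul_le_mul h2 _ (by positivity) h.lampos.le
        have : 0 ≤ ℓ ^ 3 := by positivity
        linarith
  have hlam := h.lampos
  have he : Real.exp 1 < 3 := Real.exp_one_lt_three
  calc Real.exp 1 * m * ((k : ℝ) / n) ≤ 3 * (lamP n k * ℓ ^ 3) * (ℓ * Real.exp (-(ℓ / 2))) := by
        have := h.kn_le
        gcongr
    _ = lamP n k * ((3 * ℓ ^ 4) * Real.exp (-(ℓ / 2))) := by ring
    _ ≤ lamP n k * (Real.exp (ε ^ 2 / 16 * ℓ) * Real.exp (-(ℓ / 2))) := by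
        have := h.P
        rw [← hℓ] at this
        have h4 : 0 ≤ ℓ ^ 4 := by positivity
        gcongr
        linarith
    _ = _ := by
        rw [← Real.exp_add]; congr 2; ring

set_option maxHeartbeats 2000000 in
theorem loss (h : PF ε n k) (m : ℕ) (hm : (m : ℝ) ≤ Real.log n ^ 3 / (3 * LL n k)) (K : ℝ)
    (hK : K = 2 * (m : ℝ) ^ 2 * k ^ 2 / n + 3 * lamP n k * m * Real.log n) :
    0 ≤ K ∧ K + k ≤ n / 2 ∧ 2 * (k : ℝ) ≤ n / 2 ∧ 4 * K * k ^ 2 / (n : ℝ) ^ 2 ≤ 1 ∧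
    m * (m * (4 * K * k ^ 2 / (n : ℝ) ^ 2 / interProb n k) +
          (k : ℝ) / n * (LL n k * Real.exp (LL n k * lamP n k) * (2 * K))) ≤ 1 / 2 ∧
    (m : ℝ) + 1 ≤ n := by
  have hL := h.L0
  have hl := h.l1
  have hl0 := h.lpos
  have hlam := h.lampos
  have hn := h.npos
  have hk := h.kpos
  have he0 := h.e0
  have he4 := h.e4
  have hPP := h.P
  have hLlam := h.Llam
  have hLθ := h.Lθ
  have hL2 := h.L2
  have hθ1 := h.θle
  have hθ0 := h.θpos
  set ℓ := Real.log n with hℓ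
  set θ := ε ^ 2 / 16 with hθ
  set P := Real.exp (θ * ℓ) with hPd
  set D := Real.exp ((1 / 4 - ε / 2) * ℓ) with hD
  have hP0 : 0 < P := Real.exp_pos _
  have hD0 : 0 < D := Real.exp_pos _
  have h1P : 100 ≤ P := by
    have : 1 ≤ ℓ ^ 4 := one_le_pow₀ hl
    linarith
  have hl3 : 100 * ℓ ^ 3 ≤ P := by
    have : ℓ ^ 3 ≤ ℓ ^ 4 := pow_le_pow_right₀ hl (by norm_num)
    linarith
  have hl1 : 100 * ℓ ≤ P := by
    have : ℓ ≤ ℓ ^ 4 := le_self_pow₀ hl (by norm_num)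
    linarith
  have hP8 : P ^ 8 ≤ Real.exp (ε / 2 * ℓ) := by
    rw [hPd, ← Real.exp_nat_mul]
    apply Real.exp_le_exp.2
    push_cast
    have : θ * ℓ ≤ ε / 64 * ℓ := mul_le_mul_of_nonneg_right hθ1 hl0.le
    have : 0 ≤ ε * ℓ := by positivity
    linarith
  have hE := h.E
  have hEP : Real.exp (ε / 2 * ℓ) * Real.exp (-(ε / 2 * ℓ)) = 1 := by
    rw [← Real.exp_add]; simp
  have hD2 : D ^ 2 * Real.exp (ε * ℓ) = Real.exp (ℓ / 2) := by
    rw [hD, ← Real.exp_nat_mul, ← Real.exp_add]; congr 1; push_cast; ring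
  have hee : Real.exp (ε * ℓ) = Real.exp (ε / 2 * ℓ) * Real.exp (ε / 2 * ℓ) := by
    rw [← Real.exp_add]; congr 1; ring
  have hn2 : (n : ℝ) = Real.exp (ℓ / 2) * Real.exp (ℓ / 2) := by
    rw [← Real.exp_add, h.n0]; congr 1; ring
  have hmD : (m : ℝ) ≤ P * D := by
    calc (m : ℝ) ≤ ℓ ^ 3 / (3 * LL n k) := hm
      _ = (ℓ ^ 3 / 3) * (1 / LL n k) := by field_simp
      _ ≤ P * D := by
        apply mul_le_mul _ hL2 (by positivity) hP0.le
        have : 0 ≤ ℓ ^ 3 := by positivity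
        linarith
  have hlamD : lamP n k ≤ P * D := by
    calc lamP n k = (LL n k * lamP n k) * (1 / LL n k) := by field_simp
      _ ≤ (θ * ℓ) * D := by gcongr
      _ ≤ P * D := by
        gcongr
        nlinarith
  have hkk : (k : ℝ) ^ 2 / n ≤ ℓ := by rw [div_le_iff₀ hn, mul_comm]; exact h.ksq
  have hK0 : 0 ≤ K := by rw [hK]; positivity
  have hKD : K ≤ P ^ 3 * D ^ 2 := by
    calc K = 2 * (m : ℝ) ^ 2 * (k ^ 2 / n) + 3 * lamP n k * m * ℓ := by rw [hK]; ring
      _ ≤ 2 * (P * D) ^ 2 * ℓ + 3 * (P * D) * (P * D) * ℓ := by gcongr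
      _ = (5 * ℓ) * (P ^ 2 * D ^ 2) := by ring
      _ ≤ P * (P ^ 2 * D ^ 2) := by gcongr; linarith
      _ = _ := by ring
  have hkP : (k : ℝ) ≤ P * Real.exp (ℓ / 2) := by
    refine h.k_le.trans ?_
    gcongr; linarith
  have hex : Real.exp (ε / 2 * ℓ) ≤ Real.exp (ℓ / 2) := by
    apply Real.exp_le_exp.2; nlinarith
  have hP8' : P ^ 8 ≤ Real.exp (ℓ / 2) := hP8.trans hex
  have hP4 : 4 * P ≤ Real.exp (ℓ / 2) := by
    refine le_trans ?_ hP8'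
    calc 4 * P ≤ P * P := by gcongr; linarith
      _ = P ^ 2 := by ring
      _ ≤ P ^ 8 := pow_le_pow_right₀ (by linarith) (by norm_num)
  have hk4 : 4 * (k : ℝ) ≤ n := by
    rw [hn2]
    calc 4 * (k : ℝ) ≤ 4 * (P * Real.exp (ℓ / 2)) := by gcongr
      _ = (4 * P) * Real.exp (ℓ / 2) := by ring
      _ ≤ _ := by gcongr
  have hD2e : D ^ 2 ≤ Real.exp (ℓ / 2) := by
    rw [← hD2]
    apply le_mul_of_one_le_right (by positivity)
    rw [Real.one_le_exp_iff]; positivity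
  have hK4 : 4 * K ≤ n := by
    calc 4 * K ≤ 4 * (P ^ 3 * D ^ 2) := by gcongr
      _ = 4 * P ^ 3 * D ^ 2 := by ring
      _ ≤ P ^ 8 * D ^ 2 := by
        gcongr
        calc 4 * P ^ 3 ≤ P * P ^ 3 := by gcongr; linarith
          _ = P ^ 4 := by ring
          _ ≤ P ^ 8 := pow_le_pow_right₀ (by linarith) (by norm_num)
      _ ≤ Real.exp (ℓ / 2) * Real.exp (ℓ / 2) := by gcongr
      _ = n := hn2.symm
  have hζ : 4 * K * k ^ 2 / (n : ℝ) ^ 2 ≤ 1 := by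
    have e : 4 * K * k ^ 2 / (n : ℝ) ^ 2 = (4 * K * (k ^ 2 / n)) / n := by field_simp
    rw [e, div_le_one hn]
    calc 4 * K * ((k : ℝ) ^ 2 / n) ≤ 4 * (P ^ 3 * D ^ 2) * P := by
          gcongr; exact hkk.trans (by linarith)
      _ = 4 * P ^ 4 * D ^ 2 := by ring
      _ ≤ P ^ 8 * D ^ 2 := by
        gcongr
        calc 4 * P ^ 4 ≤ P * P ^ 4 := by gcongr; linarith
          _ = P ^ 5 := by ring
          _ ≤ P ^ 8 := pow_le_pow_right₀ (by linarith) (by norm_num)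
      _ ≤ Real.exp (ℓ / 2) * Real.exp (ℓ / 2) := by gcongr
      _ = n := hn2.symm
  refine ⟨hK0, by linarith, by linarith, hζ, ?_, ?_⟩
  · have hLm : LL n k * m ≤ P := by
      have : LL n k * m ≤ LL n k * (ℓ ^ 3 / (3 * LL n k)) := by gcongr
      have e : LL n k * (ℓ ^ 3 / (3 * LL n k)) = ℓ ^ 3 / 3 := by field_simp
      rw [e] at this
      have : 0 ≤ ℓ ^ 3 := by positivity
      linarith
    have hqi : 1 / interProb n k ≤ P := by
      rw [h.qe, Real.exp_neg, one_div, inv_inv]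
      exact Real.exp_le_exp.2 hLθ
    have hq0 := h.q0
    have t1 : (m : ℝ) * (m * (4 * K * k ^ 2 / (n : ℝ) ^ 2 / interProb n k)) ≤ 1 / 4 := by
      have e : (m : ℝ) * (m * (4 * K * k ^ 2 / (n : ℝ) ^ 2 / interProb n k)) =
          (m : ℝ) ^ 2 * (4 * K) * (k ^ 2 / n) * (1 / interProb n k) / n := by field_simp
      rw [e, div_le_iff₀ hn]
      calc (m : ℝ) ^ 2 * (4 * K) * (k ^ 2 / n) * (1 / interProb n k)
          ≤ (P * D) ^ 2 * (4 * (P ^ 3 * D ^ 2)) * P * P := by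
            gcongr; exact hkk.trans (by linarith)
        _ = 4 * P ^ 7 * (D ^ 2 * D ^ 2) := by ring
        _ ≤ P ^ 8 * (D ^ 2 * D ^ 2) := by
            gcongr
            calc 4 * P ^ 7 ≤ P * P ^ 7 := by gcongr; linarith
              _ = P ^ 8 := by ring
        _ ≤ (Real.exp (ε / 2 * ℓ) * (Real.exp (ε / 2 * ℓ) * Real.exp (-(ε / 2 * ℓ)))) *
              (D ^ 2 * D ^ 2) := by rw [hEP, mul_one]; gcongr
        _ ≤ (Real.exp (ε / 2 * ℓ) * (Real.exp (ε / 2 * ℓ) * (1 / 4))) *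
              (D ^ 2 * D ^ 2) := by gcongr
        _ = 1 / 4 * ((D ^ 2 * Real.exp (ε * ℓ)) * D ^ 2) := by rw [hee]; ring
        _ ≤ 1 / 4 * n := by
            rw [hD2, hn2]
            gcongr
    have t2 : (m : ℝ) * ((k : ℝ) / n * (LL n k * Real.exp (LL n k * lamP n k) * (2 * K))) ≤ 1 / 4 := by
      have e : (m : ℝ) * ((k : ℝ) / n * (LL n k * Real.exp (LL n k * lamP n k) * (2 * K))) =
          (LL n k * m) * k * Real.exp (LL n k * lamP n k) * (2 * K) / n := by ring
      rw [e, div_le_iff₀ hn]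
      calc (LL n k * m) * k * Real.exp (LL n k * lamP n k) * (2 * K)
          ≤ P * (P * Real.exp (ℓ / 2)) * P * (2 * (P ^ 3 * D ^ 2)) := by
            have := Real.exp_le_exp.2 hLlam
            gcongr
        _ = 2 * P ^ 6 * (D ^ 2 * Real.exp (ℓ / 2)) := by ring
        _ ≤ P ^ 8 * (D ^ 2 * Real.exp (ℓ / 2)) := by
            gcongr
            calc 2 * P ^ 6 ≤ P * P ^ 6 := by gcongr; linarith
              _ = P ^ 7 := by ring
              _ ≤ P ^ 8 := pow_le_pow_right₀ (by linarith) (by norm_num)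
        _ ≤ (Real.exp (ε / 2 * ℓ) * (Real.exp (ε / 2 * ℓ) * Real.exp (-(ε / 2 * ℓ)))) *
              (D ^ 2 * Real.exp (ℓ / 2)) := by rw [hEP, mul_one]; gcongr
        _ ≤ (Real.exp (ε / 2 * ℓ) * (Real.exp (ε / 2 * ℓ) * (1 / 4))) *
              (D ^ 2 * Real.exp (ℓ / 2)) := by gcongr
        _ = 1 / 4 * ((D ^ 2 * Real.exp (ε * ℓ)) * Real.exp (ℓ / 2)) := by rw [hee]; ring
        _ = 1 / 4 * n := by rw [hD2, hn2]
    rw [mul_add]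
    linarith
  · have h1 : D ≤ Real.exp (ℓ / 2) := by
      apply Real.exp_le_exp.2; nlinarith
    have h2 : 2 * P ≤ Real.exp (ℓ / 2) := by linarith
    have h3 : P * D + P * D ≤ n := by
      rw [hn2]
      calc P * D + P * D = (2 * P) * D := by ring
        _ ≤ _ := by gcongr
    have h4 : 1 ≤ P * D := by
      have : 1 ≤ D := by
        rw [hD, Real.one_le_exp_iff]
        apply mul_nonneg _ hl0.le; linarith
      nlinarith
    linarith
end PF

open Filter

theorem binom_cheb (M : ℕ) (p : ℝ) (hp0 : 0 ≤ p) (hp1 : p ≤ 1) (h8 : 8 ≤ p * M) :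
    1 / 2 ≤ binomProbGe M p ⌊p * M / 2⌋₊ := by
  have hvar := congrArg (Polynomial.eval p) (bernsteinPolynomial.variance ℝ M)
  have hsum := congrArg (Polynomial.eval p) (bernsteinPolynomial.sum ℝ M)
  simp only [Polynomial.eval_finsetSum, bernsteinPolynomial, Polynomial.eval_mul,
    Polynomial.eval_pow, Polynomial.eval_sub, Polynomial.eval_X, Polynomial.eval_one,
    Polynomial.eval_natCast, Polynomial.eval_smul, nsmul_eq_mul, Polynomial.eval_mul] at hvar hsum
  set f : ℕ → ℝ := fun j => (M.choose j : ℝ) * p ^ j * (1 - p) ^ (M - j) with hf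
  have hf0 : ∀ j, 0 ≤ f j := fun j => by
    have : 0 ≤ 1 - p := by linarith
    rw [hf]; positivity
  set t := ⌊p * M / 2⌋₊ with ht
  have hte : (t : ℝ) ≤ p * M / 2 := Nat.floor_le (by linarith)
  have hs1 : ∑ j ∈ (Finset.range (M + 1)).filter (fun j => j < t), f j +
      ∑ j ∈ (Finset.range (M + 1)).filter (fun j => ¬ j < t), f j = 1 := by
    rw [Finset.sum_filter_add_sum_filter_not]; exact hsum
  have hge : binomProbGe M p t = ∑ j ∈ (Finset.range (M + 1)).filter (fun j => ¬ j < t), f j := by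
    unfold binomProbGe
    apply Finset.sum_congr _ (fun _ _ => rfl)
    ext j
    simp only [Finset.mem_Icc, Finset.mem_filter, Finset.mem_range]
    omega
  have hlow : (∑ j ∈ (Finset.range (M + 1)).filter (fun j => j < t), f j) * (p * M / 2) ^ 2 ≤
      M * p * (1 - p) := by
    rw [← hvar, Finset.sum_mul]
    refine (Finset.sum_le_sum (fun j hj => ?_)).trans
      (Finset.sum_le_sum_of_subset_of_nonneg (Finset.filter_subset _ _)
        (fun j _ _ => mul_nonneg (sq_nonneg _) (hf0 j)))
    have hj1 : j < t := (Finset.mem_filter.1 hj).2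
    have hj2 : (j : ℝ) ≤ p * M / 2 := le_trans (by exact_mod_cast hj1.le) hte
    rw [mul_comm]
    apply mul_le_mul_of_nonneg_right _ (hf0 j)
    apply pow_le_pow_left₀ (by linarith)
    linarith
  rw [hge]
  have hx : (∑ j ∈ (Finset.range (M + 1)).filter (fun j => j < t), f j) ≤ 1 / 2 := by
    by_contra hcon
    push Not at hcon
    have h1 : (1 / 2 : ℝ) * (p * M / 2) ^ 2 < M * p * (1 - p) :=
      lt_of_lt_of_le (mul_lt_mul_of_pos_right hcon (by positivity)) hlow
    have h2 : (M : ℝ) * p * (1 - p) ≤ p * M := by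
      have : 0 ≤ (M : ℝ) * p * p := by positivity
      linarith
    nlinarith
  linarith

theorem alpha1_ge (n k : ℕ) (p : ℝ) (hp0 : 0 ≤ p) (hp1 : p ≤ 1) (hl : 0 < Real.log n)
    (h8 : 8 ≤ phi n k p) : phi n k p ≤ 4 * alpha1 n k p := by
  unfold phi at *
  set M := (n - 1).choose (k - 1) with hM
  have hn : (0 : ℝ) < n := by
    by_contra h
    have : n = 0 := by
      have : (n : ℝ) ≤ 0 := not_lt.1 h
      exact_mod_cast le_antisymm this (by positivity)
    rw [this] at hl; simp at hl
  have h1 := binom_cheb M p hp0 hp1 h8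
  have hb : Real.log n / n ≤ 1 / 2 := by
    rw [div_le_iff₀ hn]
    have e : (n : ℝ) = Real.exp (Real.log n / 2) ^ 2 := by
      rw [← Real.exp_nat_mul]; push_cast
      rw [show 2 * (Real.log n / 2) = Real.log n by ring, Real.exp_log hn]
    have h3 := Real.add_one_le_exp (Real.log n / 2)
    have h4 : (Real.log n / 2 + 1) ^ 2 ≤ Real.exp (Real.log n / 2) ^ 2 :=
      pow_le_pow_left₀ (by linarith) h3 2
    rw [← e] at h4
    nlinarith [sq_nonneg (Real.log n / 2 - 1)]
  have hle : ⌊p * M / 2⌋₊ ≤ alpha1 n k p := by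
    unfold alpha1
    apply le_csSup
    · refine ⟨M, fun t ht => ?_⟩
      by_contra hcon
      push Not at hcon
      have ht' : Real.log n / n ≤ binomProbGe M p t := ht
      have h0 : binomProbGe M p t = 0 := by
        unfold binomProbGe
        rw [Finset.Icc_eq_empty (by omega)]; simp
      rw [h0] at ht'
      have := div_pos hl hn
      linarith
    · exact hb.trans h1
  have h2 := Nat.lt_floor_add_one (p * M / 2)
  have h3 : (⌊p * M / 2⌋₊ : ℝ) ≤ alpha1 n k p := by exact_mod_cast hle
  linarith

theorem phi_le (n k : ℕ) (p s : ℝ) (hp0 : 0 ≤ p) (hp1 : p ≤ 1) (hl : 0 < Real.log n)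
    (hm : 1 ≤ gammaP n k p s) (hφ : phi n k p ≤ phiStar n k) :
    phi n k p ≤ 8 * gammaP n k p s := by
  have hm' : (1 : ℝ) ≤ gammaP n k p s := by exact_mod_cast hm
  rcases le_total (alphaP n k p s) ⌊phiStar n k / 3⌋₊ with h | h
  · have e : gammaP n k p s = alphaP n k p s := min_eq_left h
    rw [e] at hm' ⊢
    by_cases h8 : 8 ≤ phi n k p
    · have h1 := alpha1_ge n k p hp0 hp1 hl h8
      have h2 : (alpha1 n k p : ℝ) ≤ alphaP n k p s := by exact_mod_cast le_max_left _ _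
      linarith
    · linarith
  · have e : gammaP n k p s = ⌊phiStar n k / 3⌋₊ := min_eq_right h
    rw [e] at hm' ⊢
    have := Nat.lt_floor_add_one (phiStar n k / 3)
    linarith

open Filter

theorem mubar_eq (n k : ℕ) (p : ℝ) (hk : 1 ≤ k) (hkn : k ≤ n) :
    mubar n k p = p * n.choose k := by
  unfold mubar phi
  have hk0 : (0 : ℝ) < k := by exact_mod_cast hk
  obtain ⟨k', rfl⟩ : ∃ k', k = k' + 1 := ⟨k - 1, by omega⟩
  obtain ⟨n', rfl⟩ : ∃ n', n = n' + 1 := ⟨n - 1, by omega⟩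
  have := Nat.add_one_mul_choose_eq n' k'
  have h' : ((n' + 1 : ℕ) : ℝ) * (n'.choose k' : ℕ) = ((n' + 1).choose (k' + 1) : ℕ) * ((k' + 1 : ℕ) : ℝ) := by
    exact_mod_cast this
  rw [div_eq_iff hk0.ne']
  simp only [Nat.add_sub_cancel]
  calc p * (n'.choose k' : ℝ) * ((n' + 1 : ℕ) : ℝ) = p * (((n' + 1 : ℕ) : ℝ) * (n'.choose k' : ℕ)) := by ring
    _ = _ := by rw [h']; ring

theorem star_card (n k : ℕ) (hk : 1 ≤ k) (x : Fin n) :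
    ((kSets n k).filter (fun A => x ∈ A)).card = (n - 1).choose (k - 1) := by
  classical
  have h : (kSets n k).filter (fun A => x ∈ A) =
      (Finset.powersetCard (k - 1) (Finset.univ.erase x)).image (fun A => insert x A) := by
    ext A
    simp only [kSets, Finset.mem_filter, Finset.mem_powersetCard, Finset.mem_image]
    constructor
    · rintro ⟨⟨-, h1⟩, h2⟩
      exact ⟨A.erase x, ⟨Finset.erase_subset_erase _ (Finset.subset_univ _),
        by rw [Finset.card_erase_of_mem h2, h1]⟩, Finset.insert_erase h2⟩
    · rintro ⟨B, ⟨h1, h2⟩, rfl⟩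
      have hx : x ∉ B := fun h => by simpa using h1 h
      refine ⟨⟨Finset.subset_univ _, ?_⟩, Finset.mem_insert_self _ _⟩
      rw [Finset.card_insert_of_notMem hx, h2]; omega
  rw [h, Finset.card_image_of_injOn, Finset.card_powersetCard, Finset.card_erase_of_mem (Finset.mem_univ _)]
  · simp
  · intro A hA B hB hAB
    simp only [Finset.mem_coe, Finset.mem_powersetCard] at hA hB
    have hxA : x ∉ A := fun h => by simpa using hA.1 h
    have hxB : x ∉ B := fun h => by simpa using hB.1 h
    simp only at hAB
    rw [← Finset.erase_insert hxA, hAB, Finset.erase_insert hxB]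

theorem prob_deg_ge (n k : ℕ) (p : ℝ) (hp0 : 0 ≤ p) (hp1 : p ≤ 1) (hk : 1 ≤ k) (T : ℕ) (hT : 1 ≤ T) :
    hprob n k p (fun H => T ≤ maxDegree H) ≤ n * phi n k p ^ T := by
  classical
  set F : Finset (Finset (Finset (Fin n))) :=
    Finset.univ.biUnion (fun x : Fin n => Finset.powersetCard T ((kSets n k).filter (fun A => x ∈ A)))
    with hF
  have hsub : ∀ C ∈ F, C ⊆ kSets n k ∧ C.card = T := by
    intro C hC
    simp only [hF, Finset.mem_biUnion, Finset.mem_univ, true_and, Finset.mem_powersetCard] at hC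
    obtain ⟨x, h1, h2⟩ := hC
    exact ⟨h1.trans (Finset.filter_subset _ _), h2⟩
  refine (hprob_mono hp0 hp1 (Q := fun H => ∃ C ∈ F, C ⊆ H) ?_).trans
      ((hprob_first_moment hp0 hp1 F (fun C hC => (hsub C hC).1)).trans ?_)
  · intro H hH hT'
    obtain ⟨x, hx⟩ : ∃ x : Fin n, T ≤ vdeg H x := by
      by_contra hcon
      push Not at hcon
      have : maxDegree H < T := by
        unfold maxDegree
        rw [Finset.sup_lt_iff (by exact hT)]
        exact fun x _ => hcon x
      omega
    obtain ⟨C, hC1, hC2⟩ := Finset.exists_subset_card_eq (s := starOf H x) (n := T) hx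
    refine ⟨C, ?_, hC1.trans (Finset.filter_subset _ _)⟩
    simp only [hF, Finset.mem_biUnion, Finset.mem_univ, true_and, Finset.mem_powersetCard]
    exact ⟨x, hC1.trans (Finset.filter_subset_filter _ hH), hC2⟩
  · rw [Finset.sum_congr rfl (fun C hC => by rw [(hsub C hC).2]), Finset.sum_const, nsmul_eq_mul]
    have h1 : (F.card : ℝ) ≤ n * ((n - 1).choose (k - 1) : ℝ) ^ T := by
      have : F.card ≤ n * ((n - 1).choose (k - 1)) ^ T := by
        refine Finset.card_biUnion_le.trans ?_
        refine (Finset.sum_le_sum (fun x _ => ?_)).trans (b := ∑ x : Fin n, ((n - 1).choose (k - 1)) ^ T) ?_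
        · rw [Finset.card_powersetCard, star_card n k hk]
          exact Nat.choose_le_pow _ _
        · simp
      exact_mod_cast this
    calc (F.card : ℝ) * p ^ T ≤ (n * ((n - 1).choose (k - 1) : ℝ) ^ T) * p ^ T := by gcongr
      _ = _ := by unfold phi; rw [mul_pow]; ring

theorem prob_one (n k : ℕ) (p : ℝ) (hp0 : 0 ≤ p) (hp1 : p ≤ 1) (hk : 1 ≤ k) (hkn : k ≤ n) :
    hprob n k p (fun H => 1 ≤ maxDegree H) ≤ mubar n k p := by
  classical
  set F : Finset (Finset (Finset (Fin n))) := (kSets n k).image (fun A => {A}) with hF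
  have hsub : ∀ C ∈ F, C ⊆ kSets n k ∧ C.card = 1 := by
    intro C hC
    simp only [hF, Finset.mem_image] at hC
    obtain ⟨A, hA, rfl⟩ := hC
    simpa using hA
  refine (hprob_mono hp0 hp1 (Q := fun H => ∃ C ∈ F, C ⊆ H) ?_).trans
      ((hprob_first_moment hp0 hp1 F (fun C hC => (hsub C hC).1)).trans ?_)
  · intro H hH hT'
    have hne : H.Nonempty := by
      by_contra hcon
      rw [Finset.not_nonempty_iff_eq_empty] at hcon
      rw [hcon] at hT'
      have : maxDegree (∅ : Finset (Finset (Fin n))) = 0 := by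
        unfold maxDegree
        exact (Finset.sup_eq_bot_iff _ _).2 (fun x _ => by simp [vdeg, starOf])
      omega
    obtain ⟨A, hA⟩ := hne
    exact ⟨{A}, Finset.mem_image_of_mem _ (hH hA), by simpa using hA⟩
  · rw [Finset.sum_congr rfl (fun C hC => by rw [(hsub C hC).2]), Finset.sum_const, nsmul_eq_mul,
      mubar_eq n k p hk hkn, pow_one, mul_comm]
    gcongr
    rw [← card_kSets]
    exact Finset.card_image_le

theorem prob_two (n k : ℕ) (p : ℝ) (hp0 : 0 ≤ p) (hp1 : p ≤ 1) (hk : 1 ≤ k) (hkn : k ≤ n) :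
    hprob n k p (fun H => 2 ≤ maxDegree H) ≤ interProb n k * mubar n k p ^ 2 / 2 := by
  classical
  set F : Finset (Finset (Finset (Fin n))) :=
    (Finset.powersetCard 2 (kSets n k)).filter (fun C => IsClique C) with hF
  have hsub : ∀ C ∈ F, C ⊆ kSets n k ∧ C.card = 2 := by
    intro C hC
    rw [hF, Finset.mem_filter, Finset.mem_powersetCard] at hC
    exact hC.1
  refine (hprob_mono hp0 hp1 (Q := fun H => ∃ C ∈ F, C ⊆ H) ?_).trans
      ((hprob_first_moment hp0 hp1 F (fun C hC => (hsub C hC).1)).trans ?_)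
  · intro H hH hT'
    obtain ⟨x, hx⟩ : ∃ x : Fin n, 2 ≤ vdeg H x := by
      by_contra hcon
      push Not at hcon
      have : maxDegree H < 2 := by
        unfold maxDegree
        rw [Finset.sup_lt_iff (by norm_num)]
        exact fun x _ => hcon x
      omega
    obtain ⟨C, hC1, hC2⟩ := Finset.exists_subset_card_eq (s := starOf H x) (n := 2) hx
    have hCH := hC1.trans (Finset.filter_subset _ _)
    refine ⟨C, ?_, hCH⟩
    rw [hF, Finset.mem_filter, Finset.mem_powersetCard]
    refine ⟨⟨hCH.trans hH, hC2⟩, fun A hA B hB => ⟨x, Finset.mem_inter.2 ⟨?_, ?_⟩⟩⟩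
    · exact (Finset.mem_filter.1 (hC1 hA)).2
    · exact (Finset.mem_filter.1 (hC1 hB)).2
  · rw [Finset.sum_congr rfl (fun C hC => by rw [(hsub C hC).2]), Finset.sum_const, nsmul_eq_mul,
      mubar_eq n k p hk hkn]
    have hcount : F.card * 2 ≤ (((kSets n k) ×ˢ (kSets n k)).filter
        fun AB => (AB.1 ∩ AB.2).Nonempty).card * 1 := by
      refine Finset.card_mul_le_card_mul (fun C AB => C = {AB.1, AB.2}) ?_ ?_
      · intro C hC
        have hC' := hsub C hC
        have hcl : IsClique C := (Finset.mem_filter.1 hC).2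
        obtain ⟨A, B, hAB, rfl⟩ := Finset.card_eq_two.1 hC'.2
        have hA : A ∈ kSets n k := hC'.1 (by simp)
        have hB : B ∈ kSets n k := hC'.1 (by simp)
        have h2 : (({(A, B), (B, A)} : Finset (Finset (Fin n) × Finset (Fin n)))).card = 2 := by
          apply Finset.card_pair
          intro h
          exact hAB (Prod.mk.inj h).1
        rw [← h2]
        apply Finset.card_le_card
        intro z hz
        rw [Finset.mem_insert, Finset.mem_singleton] at hz
        rw [Finset.mem_bipartiteAbove, Finset.mem_filter, Finset.mem_product]
        rcases hz with rfl | rfl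
        · exact ⟨⟨⟨hA, hB⟩, hcl A (by simp) B (by simp)⟩, rfl⟩
        · exact ⟨⟨⟨hB, hA⟩, hcl B (by simp) A (by simp)⟩, Finset.pair_comm _ _⟩
      · intro AB _
        rw [Finset.card_le_one]
        intro C hC D hD
        rw [Finset.mem_bipartiteBelow] at hC hD
        rw [hC.2, hD.2]
    have hq : interProb n k * (n.choose k : ℝ) ^ 2 = ((((kSets n k) ×ˢ (kSets n k)).filter
        fun AB => (AB.1 ∩ AB.2).Nonempty).card : ℝ) := by
      unfold interProb
      rw [card_kSets]
      have : (n.choose k : ℝ) ≠ 0 := by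
        have := Nat.choose_pos hkn
        positivity
      rw [div_mul_cancel₀]
      exact pow_ne_zero _ this
    have hc : (F.card : ℝ) * 2 ≤ interProb n k * (n.choose k : ℝ) ^ 2 := by
      rw [hq]; exact_mod_cast (by simpa using hcount)
    calc (F.card : ℝ) * p ^ 2 = (F.card * 2) * p ^ 2 / 2 := by ring
      _ ≤ (interProb n k * (n.choose k : ℝ) ^ 2) * p ^ 2 / 2 := by gcongr
      _ = _ := by ring

open Filter

theorem Lam_ge_one (n k : ℕ) (p : ℝ) (T : ℕ) (q0 : 0 < interProb n k) (q1 : interProb n k ≤ 1)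
    (hμ : (T : ℝ) ≤ (mubar n k p - T) * interProb n k ^ T) (t : ℕ) (ht : t ≤ T) (hT : 1 ≤ T) :
    1 ≤ Lam n k p t := by
  set μ := mubar n k p
  set q := interProb n k
  have hT0 : (0 : ℝ) < T := by exact_mod_cast hT
  have hqT : 0 < q ^ T := by positivity
  have hμT : 0 < μ - T := by
    by_contra h
    have : (μ - T) * q ^ T ≤ 0 := mul_nonpos_of_nonpos_of_nonneg (not_lt.1 h) hqT.le
    linarith
  unfold Lam gchoose
  have h1 : (μ - T) ^ t ≤ ∏ i ∈ Finset.range t, (μ - i) := by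
    rw [← Finset.card_range t, ← Finset.prod_const, Finset.card_range]
    apply Finset.prod_le_prod
    · intros; exact hμT.le
    · intro i hi
      have : i ≤ T := by have := Finset.mem_range.1 hi; omega
      have : (i : ℝ) ≤ T := by exact_mod_cast this
      linarith
  have h2 : (t.factorial : ℝ) ≤ (T : ℝ) ^ t := by
    have : t.factorial ≤ T ^ t := (Nat.factorial_le_pow t).trans (Nat.pow_le_pow_left ht t)
    exact_mod_cast this
  have h3 : (q ^ T) ^ t ≤ q ^ t.choose 2 := by
    rw [← pow_mul]
    apply pow_le_pow_of_le_one q0.le q1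
    calc t.choose 2 ≤ t * t := by
          rw [Nat.choose_two_right]
          exact (Nat.div_le_self _ _).trans (Nat.mul_le_mul_left _ (Nat.sub_le _ _))
      _ ≤ T * t := Nat.mul_le_mul_right _ ht
  calc (1 : ℝ) ≤ ((μ - T) * q ^ T / T) ^ t := by
        apply one_le_pow₀
        rw [le_div_iff₀ hT0]; linarith
    _ = (μ - T) ^ t / (T : ℝ) ^ t * (q ^ T) ^ t := by rw [div_pow, mul_pow]; ring
    _ ≤ _ := by
        have h4 : 0 ≤ ∏ i ∈ Finset.range t, (μ - i) := le_trans (by positivity) h1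
        gcongr

theorem prob_split {n k : ℕ} {p : ℝ} (hp0 : 0 ≤ p) (hp1 : p ≤ 1) (P Q : Finset (Finset (Fin n)) → Prop)
    (h : ∀ H, P H ∨ Q H) : 1 ≤ hprob n k p P + hprob n k p Q := by
  have h1 := hprob_not (n := n) (k := k) (p := p) P
  have h2 : hprob n k p (fun H => ¬ P H) ≤ hprob n k p Q :=
    hprob_mono hp0 hp1 (fun H _ hP => (h H).resolve_left hP)
  linarith

theorem two_contra (q μ : ℝ) (q0 : 0 < q) (q1 : q < 1) (hμ : 1 / 2 ≤ μ)
    (a1 : 1.98 ≤ q * μ ^ 2) (hC : μ * (μ - 1) / 2 * q ≤ 0.01) : False := by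
  have a2 : q * μ ≥ 1.96 := by
    have : q * μ = q * μ ^ 2 - 2 * (μ * (μ - 1) / 2 * q) := by ring
    linarith
  have a3 : μ ≥ 1.96 := by
    have : q * μ ≤ 1 * μ := mul_le_mul_of_nonneg_right q1.le (by linarith)
    linarith
  have a4 : q * μ * (μ - 1) ≥ 1.96 * 0.96 :=
    mul_le_mul a2 (by linarith) (by norm_num) (by linarith)
  have : q * μ * (μ - 1) = 2 * (μ * (μ - 1) / 2 * q) := by ring
  linarith

set_option maxHeartbeats 1000000 in
theorem phi_lower {ε : ℝ} {n k : ℕ} (h : PF ε n k) (p s u : ℝ) (hp0 : 0 ≤ p) (hp1 : p ≤ 1)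
    (hs : s < 1 / 100) (hu : u < 1 / 100)
    (hLam : hprob n k p (fun H => s < Lam n k p (maxDegree H)) < u) :
    Real.exp (-(ε / 2 * Real.log n)) ≤ phi n k p := by
  by_contra hcon
  push Not at hcon
  have hkn : k ≤ n := by have := h.k2; omega
  have hk := h.k1
  have e0 := h.e0
  have e4 := h.e4
  have l1 := h.l1
  have hP := h.P
  have hθ1 := h.θle
  have hL1 := h.L1
  have hθ0 := h.θpos
  have hlθ := h.lθ
  have hqe := h.qe
  have hne := h.n0
  have hn := h.npos
  set ℓ := Real.log n with hℓ
  set θ := ε ^ 2 / 16 with hθ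
  have hphi0 : 0 ≤ phi n k p := by unfold phi; positivity
  have h1P : 100 * ℓ ≤ Real.exp (θ * ℓ) := by
    have : ℓ ≤ ℓ ^ 4 := le_self_pow₀ l1 (by norm_num)
    linarith
  have hex : ∀ c : ℝ, 1 / 100 ≤ c → 100 * ℓ ≤ Real.exp (c * ℓ) := by
    intro c hc
    refine h1P.trans (Real.exp_le_exp.2 ?_)
    apply mul_le_mul_of_nonneg_right _ (by linarith)
    linarith
  have h0 : Lam n k p 0 = 1 := by simp [Lam, gchoose]
  have h1 : Lam n k p 1 = mubar n k p := by simp [Lam, gchoose]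
  have h2 : Lam n k p 2 = mubar n k p * (mubar n k p - 1) / 2 * interProb n k := by
    simp [Lam, gchoose, Finset.prod_range_succ]
  by_cases hA : Real.exp (1 / 20 * ℓ) ≤ mubar n k p
  · set T := ⌈4 / ε⌉₊ with hT
    have hT1 : 4 / ε ≤ T := Nat.le_ceil _
    have hT2 : (T : ℝ) < 4 / ε + 1 := Nat.ceil_lt_add_one (by positivity)
    have hT3 : (T : ℝ) ≤ 5 / ε := by
      have : 1 ≤ 1 / ε := by rw [le_div_iff₀ e0]; linarith
      have e : 5 / ε = 4 / ε + 1 / ε := by ring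
      linarith
    have hT0 : 1 ≤ T := by
      have : (0 : ℝ) < T := lt_of_lt_of_le (by positivity) hT1
      have : 0 < T := by exact_mod_cast this
      omega
    have hTε : (T : ℝ) * ε ≤ 5 := by rwa [le_div_iff₀ e0] at hT3
    have hTl : (T : ℝ) ≤ ℓ := by
      have h3 : θ ^ 2 ≤ ε / 5 := by nlinarith
      have h4 : 1 ≤ ε / 5 * ℓ := hlθ.trans (mul_le_mul_of_nonneg_right h3 (by linarith))
      refine hT3.trans ?_
      rw [div_le_iff₀ e0]; linarith
    have hqT : Real.exp (-(1 / 50 * ℓ)) ≤ interProb n k ^ T := by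
      rw [hqe, ← Real.exp_nat_mul]
      apply Real.exp_le_exp.2
      have h5 : (T : ℝ) * LL n k ≤ T * (θ ^ 2 / 4 * ℓ) := mul_le_mul_of_nonneg_left hL1 (by positivity)
      have h6 : (T : ℝ) * θ ≤ 5 / 64 := by
        have : (T : ℝ) * θ ≤ T * (ε / 64) := mul_le_mul_of_nonneg_left hθ1 (by positivity)
        linarith
      have h7 : (T : ℝ) * (θ ^ 2 / 4) ≤ 1 / 50 := by
        have : (T : ℝ) * (θ ^ 2 / 4) = (T * θ) * (θ / 4) := by ring
        rw [this]
        have : (T * θ) * (θ / 4) ≤ (5 / 64) * (θ / 4) := mul_le_mul_of_nonneg_right h6 (by linarith)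
        linarith
      have h8 : (T : ℝ) * (θ ^ 2 / 4) * ℓ ≤ 1 / 50 * ℓ := mul_le_mul_of_nonneg_right h7 (by linarith)
      linarith
    have hmain : (T : ℝ) ≤ (mubar n k p - T) * interProb n k ^ T := by
      have h3 := hex (3 / 100) (by norm_num)
      have h4 : Real.exp (1 / 20 * ℓ) = Real.exp (3 / 100 * ℓ) * Real.exp (1 / 50 * ℓ) := by
        rw [← Real.exp_add]; congr 1; ring
      have h5 : 1 ≤ Real.exp (1 / 50 * ℓ) := by rw [Real.one_le_exp_iff]; linarith
      have h6 : (T : ℝ) * Real.exp (1 / 50 * ℓ) ≤ mubar n k p - T := by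
        have h7 : (100 * ℓ) * Real.exp (1 / 50 * ℓ) ≤ Real.exp (1 / 20 * ℓ) := by
          rw [h4]; gcongr
        have h8 : (2 * (T : ℝ)) * Real.exp (1 / 50 * ℓ) ≤ (100 * ℓ) * Real.exp (1 / 50 * ℓ) := by
          gcongr; linarith
        have h9 : (T : ℝ) ≤ T * Real.exp (1 / 50 * ℓ) := le_mul_of_one_le_right (by positivity) h5
        linarith
      calc (T : ℝ) = (T * Real.exp (1 / 50 * ℓ)) * Real.exp (-(1 / 50 * ℓ)) := by
            rw [mul_assoc, ← Real.exp_add]; simp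
        _ ≤ _ := mul_le_mul h6 hqT (Real.exp_pos _).le (le_trans (by positivity) h6)
    have hd := prob_deg_ge n k p hp0 hp1 hk T hT0
    have hd2 : (n : ℝ) * phi n k p ^ T ≤ 1 / 2 := by
      have h3 : phi n k p ^ T ≤ Real.exp (-(2 * ℓ)) := by
        calc phi n k p ^ T ≤ Real.exp (-(ε / 2 * ℓ)) ^ T := by gcongr
          _ = Real.exp (T * (-(ε / 2 * ℓ))) := by rw [Real.exp_nat_mul]
          _ ≤ _ := by
            apply Real.exp_le_exp.2
            have h3 : 4 ≤ T * ε := by rwa [div_le_iff₀ e0] at hT1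
            have := mul_le_mul_of_nonneg_right h3 (show 0 ≤ ℓ by linarith)
            linarith
      calc (n : ℝ) * phi n k p ^ T ≤ n * Real.exp (-(2 * ℓ)) := by gcongr
        _ = Real.exp (-ℓ) := by
          conv_lhs => rw [hne]
          rw [← Real.exp_add]; congr 1; ring
        _ ≤ 1 / 2 := by
          rw [Real.exp_neg, one_div]
          apply inv_anti₀ (by norm_num)
          have := Real.add_one_le_exp ℓ
          linarith
    have hsp := prob_split (n := n) (k := k) hp0 hp1 (fun H => s < Lam n k p (maxDegree H))
      (fun H => T ≤ maxDegree H) (fun H => by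
        rcases le_or_gt T (maxDegree H) with h' | h'
        · exact Or.inr h'
        · left
          have := Lam_ge_one n k p T h.q0 h.q1.le hmain (maxDegree H) h'.le hT0
          linarith)
    linarith
  · push Not at hA
    have hd := prob_deg_ge n k p hp0 hp1 hk 3 (by norm_num)
    have hphi : phi n k p ≤ Real.exp (-(2 / 5 * ℓ)) := by
      have e : phi n k p = mubar n k p * ((k : ℝ) / n) := by
        unfold mubar
        have := h.kpos
        field_simp
      have hm0 : 0 ≤ mubar n k p := by unfold mubar; positivity
      have h3 : ℓ ≤ Real.exp (1 / 20 * ℓ) := by have := hex (1 / 20) (by norm_num); linarith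
      rw [e]
      calc mubar n k p * ((k : ℝ) / n) ≤ Real.exp (1 / 20 * ℓ) * (Real.exp (1 / 20 * ℓ) * Real.exp (-(ℓ / 2))) := by
            refine mul_le_mul hA.le (h.kn_le.trans ?_) (by positivity) (Real.exp_pos _).le
            gcongr
        _ = _ := by rw [← Real.exp_add, ← Real.exp_add]; congr 1; ring
    have hd3 : (n : ℝ) * phi n k p ^ 3 ≤ 1 / 100 := by
      calc (n : ℝ) * phi n k p ^ 3 ≤ n * Real.exp (-(2 / 5 * ℓ)) ^ 3 := by gcongr
        _ = Real.exp (-(1 / 5 * ℓ)) := by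
          conv_lhs => rw [hne]
          rw [← Real.exp_nat_mul, ← Real.exp_add]; congr 1; push_cast; ring
        _ ≤ 1 / 100 := by
          rw [Real.exp_neg, show (1 : ℝ) / 100 = (100)⁻¹ by norm_num]
          apply inv_anti₀ (by norm_num)
          have := hex (1 / 5) (by norm_num)
          linarith
    by_cases hB : mubar n k p < 1 / 2
    · have hone := prob_one n k p hp0 hp1 hk hkn
      have hsp := prob_split (n := n) (k := k) hp0 hp1 (fun H => s < Lam n k p (maxDegree H))
        (fun H => 1 ≤ maxDegree H) (fun H => by
          rcases Nat.eq_zero_or_pos (maxDegree H) with h' | h'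
          · left; rw [h', h0]; linarith
          · exact Or.inr h')
      linarith
    · push Not at hB
      have htwo := prob_two n k p hp0 hp1 hk hkn
      have hsp := prob_split (n := n) (k := k) hp0 hp1 (fun H => s < Lam n k p (maxDegree H))
        (fun H => 2 ≤ maxDegree H) (fun H => by
          rcases le_or_gt 2 (maxDegree H) with h' | h'
          · exact Or.inr h'
          · left
            have : maxDegree H = 0 ∨ maxDegree H = 1 := by omega
            rcases this with h'' | h''
            · rw [h'', h0]; linarith
            · rw [h'', h1]; linarith)
      by_cases hC : s < Lam n k p 2
      · have hsp2 := prob_split (n := n) (k := k) hp0 hp1 (fun H => s < Lam n k p (maxDegree H))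
          (fun H => 3 ≤ maxDegree H) (fun H => by
            rcases le_or_gt 3 (maxDegree H) with h' | h'
            · exact Or.inr h'
            · left
              have : maxDegree H = 0 ∨ maxDegree H = 1 ∨ maxDegree H = 2 := by omega
              rcases this with h'' | h'' | h''
              · rw [h'', h0]; linarith
              · rw [h'', h1]; linarith
              · rw [h'']; exact hC)
        linarith
      · push Not at hC
        rw [h2] at hC
        exact two_contra _ _ h.q0 h.q1 hB (by linarith) (by linarith)

open Filter

theorem Lam_succ (n k : ℕ) (p : ℝ) (t : ℕ) :
    Lam n k p (t + 1) = Lam n k p t * ((mubar n k p - t) / (t + 1) * interProb n k ^ t) := by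
  unfold Lam gchoose
  rw [Finset.prod_range_succ, Nat.factorial_succ, Nat.choose_succ_succ' t 1]
  simp only [Nat.choose_one_right, Nat.reduceAdd, pow_add]
  push_cast
  have : (t.factorial : ℝ) ≠ 0 := by positivity
  have : (t : ℝ) + 1 ≠ 0 := by positivity
  field_simp

theorem Lam_pos (n k : ℕ) (p : ℝ) (q0 : 0 < interProb n k) (t : ℕ) (ht : (t : ℝ) ≤ mubar n k p) :
    0 < Lam n k p t := by
  unfold Lam gchoose
  have : 0 < ∏ i ∈ Finset.range t, (mubar n k p - i) := by
    apply Finset.prod_pos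
    intro i hi
    have : (i : ℝ) < t := by exact_mod_cast Finset.mem_range.1 hi
    linarith
  positivity

theorem Lam_anti (n k : ℕ) (p : ℝ) (q0 : 0 < interProb n k) (q1 : interProb n k ≤ 1) (a m : ℕ)
    (hm : (m : ℝ) ≤ mubar n k p) (ham : a + 1 ≤ m)
    (hlt : Lam n k p (a + 1) ≤ Lam n k p a) : Lam n k p m ≤ Lam n k p (a + 1) := by
  have hr : ∀ t : ℕ, a ≤ t → t < m → (mubar n k p - t) / (t + 1) * interProb n k ^ t ≤ 1 := by
    intro t hat htm
    have h1 : (mubar n k p - a) / (a + 1) * interProb n k ^ a ≤ 1 := by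
      have hp : 0 < Lam n k p a := by
        apply Lam_pos n k p q0
        have : (a : ℝ) ≤ m := by exact_mod_cast (by omega)
        linarith
      rw [Lam_succ] at hlt
      by_contra hc
      push Not at hc
      have := mul_lt_mul_of_pos_left hc hp
      linarith
    refine le_trans ?_ h1
    have hat' : (a : ℝ) ≤ t := by exact_mod_cast hat
    have htm' : (t : ℝ) < m := by exact_mod_cast htm
    have h2 : 0 ≤ mubar n k p - a := by linarith
    apply mul_le_mul _ (pow_le_pow_of_le_one q0.le q1 hat) (by positivity) (by positivity)
    apply div_le_div₀ h2 (by linarith) (by positivity) (by linarith)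
  have key : ∀ t, a + 1 ≤ t → t ≤ m → Lam n k p t ≤ Lam n k p (a + 1) := by
    intro t hat
    induction t, hat using Nat.le_induction with
    | base => intro _; exact le_rfl
    | succ t ht ih =>
      intro htm
      have hp : 0 < Lam n k p t := by
        apply Lam_pos n k p q0
        have : (t : ℝ) ≤ m := by exact_mod_cast (by omega)
        linarith
      rw [Lam_succ]
      refine le_trans ?_ (ih (by omega))
      exact mul_le_of_le_one_right hp.le (hr t (by omega) (by omega))
  exact key m ham le_rfl

theorem S0_le (n k : ℕ) (p : ℝ) (q0 : 0 < interProb n k) (m : ℕ)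
    (hm : 2 * (m : ℝ) ^ 2 ≤ mubar n k p) (hm1 : 1 ≤ m) :
    mubar n k p ^ m / m.factorial * interProb n k ^ m.choose 2 ≤ 2 * Lam n k p m := by
  unfold Lam gchoose
  set μ := mubar n k p
  have hm0 : (1 : ℝ) ≤ m := by exact_mod_cast hm1
  have hmm : (m : ℝ) ≤ (m : ℝ) ^ 2 := by nlinarith
  have hμ : 0 < μ := by linarith
  have h1 : (μ - m) ^ m ≤ ∏ i ∈ Finset.range m, (μ - i) := by
    rw [← Finset.card_range m, ← Finset.prod_const, Finset.card_range]
    apply Finset.prod_le_prod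
    · intros; linarith
    · intro i hi
      have : (i : ℝ) < m := by exact_mod_cast Finset.mem_range.1 hi
      linarith
  have h2 : 1 / 2 ≤ (1 + -(m / μ)) ^ m := by
    have hmμ : (m : ℝ) / μ ≤ 1 := by rw [div_le_one hμ]; linarith
    have hb := one_add_mul_le_pow (a := -((m : ℝ) / μ)) (by linarith) m
    refine le_trans ?_ hb
    have : (m : ℝ) * (m / μ) ≤ 1 / 2 := by
      rw [← mul_div_assoc, div_le_iff₀ hμ]; nlinarith
    linarith
  have h3 : (μ - m) ^ m = μ ^ m * (1 + -(m / μ)) ^ m := by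
    rw [← mul_pow]; congr 1; field_simp; ring
  have h4 : μ ^ m ≤ 2 * ∏ i ∈ Finset.range m, (μ - i) := by
    have : μ ^ m * (1 / 2) ≤ μ ^ m * (1 + -(m / μ)) ^ m := by gcongr
    linarith
  calc μ ^ m / m.factorial * interProb n k ^ m.choose 2
      ≤ (2 * ∏ i ∈ Finset.range m, (μ - i)) / m.factorial * interProb n k ^ m.choose 2 := by gcongr
    _ = _ := by ring

theorem mubar_big {ε : ℝ} {n k : ℕ} (h : PF ε n k) (p : ℝ)
    (hphi : Real.exp (-(ε / 2 * Real.log n)) ≤ phi n k p) (m : ℕ)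
    (hm : (m : ℝ) ≤ Real.log n ^ 3 / (3 * LL n k)) : 2 * (m : ℝ) ^ 2 ≤ mubar n k p := by
  have hkn := h.kn_le
  have l1 := h.l1
  have hL2 := h.L2
  have hL0 := h.L0
  have hP := h.P
  have hθ := h.θle
  have hn := h.npos
  have hk := h.kpos
  have e0 := h.e0
  set ℓ := Real.log n
  have h1 : (m : ℝ) ≤ ℓ ^ 3 / 3 * Real.exp ((1 / 4 - ε / 2) * ℓ) := by
    refine hm.trans ?_
    have : ℓ ^ 3 / (3 * LL n k) = ℓ ^ 3 / 3 * (1 / LL n k) := by field_simp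
    rw [this]; gcongr
  have h2 : (m : ℝ) ^ 2 ≤ ℓ ^ 6 / 9 * Real.exp ((1 / 2 - ε) * ℓ) := by
    calc (m : ℝ) ^ 2 ≤ (ℓ ^ 3 / 3 * Real.exp ((1 / 4 - ε / 2) * ℓ)) ^ 2 := by gcongr
      _ = ℓ ^ 6 / 9 * (Real.exp ((1 / 4 - ε / 2) * ℓ) * Real.exp ((1 / 4 - ε / 2) * ℓ)) := by ring
      _ = _ := by rw [← Real.exp_add]; congr 2; ring
  have h3 : ℓ ^ 8 ≤ Real.exp (ε / 2 * ℓ) := by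
    have h4 : ℓ ^ 4 ≤ Real.exp (ε ^ 2 / 16 * ℓ) := by
      have : 0 ≤ ℓ ^ 4 := by positivity
      linarith
    calc ℓ ^ 8 = ℓ ^ 4 * ℓ ^ 4 := by ring
      _ ≤ Real.exp (ε ^ 2 / 16 * ℓ) * Real.exp (ε ^ 2 / 16 * ℓ) := by gcongr
      _ = Real.exp (2 * (ε ^ 2 / 16) * ℓ) := by rw [← Real.exp_add]; congr 1; ring
      _ ≤ _ := by
        apply Real.exp_le_exp.2
        apply mul_le_mul_of_nonneg_right _ (by linarith)
        linarith
  have h5 : ℓ ^ 7 ≤ Real.exp (ε / 2 * ℓ) := (pow_le_pow_right₀ l1 (by norm_num)).trans h3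
  have h6 : phi n k p ≤ mubar n k p * (ℓ * Real.exp (-(ℓ / 2))) := by
    have hp0 : 0 ≤ phi n k p := le_trans (Real.exp_pos _).le hphi
    have e : phi n k p = mubar n k p * ((k : ℝ) / n) := by
      unfold mubar
      field_simp
    have hm0 : 0 ≤ mubar n k p := by unfold mubar; positivity
    calc phi n k p = mubar n k p * ((k : ℝ) / n) := e
      _ ≤ _ := mul_le_mul_of_nonneg_left hkn hm0
  have h7 : Real.exp ((1 / 2 - ε / 2) * ℓ) ≤ mubar n k p * ℓ := by
    have : Real.exp ((1 / 2 - ε / 2) * ℓ) = Real.exp (-(ε / 2 * ℓ)) * Real.exp (ℓ / 2) := by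
      rw [← Real.exp_add]; congr 1; ring
    rw [this]
    calc Real.exp (-(ε / 2 * ℓ)) * Real.exp (ℓ / 2)
        ≤ (mubar n k p * (ℓ * Real.exp (-(ℓ / 2)))) * Real.exp (ℓ / 2) := by
          gcongr; exact hphi.trans h6
      _ = mubar n k p * ℓ * (Real.exp (-(ℓ / 2)) * Real.exp (ℓ / 2)) := by ring
      _ = _ := by rw [← Real.exp_add]; simp
  have h8 : 2 * (m : ℝ) ^ 2 * ℓ ≤ mubar n k p * ℓ := by
    refine le_trans ?_ h7
    calc 2 * (m : ℝ) ^ 2 * ℓ ≤ 2 * (ℓ ^ 6 / 9 * Real.exp ((1 / 2 - ε) * ℓ)) * ℓ := by gcongr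
      _ = 2 / 9 * (ℓ ^ 7 * Real.exp ((1 / 2 - ε) * ℓ)) := by ring
      _ ≤ 1 * (Real.exp (ε / 2 * ℓ) * Real.exp ((1 / 2 - ε) * ℓ)) := by
        gcongr; norm_num
      _ = _ := by rw [one_mul, ← Real.exp_add]; congr 1; ring
  exact le_of_mul_le_mul_right h8 (by linarith)

theorem S0_bound {ε : ℝ} {n k : ℕ} (h : PF ε n k) (p s u : ℝ) (hp0 : 0 ≤ p) (hp1 : p ≤ 1)
    (hs : s < 1 / 100) (hu : u < 1 / 100)
    (hLam : hprob n k p (fun H => s < Lam n k p (maxDegree H)) < u)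
    (m : ℕ) (hm : m = gammaP n k p s) (hm1 : 1 ≤ m)
    (hII : LL n k * m < (1 + ε) * Real.log n) :
    mubar n k p ^ m / m.factorial * interProb n k ^ m.choose 2 ≤ 2 * s := by
  have l1 := h.l1
  have hL0 := h.L0
  have hL1 := h.Lθ
  have hθ := h.θle
  have e0 := h.e0
  have e4 := h.e4
  have hlθ := h.lθ
  have hθ0 := h.θpos
  have hfl : (⌊phiStar n k / 3⌋₊ : ℝ) ≤ Real.log n ^ 3 / (3 * LL n k) := by
    have e : phiStar n k / 3 = Real.log n ^ 3 / (3 * LL n k) := by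
      unfold phiStar LL; rw [div_div, mul_comm (3 : ℝ)]
    rw [← e]
    apply Nat.floor_le
    rw [e]; positivity
  have hmle : (m : ℝ) ≤ Real.log n ^ 3 / (3 * LL n k) := by
    refine le_trans ?_ hfl
    rw [hm]; unfold gammaP
    exact_mod_cast min_le_right _ _
  have hμ := mubar_big h p (phi_lower h p s u hp0 hp1 hs hu hLam) m hmle
  have hltfl : m < ⌊phiStar n k / 3⌋₊ := by
    have e : phiStar n k / 3 = Real.log n ^ 3 / (3 * LL n k) := by
      unfold phiStar LL; rw [div_div, mul_comm (3 : ℝ)]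
    have : ((m + 1 : ℕ) : ℝ) ≤ phiStar n k / 3 := by
      rw [e, le_div_iff₀ (by positivity)]
      push_cast
      have hl9 : 9 ≤ Real.log n := by
        have : (ε ^ 2 / 16) ^ 2 ≤ 1 / 9 := by nlinarith
        have := mul_le_mul_of_nonneg_right this (show 0 ≤ Real.log n by linarith)
        linarith
      have h3 : 81 * Real.log n ≤ Real.log n ^ 3 := by nlinarith [mul_self_nonneg (Real.log n)]
      have h4 : ε ^ 2 / 16 * Real.log n ≤ 1 * Real.log n :=
        mul_le_mul_of_nonneg_right (by linarith) (by linarith)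
      have h5 : (1 + ε) * Real.log n ≤ 2 * Real.log n :=
        mul_le_mul_of_nonneg_right (by linarith) (by linarith)
      nlinarith
    have := Nat.le_floor this
    omega
  have hα : alpha2 n k p s ≤ m := by
    have : m = alphaP n k p s := by
      unfold gammaP at hm
      rcases min_choice (alphaP n k p s) ⌊phiStar n k / 3⌋₊ with h' | h'
      · rw [hm, h']
      · omega
    rw [this]; exact le_max_right _ _
  have hne : {t : ℕ | Lam n k p t ≤ s}.Nonempty := by
    by_contra hc
    have hall : ∀ t, s < Lam n k p t := by
      intro t
      by_contra ht
      exact hc ⟨t, not_lt.1 ht⟩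
    have := prob_split (n := n) (k := k) hp0 hp1 (fun H => s < Lam n k p (maxDegree H))
      (fun H => s < Lam n k p (maxDegree H)) (fun H => Or.inl (hall _))
    linarith
  have hmem : Lam n k p (alpha2 n k p s) ≤ s := Nat.sInf_mem hne
  have h0 : Lam n k p 0 = 1 := by simp [Lam, gchoose]
  obtain ⟨a, ha⟩ : ∃ a, alpha2 n k p s = a + 1 := by
    rcases Nat.eq_zero_or_pos (alpha2 n k p s) with h' | h'
    · rw [h', h0] at hmem; linarith
    · exact ⟨_, (Nat.succ_pred_eq_of_pos h').symm⟩
  have hnot : s < Lam n k p a := by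
    have : a ∉ {t : ℕ | Lam n k p t ≤ s} := by
      apply Nat.notMem_of_lt_sInf
      change a < alpha2 n k p s
      omega
    simpa using this
  rw [ha] at hmem hα
  have hmμ : (m : ℝ) ≤ mubar n k p := by
    have : (1 : ℝ) ≤ m := by exact_mod_cast hm1
    nlinarith
  have := Lam_anti n k p h.q0 h.q1.le a m hmμ hα (by linarith)
  have h9 := S0_le n k p h.q0 m hμ hm1
  linarith

open Filter

theorem sum_bound {n m : ℕ} (S : Finset ℕ) (hS : S ⊆ Finset.range (m + 1)) (f : ℕ → ℝ) (B ℓ : ℝ)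
    (hB : 0 ≤ B) (hf : ∀ a ∈ S, f a ≤ B) (hmn : (m : ℝ) + 1 ≤ n) (hn : (n : ℝ) = Real.exp ℓ) :
    (n : ℝ) * ∑ a ∈ S, 2 * f a ≤ 2 * (Real.exp (2 * ℓ) * B) := by
  have h1 : ∑ a ∈ S, 2 * f a ≤ S.card • (2 * B) := by
    apply Finset.sum_le_card_nsmul
    intro a ha
    have := hf a ha
    linarith
  have h2 : (S.card : ℝ) ≤ n := by
    have := Finset.card_le_card hS
    rw [Finset.card_range] at this
    have : (S.card : ℝ) ≤ ((m + 1 : ℕ) : ℝ) := by exact_mod_cast this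
    push_cast at this
    linarith
  rw [nsmul_eq_mul] at h1
  have h3 : Real.exp (2 * ℓ) = n * n := by rw [hn, ← Real.exp_add]; congr 1; ring
  rw [h3]
  have hn0 : (0 : ℝ) ≤ n := by positivity
  calc (n : ℝ) * ∑ a ∈ S, 2 * f a ≤ n * (n * (2 * B)) := by
        apply mul_le_mul_of_nonneg_left _ hn0
        exact h1.trans (mul_le_mul_of_nonneg_right h2 (by linarith))
    _ = _ := by ring

set_option maxHeartbeats 1000000 in
theorem fixed_bound {ε : ℝ} {n k : ℕ} (h : PF ε n k) (p s u : ℝ) (hp0 : 0 ≤ p) (hp1 : p ≤ 1)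
    (hs : s < 1 / 100) (hu : u < 1 / 100)
    (hLam : hprob n k p (fun H => s < Lam n k p (maxDegree H)) < u)
    (hφ : phi n k p ≤ phiStar n k) :
    hprob n k p (fun H => ∃ C ⊆ H, IsClique C ∧ C.card = gammaP n k p s ∧
        (∀ x y : Fin n, lamP n k < (vdeg C x : ℝ) → lamP n k < (vdeg C y : ℝ) → x = y) ∧
        (∀ x : Fin n, (vdeg C x : ℝ) < tauP ε n k p s)) ≤
      2 * Real.exp (-Real.log n) + 2 * Real.exp (-(ε / 4 * Real.log n)) +
        2 * Real.exp (-(2 * Real.log n)) + 8 * |s| := by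
  have hR : 0 ≤ 2 * Real.exp (-Real.log n) + 2 * Real.exp (-(ε / 4 * Real.log n)) +
        2 * Real.exp (-(2 * Real.log n)) + 8 * |s| := by positivity
  rcases Nat.eq_zero_or_pos (gammaP n k p s) with hm0 | hm1
  · refine le_trans (le_trans (hprob_mono hp0 hp1 (Q := fun _ => False) ?_) ?_) hR
    · rintro H - ⟨C, -, -, -, -, hx⟩
      have hn : 0 < n := by exact_mod_cast h.npos
      have := hx ⟨0, hn⟩
      unfold tauP at this
      rw [hm0] at this
      simp only [Nat.cast_zero, mul_zero] at this
      exact absurd this (not_lt.2 (Nat.cast_nonneg _))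
    · simp [hprob]
  · have hφ8 := phi_le n k p s hp0 hp1 h.lpos hm1 hφ
    have hτ : tauP ε n k p s = (1 - ε) * (gammaP n k p s : ℝ) := rfl
    have hS0 := fun hII => S0_bound h p s u hp0 hp1 hs hu hLam (gammaP n k p s) rfl hm1 hII
    have hmle : (gammaP n k p s : ℝ) ≤ Real.log n ^ 3 / (3 * LL n k) := by
      have e : phiStar n k / 3 = Real.log n ^ 3 / (3 * LL n k) := by
        unfold phiStar LL; rw [div_div, mul_comm (3 : ℝ)]
      have hL0 := h.L0
      have hl := h.lpos
      have hfl : (⌊phiStar n k / 3⌋₊ : ℝ) ≤ phiStar n k / 3 := by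
        apply Nat.floor_le
        rw [e]; positivity
      rw [e] at hfl
      refine le_trans ?_ hfl
      rw [← e]
      unfold gammaP
      exact_mod_cast min_le_right _ _
    generalize gammaP n k p s = m at *
    generalize tauP ε n k p s = τ at *
    subst hτ
    obtain ⟨hK0, hKn, hk2, hζ, hη, hmn⟩ := h.loss m hmle _ rfl
    have hlam := h.lampos
    have hlog2 : (1 : ℝ) / 2 ≤ Real.log 2 := by have := Real.log_two_gt_d9; linarith
    have hL0 := h.L0
    have hl := h.lpos
    have l1 := h.l1
    have e0 := h.e0
    have e4 := h.e4
    have hn := h.npos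
    have hk := h.kpos
    have hq0 := h.q0
    have hθ := h.θle
    have hθ0 := h.θpos
    have hne := h.n0
    have hkn : k ≤ n := by have := h.k2; omega
    set K := 2 * (m : ℝ) ^ 2 * k ^ 2 / n + 3 * lamP n k * m * Real.log n with hK
    have hub := union_bound (n := n) k p hp0 hp1 h.k1 hq0 (lamP n k) K ((1 - ε) * m) hlam hK0 hKn hk2 hζ m
      _ le_rfl (by
        have : 0 ≤ Real.log (1 / interProb n k) := h.L0.le
        positivity) (le_trans hη hlog2)
    refine hub.trans ?_
    rw [← mubar_eq n k p h.k1 hkn]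
    have hphi0 : 0 ≤ phi n k p := by unfold phi; positivity
    have hr0 : 0 < (n : ℝ) / k := by positivity
    have hμ : mubar n k p = phi n k p * ((n : ℝ) / k) := by unfold mubar; ring
    have h100 : 100 ≤ Real.exp (ε ^ 2 / 16 * Real.log n) := by
      have := h.P
      have : 1 ≤ Real.log n ^ 4 := one_le_pow₀ l1
      linarith
    have hφm : phi n k p ≤ m * Real.exp (ε ^ 2 / 16 * Real.log n) := by
      refine hφ8.trans ?_
      rw [mul_comm]; gcongr; linarith
    have h2e : 2 * Real.exp 1 ≤ Real.exp (ε ^ 2 / 16 * Real.log n) := by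
      have := Real.exp_one_lt_d9
      linarith
    have hm1' : (1 : ℝ) ≤ m := by exact_mod_cast hm1
    have hw : (k : ℝ) / n = 1 / ((n : ℝ) / k) := by rw [one_div_div]
    have T1 : ((n : ℝ) + 1) * (mubar n k p ^ m / m.factorial *
        Real.exp (2 * (m : ℝ) ^ 2 * k ^ 2 / (n * lamP n k) - K / lamP n k)) ≤
        2 * Real.exp (-Real.log n) := by
      have e : 2 * (m : ℝ) ^ 2 * k ^ 2 / (n * lamP n k) - K / lamP n k = -(3 * m * Real.log n) := by
        rw [hK]; field_simp; ring
      rw [e, hμ]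
      have ht := term_bad m hm1 (phi n k p) ((n : ℝ) / k) (Real.log n) (ε ^ 2 / 16) hphi0 hr0 hφm h.hr h2e
        (by linarith) hl.le
      have hn1 : (n : ℝ) + 1 ≤ 2 * n := by linarith
      calc _ ≤ (2 * (n : ℝ)) * Real.exp (-(2 * Real.log n)) := by gcongr
        _ = 2 * (Real.exp (Real.log n) * Real.exp (-(2 * Real.log n))) := by rw [← hne]; ring
        _ = _ := by rw [← Real.exp_add]; congr 2; ring
    have hlg := h.lam_ge
    have hsub : (Finset.range (m + 1)).filter (fun a : ℕ => lamP n k < (a : ℝ) ∧ (a : ℝ) < (1 - ε) * m) ⊆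
      Finset.range (m + 1) := Finset.filter_subset _ _
    have hsabs := le_abs_self s
    by_cases hI : (1 + ε) * Real.log n ≤ LL n k * m
    · have T2 : mubar n k p ^ m / m.factorial * interProb n k ^ (m.choose 2) ≤
          Real.exp (-(ε / 4 * Real.log n)) := by
        have := term_caseI m 0 m (by simp) hm1 (phi n k p) ((n : ℝ) / k) (interProb n k) (LL n k)
          (Real.log n) (ε ^ 2 / 16) ε hphi0 hr0 h.qe hφm h.hr h2e hL0.le h.Lθ hI (by nlinarith) e0 e4 hl.le rfl
        simp only [Nat.factorial_zero, Nat.cast_one, one_mul, pow_zero, mul_one, zero_mul, zero_add] at this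
        rw [hμ]
        refine this.trans (Real.exp_le_exp.2 ?_)
        have : ε / 4 * Real.log n * 1 ≤ ε / 4 * Real.log n * m := by gcongr
        linarith
      have T3 := sum_bound _ hsub (fun a : ℕ => mubar n k p ^ m / (a.factorial * (m - a).factorial) *
          ((k : ℝ) / n) ^ a * interProb n k ^ (a * (m - a) + (m - a).choose 2))
          (Real.exp (-(4 * Real.log n))) (Real.log n) (Real.exp_pos _).le (by
            intro a ha
            rw [Finset.mem_filter, Finset.mem_range] at ha
            obtain ⟨ha1, ha2, ha3⟩ := ha
            have hbr : ((m - a : ℕ) : ℝ) = m - a := by rw [Nat.cast_sub (by omega)]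
            have hb : ε * m ≤ ((m - a : ℕ) : ℝ) := by rw [hbr]; linarith
            have := term_caseI m a (m - a) (by omega) hm1 (phi n k p) ((n : ℝ) / k) (interProb n k) (LL n k)
              (Real.log n) (ε ^ 2 / 16) ε hphi0 hr0 h.qe hφm h.hr h2e hL0.le h.Lθ hI hb e0 e4 hl.le rfl
            rw [hμ, hw]
            refine this.trans (Real.exp_le_exp.2 ?_)
            have ham : (a : ℝ) ≤ m := by exact_mod_cast (by omega : a ≤ m)
            have h16 : 16 / ε ^ 2 ≤ m := by linarith
            have h17 : 16 ≤ m * ε ^ 2 := by rwa [div_le_iff₀ (by positivity)] at h16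
            have h18 : 4 ≤ ε / 4 * ((m - a : ℕ) : ℝ) := by
              have : ε / 4 * (ε * m) ≤ ε / 4 * ((m - a : ℕ) : ℝ) := by gcongr
              linarith
            have := mul_le_mul_of_nonneg_right h18 hl.le
            linarith) hmn hne
      have hee : Real.exp (2 * Real.log n) * Real.exp (-(4 * Real.log n)) = Real.exp (-(2 * Real.log n)) := by
        rw [← Real.exp_add]; congr 1; ring
      rw [hee] at T3
      have := abs_nonneg s
      linarith
    · push Not at hI
      have hS := hS0 hI
      have hmu0 : 0 ≤ mubar n k p := by rw [hμ]; positivity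
      set S0 := mubar n k p ^ m / m.factorial * interProb n k ^ (m.choose 2) with hS0d
      have hS00 : 0 ≤ S0 := by positivity
      have T3 := sum_bound _ hsub (fun a : ℕ => mubar n k p ^ m / (a.factorial * (m - a).factorial) *
          ((k : ℝ) / n) ^ a * interProb n k ^ (a * (m - a) + (m - a).choose 2))
          (S0 * Real.exp (-(4 * Real.log n))) (Real.log n) (by positivity) (by
            intro a ha
            rw [Finset.mem_filter, Finset.mem_range] at ha
            obtain ⟨ha1, ha2, ha3⟩ := ha
            have := term_caseII m a (m - a) (by omega) (mubar n k p) ((k : ℝ) / n) (interProb n k) (LL n k)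
              (Real.log n) (ε ^ 2 / 16) ε (lamP n k) hmu0 (by positivity) h.qe hlam ha2 (h.m_lam m hmle)
              hL0.le hI.le ha3.le e0 e4 hl.le (by linarith)
            refine this.trans ?_
            apply mul_le_mul_of_nonneg_left _ hS00
            apply Real.exp_le_exp.2
            have h16 : 16 / ε ^ 2 ≤ a := by linarith
            have h17 : 16 ≤ a * ε ^ 2 := by rwa [div_le_iff₀ (by positivity)] at h16
            have := mul_le_mul_of_nonneg_right h17 hl.le
            linarith) hmn hne
      have hee : Real.exp (2 * Real.log n) * (S0 * Real.exp (-(4 * Real.log n))) ≤ S0 := by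
        have : Real.exp (2 * Real.log n) * (S0 * Real.exp (-(4 * Real.log n))) =
            S0 * Real.exp (-(2 * Real.log n)) := by
          rw [mul_left_comm, ← Real.exp_add]; congr 2; ring
        rw [this]
        apply mul_le_of_le_one_right hS00
        rw [Real.exp_le_one_iff]; linarith
      have x1 := Real.exp_pos (-(ε / 4 * Real.log n))
      have x2 := Real.exp_pos (-(2 * Real.log n))
      linarith

theorem bound_tendsto (ε : ℝ) (hε : 0 < ε) (σ : ℕ → ℝ) (hσ : Tendsto σ atTop (nhds 0)) :
    Tendsto (fun n : ℕ => 2 * Real.exp (-Real.log n) + 2 * Real.exp (-(ε / 4 * Real.log n)) +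
        2 * Real.exp (-(2 * Real.log n)) + 8 * |σ n|) atTop (nhds 0) := by
  have hl : Tendsto (fun n : ℕ => Real.log (n : ℝ)) atTop atTop :=
    Real.tendsto_log_atTop.comp tendsto_natCast_atTop_atTop
  have key : ∀ c : ℝ, 0 < c → Tendsto (fun n : ℕ => 2 * Real.exp (-(c * Real.log n))) atTop (nhds 0) := by
    intro c hc
    have := (Real.tendsto_exp_neg_atTop_nhds_zero.comp (hl.const_mul_atTop hc)).const_mul 2
    simpa using this
  have h1 := key 1 one_pos
  have h2 := key (ε / 4) (by positivity)
  have h3 := key 2 two_pos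
  have h4 := (hσ.abs).const_mul 8
  have := ((h1.add h2).add h3).add h4
  simpa using this

/-- **Lemma C.** Under the standing assumptions, almost surely `H = H_k(n,p)` contains
no clique of size `γ` having at most one vertex of clique-degree greater than `λ` and
maximum clique-degree less than `τ`. -/
theorem no_generic_clique
    (ε : ℝ) (hε0 : 0 < ε) (hε14 : ε < 1 / 4)
    (k : ℕ → ℕ) (p : ℕ → ℝ)
    (hp0 : ∀ n, 0 ≤ p n) (hp1 : ∀ n, p n ≤ 1)
    (hnk : ∀ᶠ n in atTop, 2 * k n < n)
    (δ : ℕ → ℝ) (hδ : Tendsto δ atTop (nhds 0))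
    (hklow : ∀ᶠ n : ℕ in atTop, (n : ℝ) ^ ((1 : ℝ) / 2 - δ n) < (k n : ℝ))
    (hkup : ∀ᶠ n in atTop, (k n : ℝ) < Real.sqrt ((1 / 4 - ε) * n * Real.log n))
    (σ υ : ℕ → ℝ) (hσ : Tendsto σ atTop (nhds 0)) (hυ : Tendsto υ atTop (nhds 0))
    (hLam : ∀ᶠ n in atTop,
      hprob n (k n) (p n) (fun H => σ n < Lam n (k n) (p n) (maxDegree H)) < υ n)
    (hφ : ∀ᶠ n in atTop, phi n (k n) (p n) ≤ phiStar n (k n))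
    :
    Tendsto (fun n => hprob n (k n) (p n) (fun H =>
      ¬ ∃ C ⊆ H, IsClique C ∧ C.card = gammaP n (k n) (p n) (σ n) ∧
        (∀ x y : Fin n, lamP n (k n) < (vdeg C x : ℝ) →
          lamP n (k n) < (vdeg C y : ℝ) → x = y) ∧
        (∀ x : Fin n, (vdeg C x : ℝ) < tauP ε n (k n) (p n) (σ n))))
      atTop (nhds 1) := by
  have hbad : Tendsto (fun n => hprob n (k n) (p n) (fun H =>
      ∃ C ⊆ H, IsClique C ∧ C.card = gammaP n (k n) (p n) (σ n) ∧
        (∀ x y : Fin n, lamP n (k n) < (vdeg C x : ℝ) →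
          lamP n (k n) < (vdeg C y : ℝ) → x = y) ∧
        (∀ x : Fin n, (vdeg C x : ℝ) < tauP ε n (k n) (p n) (σ n)))) atTop (nhds 0) := by
    refine squeeze_zero' (Eventually.of_forall fun n => hprob_nonneg (hp0 n) (hp1 n) _) ?_
      (bound_tendsto ε hε0 σ hσ)
    filter_upwards [eventually_PF ε hε0 hε14 k hnk δ hδ hklow hkup,
      hσ.eventually (gt_mem_nhds (show (0 : ℝ) < 1 / 100 by norm_num)),
      hυ.eventually (gt_mem_nhds (show (0 : ℝ) < 1 / 100 by norm_num)), hLam, hφ]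
      with n hPF hs hu hL hf
    exact fixed_bound hPF (p n) (σ n) (υ n) (hp0 n) (hp1 n) hs hu hL hf
  have h1 := hbad.const_sub 1
  rw [sub_zero] at h1
  refine h1.congr (fun n => ?_)
  exact (hprob_not _).symm
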